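/- Let d ≥ 1, p ∈ (1, ∞), and λ > 0. There exists a constant C, depending only on p, d, and λ, with the following property. Let Q ⊂ ℝ^d be a bounded open cube, let G : Q → ℝ^{d×d} be a measurable map taking values in the symmetric positive definite matrices with λ⁻¹‖v‖² ≤ vᵀG(x)v ≤ λ‖v‖² for all v ∈ ℝ^d and x ∈ Q, let u : Q → ℝ^d be continuously differentiable, and let x₀ ∈ Q. Then there exists a matrix R ∈ ℝ^{d×d} with RᵀR = G(x₀) and det R > 0 such that ∫_Q |Du(x) − R|_{G(x)}^p dx ≤ C·( |Q|·(osc_Q G)^p + ∫_Q dist_{G(x)}(Du(x), SO(G(x)))^p dx ), where the integrals are taken in [0, ∞] with respect to Lebesgue measure, |Q| is the Lebesgue measure of Q, and osc_Q G := sup{‖G(x) − G(y)‖_F : x, y ∈ Q}. -/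

import Mathlib

open Matrix MeasureTheory

/-- Frobenius norm of a real matrix. -/
noncomputable def frob {m n : Type*} [Fintype m] [Fintype n]
    (A : Matrix m n ℝ) : ℝ := Real.sqrt (∑ i, ∑ j, (A i j) ^ 2)

/-- The `G`-Frobenius norm of a `d × d` matrix: `|A|_G = √(trace (A G⁻¹ Aᵀ))`. -/
noncomputable def frobG {d : ℕ} (G : Matrix (Fin d) (Fin d) ℝ)
    (A : Matrix (Fin d) (Fin d) ℝ) : ℝ := Real.sqrt ((A * G⁻¹ * Aᵀ).trace)

/-- `SO(G)`: matrices representing orientation-preserving linear isometries from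
`(ℝ^d, G)` to Euclidean `ℝ^d`. -/
def SOset (d : ℕ) (G : Matrix (Fin d) (Fin d) ℝ) : Set (Matrix (Fin d) (Fin d) ℝ) :=
  {R | Rᵀ * R = G ∧ 0 < R.det}

/-- The distance, in the `G`-Frobenius norm, from a matrix to a set of matrices. -/
noncomputable def distG {d : ℕ} (G : Matrix (Fin d) (Fin d) ℝ)
    (A : Matrix (Fin d) (Fin d) ℝ) (S : Set (Matrix (Fin d) (Fin d) ℝ)) : ℝ :=
  sInf {r : ℝ | ∃ R ∈ S, r = frobG G (A - R)}

/-- The Jacobian matrix of `u` at `x`. -/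
noncomputable def jac {d : ℕ} (u : (Fin d → ℝ) → (Fin d → ℝ))
    (x : Fin d → ℝ) : Matrix (Fin d) (Fin d) ℝ :=
  Matrix.of fun i j => fderiv ℝ u x (Pi.single j 1) i

/-- The oscillation of a matrix field `G` over a set `Q`, in the Frobenius norm. -/
noncomputable def oscG {d : ℕ} (G : (Fin d → ℝ) → Matrix (Fin d) (Fin d) ℝ)
    (Q : Set (Fin d → ℝ)) : ℝ :=
  sSup {r : ℝ | ∃ x ∈ Q, ∃ y ∈ Q, r = frob (G x - G y)}

namespace Rigidity
open Metric Set Filter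
open scoped ENNReal NNReal Topology

theorem mem_closedBall_pi {d : ℕ} {c x : Fin d → ℝ} {r : ℝ} (hr : 0 ≤ r) :
    x ∈ closedBall c r ↔ ∀ i, c i - r ≤ x i ∧ x i ≤ c i + r := by
  rw [mem_closedBall, dist_pi_le_iff hr]
  refine forall_congr' fun i => ?_
  rw [Real.dist_eq, abs_le]
  constructor <;> rintro ⟨h1, h2⟩ <;> constructor <;> linarith

theorem volume_closedBall {d : ℕ} (c : Fin d → ℝ) {r : ℝ} (hr : 0 ≤ r) :
    volume (closedBall c r) = ENNReal.ofReal ((2 * r) ^ d) := by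
  rw [Real.volume_pi_closedBall c hr, Fintype.card_fin]

theorem volume_closedBall_pos {d : ℕ} (c : Fin d → ℝ) {r : ℝ} (hr : 0 < r) :
    volume (closedBall c r) ≠ 0 := by
  rw [volume_closedBall c hr.le]
  simpa using pow_pos (by linarith : 0 < 2 * r) d

theorem volume_closedBall_ne_top {d : ℕ} (c : Fin d → ℝ) (r : ℝ) :
    volume (closedBall c r) ≠ ∞ := measure_closedBall_lt_top.ne

theorem volume_closedBall_mul {d : ℕ} (c c' : Fin d → ℝ) {r t : ℝ} (hr : 0 ≤ r) (ht : 0 ≤ t) :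
    volume (closedBall c (t * r)) = ENNReal.ofReal (t ^ d) * volume (closedBall c' r) := by
  rw [volume_closedBall c (by positivity), volume_closedBall c' hr,
    ← ENNReal.ofReal_mul (by positivity)]
  congr 1
  ring

/-- Centers of the `N ^ d` congruent subcubes of the cube `closedBall c r`. -/
noncomputable def gridCenter {d : ℕ} (N : ℕ) (c : Fin d → ℝ) (r : ℝ) (n : Fin d → Fin N) :
    Fin d → ℝ :=
  fun i => c i - r + (2 * ((n i : ℕ) : ℝ) + 1) * (r / N)

theorem closedBall_gridCenter_subset {d N : ℕ} (hN : 0 < N) (c : Fin d → ℝ) {r : ℝ} (hr : 0 ≤ r)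
    (n : Fin d → Fin N) : closedBall (gridCenter N c r n) (r / N) ⊆ closedBall c r := by
  intro x hx
  have hN' : (0 : ℝ) < N := by exact_mod_cast hN
  have hρ : 0 ≤ r / N := by positivity
  rw [mem_closedBall_pi hρ] at hx
  rw [mem_closedBall_pi hr]
  intro i
  have h1 : ((n i : ℕ) : ℝ) + 1 ≤ N := by exact_mod_cast (n i).2
  have h0 : (0 : ℝ) ≤ ((n i : ℕ) : ℝ) := by positivity
  have h2 := hx i
  simp only [gridCenter] at h2
  have h3 : N * (r / N) = r := by field_simp
  constructor
  · nlinarith [mul_nonneg h0 hρ]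
  · nlinarith [mul_le_mul_of_nonneg_right h1 hρ]

theorem iUnion_grid {d N : ℕ} (hN : 0 < N) (c : Fin d → ℝ) {r : ℝ} (hr : 0 < r) :
    ⋃ n : Fin d → Fin N, closedBall (gridCenter N c r n) (r / N) = closedBall c r := by
  apply subset_antisymm
  · exact iUnion_subset fun n => closedBall_gridCenter_subset hN c hr.le n
  · intro x hx
    have hN' : (0 : ℝ) < N := by exact_mod_cast hN
    have hρ : 0 < r / N := by positivity
    have h3 : N * (r / N) = r := by field_simp
    rw [mem_closedBall_pi hr.le] at hx
    rw [mem_iUnion]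
    have key : ∀ i, ∃ k : Fin N, c i - r + 2 * ((k : ℕ) : ℝ) * (r / N) ≤ x i ∧
        x i ≤ c i - r + (2 * ((k : ℕ) : ℝ) + 2) * (r / N) := by
      intro i
      obtain ⟨h1, h2⟩ := hx i
      set t := (x i - c i + r) / (2 * (r / N)) with ht
      have ht' : t * (2 * (r / N)) = x i - c i + r := by rw [ht]; field_simp
      have ht0 : 0 ≤ t := by rw [ht]; apply div_nonneg <;> linarith
      have htN : t ≤ N := by
        rw [ht, div_le_iff₀ (by positivity)]; linarith
      by_cases hlt : t < N
      · refine ⟨⟨⌊t⌋₊, (Nat.floor_lt ht0).2 hlt⟩, ?_, ?_⟩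
        · have := Nat.floor_le ht0
          simp only
          nlinarith
        · have := (Nat.lt_floor_add_one t).le
          simp only
          nlinarith
      · have : t = N := le_antisymm htN (not_lt.1 hlt)
        refine ⟨⟨N - 1, by omega⟩, ?_, ?_⟩
        · simp only
          rw [Nat.cast_sub (by omega)]
          push_cast
          nlinarith
        · simp only
          rw [Nat.cast_sub (by omega)]
          push_cast
          nlinarith
    choose n hn using key
    refine ⟨n, ?_⟩
    rw [mem_closedBall_pi hρ.le]
    intro i
    have := hn i
    simp only [gridCenter]
    constructor <;> linarith [this.1, this.2]

theorem aedisjoint_grid {d N : ℕ} (c : Fin d → ℝ) {r : ℝ} (hr : 0 < r) :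
    Pairwise (Function.onFun (AEDisjoint volume)
      fun n : Fin d → Fin N => closedBall (gridCenter N c r n) (r / N)) := by
  have main : ∀ n m : Fin d → Fin N, ∀ i, n i < m i →
      AEDisjoint volume (closedBall (gridCenter N c r n) (r / N))
        (closedBall (gridCenter N c r m) (r / N)) := by
    intro n m i hi
    have hN : 0 < N := (Nat.zero_le _).trans_lt (n i).2
    have hN' : (0 : ℝ) < N := by exact_mod_cast hN
    have hρ : 0 < r / N := by positivity
    refine measure_mono_null (t := {x : Fin d → ℝ | x i = c i - r + 2 * ((m i : ℕ) : ℝ) * (r / N)})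
      ?_ (Measure.pi_hyperplane _ _ _)
    rintro x ⟨h1, h2⟩
    rw [mem_closedBall_pi hρ.le] at h1 h2
    have h1 := (h1 i).2
    have h2 := (h2 i).1
    have h3 : ((n i : ℕ) : ℝ) + 1 ≤ ((m i : ℕ) : ℝ) := by exact_mod_cast hi
    simp only [gridCenter] at h1 h2
    simp only [mem_ofPred_eq]
    nlinarith
  intro n m hnm
  obtain ⟨i, hi⟩ := Function.ne_iff.1 hnm
  rcases lt_or_gt_of_ne hi with h | h
  · exact main n m i h
  · exact (main m n i h).symm

theorem lintegral_grid {d N : ℕ} (hN : 0 < N) (c : Fin d → ℝ) {r : ℝ} (hr : 0 < r)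
    (f : (Fin d → ℝ) → ℝ≥0∞) :
    ∫⁻ x in closedBall c r, f x =
      ∑ n : Fin d → Fin N, ∫⁻ x in closedBall (gridCenter N c r n) (r / N), f x := by
  rw [← iUnion_grid hN c hr, Measure.restrict_iUnion_ae (aedisjoint_grid c hr)
    (fun n => measurableSet_closedBall.nullMeasurableSet), lintegral_sum_measure, tsum_fintype]

theorem volume_grid {d N : ℕ} (hN : 0 < N) (c : Fin d → ℝ) {r : ℝ} (hr : 0 < r) :
    volume (closedBall c r) =
      ∑ n : Fin d → Fin N, volume (closedBall (gridCenter N c r n) (r / N)) := by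
  have := lintegral_grid hN c hr (fun _ => 1)
  simpa using this

section FeffermanStein

variable {d : ℕ} {E : Type*} [NormedAddCommGroup E] [NormedSpace ℝ E]

/-- The average of `f` over a closed cube. -/
noncomputable def cubeAvg (f : (Fin d → ℝ) → E) (c : Fin d → ℝ) (r : ℝ) : E :=
  ⨍ x in closedBall c r, f x

theorem enorm_cubeAvg_sub_mul_le [CompleteSpace E] {f : (Fin d → ℝ) → E} {c : Fin d → ℝ}
    {r : ℝ} (hr : 0 < r)
    (hf : IntegrableOn f (closedBall c r)) (y : E) :
    ‖cubeAvg f c r - y‖ₑ * volume (closedBall c r) ≤ ∫⁻ x in closedBall c r, ‖f x - y‖ₑ := by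
  have hv := volume_closedBall_pos c hr
  have hv' := volume_closedBall_ne_top c r
  have h1 : cubeAvg f c r - y = ⨍ x in closedBall c r, (f x - y) := by
    rw [cubeAvg, setAverage_eq, setAverage_eq,
      integral_sub hf (integrableOn_const hv'), smul_sub, setIntegral_const, smul_smul,
      inv_mul_cancel₀, one_smul]
    rw [Measure.real, ENNReal.toReal_ne_zero]
    exact ⟨hv, hv'⟩
  rw [h1, setAverage_eq, enorm_smul]
  have h2 : ‖(volume.real (closedBall c r))⁻¹‖ₑ = (volume (closedBall c r))⁻¹ := by
    rw [enorm_inv, Measure.real, Real.enorm_eq_ofReal ENNReal.toReal_nonneg,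
      ENNReal.ofReal_toReal hv']
    rw [Measure.real, ENNReal.toReal_ne_zero]
    exact ⟨hv, hv'⟩
  rw [h2, mul_comm, ← mul_assoc, ENNReal.mul_inv_cancel hv hv', one_mul]
  exact enorm_integral_le_lintegral_enorm _

open Classical in
/-- The measure of the union of those cubes, among the first `n` dyadic generations below
`closedBall c r`, which have a child where the average of `f` is farther than `t` from `y`. -/
noncomputable def badVolume (f : (Fin d → ℝ) → E) : ℕ → (Fin d → ℝ) → ℝ → E → ℝ → ℝ≥0∞
  | 0, _, _, _, _ => 0
  | n + 1, c, r, y, t =>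
    if ∃ m : Fin d → Fin 2, t < ‖cubeAvg f (gridCenter 2 c r m) (r / 2) - y‖ then
      volume (closedBall c r)
    else ∑ m : Fin d → Fin 2, badVolume f n (gridCenter 2 c r m) (r / 2) y t

theorem closedBall_child_subset (c : Fin d → ℝ) {r : ℝ} (hr : 0 ≤ r) (m : Fin d → Fin 2) :
    closedBall (gridCenter 2 c r m) (r / 2) ⊆ closedBall c r := by
  simpa using closedBall_gridCenter_subset (N := 2) (by norm_num) c hr m

theorem lintegral_children (c : Fin d → ℝ) {r : ℝ} (hr : 0 < r) (f : (Fin d → ℝ) → ℝ≥0∞) :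
    ∫⁻ x in closedBall c r, f x =
      ∑ m : Fin d → Fin 2, ∫⁻ x in closedBall (gridCenter 2 c r m) (r / 2), f x := by
  simpa using lintegral_grid (N := 2) (by norm_num) c hr f

theorem volume_children (c : Fin d → ℝ) {r : ℝ} (hr : 0 < r) :
    volume (closedBall c r) =
      ∑ m : Fin d → Fin 2, volume (closedBall (gridCenter 2 c r m) (r / 2)) := by
  simpa using volume_grid (N := 2) (by norm_num) c hr

theorem volume_eq_child (c c' : Fin d → ℝ) {r : ℝ} (hr : 0 < r) :
    volume (closedBall c r) = 2 ^ d * volume (closedBall c' (r / 2)) := by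
  have := volume_closedBall_mul c c' (r := r / 2) (t := 2) (by positivity) (by norm_num)
  rw [show 2 * (r / 2) = r by ring] at this
  rw [this]
  congr 1
  rw [ENNReal.ofReal_pow (by norm_num)]
  simp

theorem badVolume_le_volume (f : (Fin d → ℝ) → E) (n : ℕ) (c : Fin d → ℝ) {r : ℝ} (hr : 0 < r)
    (y : E) (t : ℝ) : badVolume f n c r y t ≤ volume (closedBall c r) := by
  induction n generalizing c r with
  | zero => simp [badVolume]
  | succ n ih =>
    rw [badVolume]
    split_ifs
    · exact le_rfl
    · rw [volume_children c hr]
      exact Finset.sum_le_sum fun m _ => ih _ (by positivity)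

theorem badVolume_mono (f : (Fin d → ℝ) → E) (n : ℕ) (c : Fin d → ℝ) {r : ℝ} (hr : 0 < r)
    {y y' : E} {t t' : ℝ} (h : t' + ‖y - y'‖ ≤ t) :
    badVolume f n c r y t ≤ badVolume f n c r y' t' := by
  induction n generalizing c r with
  | zero => simp [badVolume]
  | succ n ih =>
    rw [badVolume, badVolume]
    have key : ∀ z, t < ‖z - y‖ → t' < ‖z - y'‖ := by
      intro z hz
      have : ‖z - y‖ ≤ ‖z - y'‖ + ‖y - y'‖ := by
        rw [norm_sub_rev y y']
        exact norm_sub_le_norm_sub_add_norm_sub z y' y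
      linarith
    split_ifs with h1 h2 h2
    · exact le_rfl
    · exact absurd (h1.imp fun m hm => key _ hm) h2
    · rw [volume_children c hr]
      exact Finset.sum_le_sum fun m _ => badVolume_le_volume f n _ (by positivity) _ _
    · exact Finset.sum_le_sum fun m _ => ih _ (by positivity)

theorem ofReal_mul_badVolume_le [CompleteSpace E] {f : (Fin d → ℝ) → E} (n : ℕ) {c : Fin d → ℝ}
    {r : ℝ}
    (hr : 0 < r) (hf : IntegrableOn f (closedBall c r)) (y : E) (t : ℝ) :
    ENNReal.ofReal t * badVolume f n c r y t ≤ 2 ^ d * ∫⁻ x in closedBall c r, ‖f x - y‖ₑ := by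
  induction n generalizing c r with
  | zero => simp [badVolume]
  | succ n ih =>
    rw [badVolume]
    split_ifs with h
    · obtain ⟨m, hm⟩ := h
      have hs := closedBall_child_subset c hr.le m
      have h1 := enorm_cubeAvg_sub_mul_le (by positivity) (hf.mono_set hs) y
      rw [volume_eq_child c (gridCenter 2 c r m) hr, mul_left_comm]
      gcongr
      calc _ ≤ ‖cubeAvg f (gridCenter 2 c r m) (r / 2) - y‖ₑ *
            volume (closedBall (gridCenter 2 c r m) (r / 2)) := by
            gcongr
            rw [← ofReal_norm]
            exact ENNReal.ofReal_le_ofReal hm.le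
        _ ≤ _ := h1
        _ ≤ _ := lintegral_mono_set hs
    · rw [lintegral_children c hr, Finset.mul_sum, Finset.mul_sum]
      exact Finset.sum_le_sum fun m _ =>
        ih (by positivity) (hf.mono_set (closedBall_child_subset c hr.le m))

theorem exists_badVolume_eq_zero (f : (Fin d → ℝ) → E) (n : ℕ) (c : Fin d → ℝ) (r : ℝ) (y : E) :
    ∃ T : ℝ, ∀ t, T ≤ t → badVolume f n c r y t = 0 := by
  induction n generalizing c r with
  | zero => exact ⟨0, fun t _ => by simp [badVolume]⟩
  | succ n ih =>
    choose T hT using fun m : Fin d → Fin 2 => ih (gridCenter 2 c r m) (r / 2)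
    refine ⟨∑ m, (|T m| + ‖cubeAvg f (gridCenter 2 c r m) (r / 2) - y‖), fun t ht => ?_⟩
    have h1 : ∀ m, |T m| + ‖cubeAvg f (gridCenter 2 c r m) (r / 2) - y‖ ≤ t := fun m =>
      (Finset.single_le_sum (f := fun m => |T m| + ‖cubeAvg f (gridCenter 2 c r m) (r / 2) - y‖)
        (fun i _ => by positivity) (Finset.mem_univ m)).trans ht
    rw [badVolume, if_neg, Finset.sum_eq_zero]
    · intro m _
      refine hT m t ?_
      linarith [h1 m, le_abs_self (T m), norm_nonneg (cubeAvg f (gridCenter 2 c r m) (r / 2) - y)]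
    · rintro ⟨m, hm⟩
      linarith [h1 m, abs_nonneg (T m)]

theorem volume_inter_le_badVolume {f : (Fin d → ℝ) → E} {V : Set (Fin d → ℝ)} {y : E} {t : ℝ}
    (n : ℕ) (c : Fin d → ℝ) {r : ℝ} (hr : 0 < r)
    (hV : ∀ x ∈ V, ∀ w, x ∈ closedBall w (r / 2 ^ (n + 1)) →
      t < ‖cubeAvg f w (r / 2 ^ (n + 1)) - y‖) :
    volume (closedBall c r ∩ V) ≤ badVolume f (n + 1) c r y t := by
  have hcover : closedBall c r ∩ V ⊆
      ⋃ m : Fin d → Fin 2, closedBall (gridCenter 2 c r m) (r / 2) ∩ V := by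
    have := iUnion_grid (N := 2) (by norm_num) c hr
    rw [← this, iUnion_inter]
    simp
  induction n generalizing c r with
  | zero =>
    rw [badVolume]
    split_ifs with h
    · exact measure_mono inter_subset_left
    · have : closedBall c r ∩ V = ∅ := by
        rw [eq_empty_iff_forall_notMem]
        intro x hx
        obtain ⟨m, hm⟩ := mem_iUnion.1 (hcover hx)
        exact h ⟨m, by simpa using hV x hm.2 _ (by simpa using hm.1)⟩
      simp [this]
  | succ n ih =>
    rw [badVolume]
    split_ifs with h
    · exact measure_mono inter_subset_left
    · refine (measure_mono hcover).trans ((measure_iUnion_fintype_le _ _).trans ?_)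
      refine Finset.sum_le_sum fun m _ => ih _ (by positivity) ?_ ?_
      · have : r / 2 / 2 ^ (n + 1) = r / 2 ^ (n + 1 + 1) := by
          rw [div_div, pow_succ' 2 (n + 1)]
        rw [this]
        exact hV
      · have := iUnion_grid (N := 2) (by norm_num) (gridCenter 2 c r m) (half_pos hr)
        rw [← this, iUnion_inter]
        simp

end FeffermanStein

section FeffermanStein

variable {d : ℕ} {E : Type*} [NormedAddCommGroup E] [NormedSpace ℝ E]

/-- Either the mean of `h` on a set of measure `V` is at most `b`, or the set is controlled by the
part of the integral where `h` exceeds `a`, provided `2 * a ≤ b`. -/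
theorem rpow_mean_dichotomy {α : Type*} [MeasurableSpace α] {μ : Measure α} [IsFiniteMeasure μ]
    {h : α → ℝ≥0∞} {a b : ℝ≥0∞} (hab : 2 * a ≤ b) (hb : b ≠ ∞)
    (hI : b * μ univ < ∫⁻ x, h x ∂μ) :
    b * μ univ ≤ 2 * ∫⁻ x, {x | a < h x}.indicator h x ∂μ := by
  have h1 : ∫⁻ x, h x ∂μ ≤ (∫⁻ x, {x | a < h x}.indicator h x ∂μ) + a * μ univ := by
    rw [← lintegral_const, ← lintegral_add_right _ measurable_const]
    refine lintegral_mono fun x => ?_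
    by_cases hx : a < h x
    · simp [indicator, hx]
    · simp only [indicator, mem_ofPred_eq, hx, if_false, zero_add]
      exact not_lt.1 hx
  have h2 : 2 * (b * μ univ) ≤
      2 * (∫⁻ x, {x | a < h x}.indicator h x ∂μ) + b * μ univ := by
    calc 2 * (b * μ univ) ≤ 2 * ((∫⁻ x, {x | a < h x}.indicator h x ∂μ) + a * μ univ) := by
          gcongr
          exact hI.le.trans h1
      _ = 2 * (∫⁻ x, {x | a < h x}.indicator h x ∂μ) + (2 * a) * μ univ := by ring
      _ ≤ _ := by gcongr
  rw [two_mul (b * μ univ)] at h2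
  exact (ENNReal.add_le_add_iff_right (ENNReal.mul_ne_top hb (measure_ne_top _ _))).1 h2

theorem badVolume_two_mul_le [CompleteSpace E] {f : (Fin d → ℝ) → E} {g : (Fin d → ℝ) → ℝ≥0}
    {q : ℝ} (hq : 1 < q) {K : ℝ≥0∞} {D₀ : Set (Fin d → ℝ)}
    (hf : IntegrableOn f D₀)
    (hosc : ∀ c r, 0 < r → closedBall c r ⊆ D₀ →
      ∫⁻ x in closedBall c r, ‖f x - cubeAvg f c r‖ₑ ≤
        K * (volume (closedBall c r)) ^ (1 - 1 / q) *
          (∫⁻ x in closedBall c r, (g x : ℝ≥0∞) ^ q) ^ (1 / q))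
    {γ : ℝ} (hγ : 0 < γ) {t : ℝ} (ht : 0 < t) (n : ℕ) (c : Fin d → ℝ) {r : ℝ} (hr : 0 < r)
    (hD : closedBall c r ⊆ D₀) (y : E) (hy : ‖cubeAvg f c r - y‖ ≤ t) :
    badVolume f n c r y (2 * t) ≤
      2 ^ d * K * ENNReal.ofReal γ * badVolume f n c r y t +
        2 * (ENNReal.ofReal (γ * t) ^ q)⁻¹ *
          ∫⁻ x in closedBall c r,
            {x | t < 2 / γ * g x}.indicator (fun x => (g x : ℝ≥0∞) ^ q) x := by
  induction n generalizing c r with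
  | zero => simp [badVolume]
  | succ n ih =>
    by_cases h : ∃ m : Fin d → Fin 2, t < ‖cubeAvg f (gridCenter 2 c r m) (r / 2) - y‖
    · have hbad : badVolume f (n + 1) c r y t = volume (closedBall c r) := by
        rw [badVolume, if_pos h]
      rw [hbad]
      set V := volume (closedBall c r) with hV
      have hV0 : V ≠ 0 := volume_closedBall_pos c hr
      have hVt : V ≠ ∞ := volume_closedBall_ne_top c r
      set I := ∫⁻ x in closedBall c r, (g x : ℝ≥0∞) ^ q with hI
      set b := ENNReal.ofReal (γ * t) ^ q with hb
      have hγt : ENNReal.ofReal (γ * t) ≠ 0 := by simpa using mul_pos hγ ht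
      have hb0 : b ≠ 0 := by
        rw [hb, Ne, ENNReal.rpow_eq_zero_iff]; simp [hγt]
      have hbt : b ≠ ∞ := by
        rw [hb]; exact ENNReal.rpow_ne_top_of_nonneg (by linarith) ENNReal.ofReal_ne_top
      by_cases hcase : I ≤ b * V
      · refine le_add_right ?_
        have h1 : badVolume f (n + 1) c r y (2 * t) ≤
            badVolume f (n + 1) c r (cubeAvg f c r) t :=
          badVolume_mono f _ c hr (by rw [norm_sub_rev]; linarith)
        have h2 := ofReal_mul_badVolume_le (n + 1) hr (hf.mono_set hD) (cubeAvg f c r) t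
        have h3 : I ^ (1 / q) ≤ ENNReal.ofReal (γ * t) * V ^ (1 / q) := by
          calc I ^ (1 / q) ≤ (b * V) ^ (1 / q) := by gcongr
            _ = _ := by
              rw [ENNReal.mul_rpow_of_nonneg _ _ (by positivity), hb, ← ENNReal.rpow_mul,
                mul_one_div_cancel (by linarith), ENNReal.rpow_one]
        have h4 : ENNReal.ofReal t * badVolume f (n + 1) c r (cubeAvg f c r) t ≤
            ENNReal.ofReal t * (2 ^ d * K * ENNReal.ofReal γ * V) := by
          calc _ ≤ _ := h2
            _ ≤ 2 ^ d * (K * V ^ (1 - 1 / q) * (ENNReal.ofReal (γ * t) * V ^ (1 / q))) := by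
              gcongr
              exact (hosc c r hr hD).trans (by gcongr)
            _ = 2 ^ d * K * ENNReal.ofReal (γ * t) * (V ^ (1 - 1 / q) * V ^ (1 / q)) := by ring
            _ = _ := by
              rw [← ENNReal.rpow_add _ _ hV0 hVt, sub_add_cancel, ENNReal.rpow_one,
                ENNReal.ofReal_mul hγ.le]
              ring
        refine h1.trans ?_
        rwa [ENNReal.mul_le_mul_iff_right (by simpa using ht) ENNReal.ofReal_ne_top] at h4
      · refine le_add_left ((badVolume_le_volume f _ c hr _ _).trans ?_)
        have : IsFiniteMeasure (volume.restrict (closedBall c r)) :=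
          ⟨by simpa using measure_closedBall_lt_top⟩
        have h5 := rpow_mean_dichotomy (μ := volume.restrict (closedBall c r))
          (h := fun x => (g x : ℝ≥0∞) ^ q) (a := ENNReal.ofReal (γ * t / 2) ^ q) (b := b) ?_ hbt
          (by simpa using not_le.1 hcase)
        · rw [Measure.restrict_apply_univ] at h5
          have h6 : ∀ x, ENNReal.ofReal (γ * t / 2) ^ q < (g x : ℝ≥0∞) ^ q ↔ t < 2 / γ * g x := by
            intro x
            rw [ENNReal.rpow_lt_rpow_iff (by linarith), ← ENNReal.ofReal_coe_nnreal,
              ENNReal.ofReal_lt_ofReal_iff_of_nonneg (by positivity)]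
            rw [div_lt_iff₀ (by norm_num), div_mul_eq_mul_div, lt_div_iff₀ hγ, mul_comm t γ,
              mul_comm 2]
          simp only [h6] at h5
          calc V = b⁻¹ * (b * V) := by
                rw [← mul_assoc, ENNReal.inv_mul_cancel hb0 hbt, one_mul]
            _ ≤ b⁻¹ * _ := mul_le_mul_right h5 _
            _ = _ := by ring
        · rw [hb, ENNReal.ofReal_div_of_pos (by norm_num), div_eq_mul_inv,
            ENNReal.mul_rpow_of_nonneg _ _ (by linarith)]
          rw [mul_comm, mul_assoc]
          refine mul_le_of_le_one_right' ?_
          have : ENNReal.ofReal 2 = 2 := by simp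
          rw [this, ← ENNReal.rpow_neg_one, ← ENNReal.rpow_mul]
          calc (2 : ℝ≥0∞) ^ (-1 * q) * 2 ≤ 2 ^ (-1 : ℝ) * 2 := by
                gcongr
                · norm_num
                · linarith
            _ = 1 := by
                rw [ENNReal.rpow_neg_one]
                exact ENNReal.inv_mul_cancel (by norm_num) (by norm_num)
    · have h' : ¬ ∃ m : Fin d → Fin 2,
          2 * t < ‖cubeAvg f (gridCenter 2 c r m) (r / 2) - y‖ :=
        fun ⟨m, hm⟩ => h ⟨m, by linarith⟩
      rw [badVolume, badVolume, if_neg h, if_neg h', lintegral_children c hr, Finset.mul_sum,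
        Finset.mul_sum, ← Finset.sum_add_distrib]
      push Not at h
      exact Finset.sum_le_sum fun m _ => ih _ (by positivity)
        ((closedBall_child_subset c hr.le m).trans hD) (h m)

end FeffermanStein

section FeffermanStein

variable {d : ℕ} {E : Type*} [NormedAddCommGroup E] [NormedSpace ℝ E]

theorem measurable_badVolume (f : (Fin d → ℝ) → E) (n : ℕ) (c : Fin d → ℝ) {r : ℝ} (hr : 0 < r)
    (y : E) : Measurable fun t => badVolume f n c r y t :=
  Antitone.measurable fun s t hst => badVolume_mono f n c hr (by simpa using hst)

theorem volume_norm_sub_gt_le_liminf [CompleteSpace E] {f : (Fin d → ℝ) → E} {c : Fin d → ℝ} {r : ℝ}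
    (hr : 0 < r) (hf : IntegrableOn f (closedBall c r)) (y : E) (t : ℝ) :
    volume.restrict (closedBall c r) {x | t < ‖f x - y‖} ≤
      liminf (fun n => badVolume f (n + 1) c r y t) atTop := by
  set V : ℕ → Set (Fin d → ℝ) := fun n => {x | ∀ w, x ∈ closedBall w (r / 2 ^ (n + 1)) →
      t < ‖cubeAvg f w (r / 2 ^ (n + 1)) - y‖} with hV
  set W : ℕ → Set (Fin d → ℝ) := fun N => ⋂ n ≥ N, V n with hW
  have hWmono : Monotone W := fun a b hab x hx => by
    simp only [hW, mem_iInter] at hx ⊢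
    exact fun n hn => hx n (hab.trans hn)
  have hδ0 : Tendsto (fun n : ℕ => r / 2 ^ (n + 1)) atTop (𝓝 0) := by
    have := (tendsto_pow_atTop_nhds_zero_of_lt_one (r := (1 / 2 : ℝ)) (by norm_num)
      (by norm_num)).const_mul r
    rw [mul_zero] at this
    refine (this.comp (tendsto_add_atTop_nat 1)).congr fun n => ?_
    simp [div_eq_mul_inv]
  have hδ : Tendsto (fun n : ℕ => r / 2 ^ (n + 1)) atTop (𝓝[>] 0) :=
    tendsto_nhdsWithin_iff.2 ⟨hδ0, .of_forall fun n => by simp only [mem_Ioi]; positivity⟩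
  have hF : Integrable ((closedBall c r).indicator f) :=
    (integrable_indicator_iff measurableSet_closedBall).2 hf
  have hae : ∀ᵐ x, x ∈ closedBall c r → t < ‖f x - y‖ → x ∈ ⋃ N, W N := by
    have hsph : ∀ᵐ x, x ∉ sphere c r :=
      measure_eq_zero_iff_ae_notMem.1 (Measure.addHaar_sphere_of_ne_zero volume c hr.ne')
    filter_upwards [IsUnifLocDoublingMeasure.ae_tendsto_average volume
      hF.locallyIntegrable 1, hsph] with x hx hxs hxc hxt
    have hxb : x ∈ ball c r := by
      rcases (mem_closedBall.1 hxc).lt_or_eq with h | h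
      · exact h
      · exact absurd h hxs
    by_contra hcon
    simp only [hW, mem_iUnion, mem_iInter, not_exists, not_forall] at hcon
    have hw : ∀ n, ∃ w, x ∈ closedBall w (r / 2 ^ (n + 1)) ∧
        (x ∉ V n → ¬ t < ‖cubeAvg f w (r / 2 ^ (n + 1)) - y‖) := by
      intro n
      by_cases h : x ∈ V n
      · exact ⟨x, mem_closedBall_self (by positivity), fun h' => absurd h h'⟩
      · simp only [hV, mem_ofPred_eq, not_forall] at h
        obtain ⟨w, hw1, hw2⟩ := h
        exact ⟨w, hw1, fun _ => hw2⟩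
    choose w hw1 hw2 using hw
    have h1 := hx w _ hδ (.of_forall fun n => by simpa using hw1 n)
    rw [indicator_of_mem hxc] at h1
    obtain ⟨ε, hε, hball⟩ := Metric.isOpen_iff.1 isOpen_ball x hxb
    have h2 : ∀ᶠ n : ℕ in atTop, r / 2 ^ (n + 1) < ε / 2 :=
      hδ0.eventually_lt_const (by positivity)
    have h3 : Tendsto (fun n => ‖cubeAvg f (w n) (r / 2 ^ (n + 1)) - y‖) atTop
        (𝓝 ‖f x - y‖) := by
      refine ((h1.sub_const y).norm).congr' ?_
      filter_upwards [h2] with n hn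
      rw [cubeAvg]
      congr 2
      refine setAverage_congr_fun measurableSet_closedBall (.of_forall fun z hz => ?_)
      refine indicator_of_mem (ball_subset_closedBall (hball ?_)) _
      have := hw1 n
      rw [mem_closedBall] at this hz
      rw [mem_ball]
      linarith [dist_triangle z (w n) x, dist_comm x (w n)]
    obtain ⟨N, hN⟩ := eventually_atTop.1 (h3.eventually_const_lt hxt)
    obtain ⟨n, hn, hnV⟩ := hcon N
    exact hw2 n hnV (hN n hn)
  calc volume.restrict (closedBall c r) {x | t < ‖f x - y‖}
      ≤ volume.restrict (closedBall c r) (⋃ N, W N) := by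
        refine measure_mono_ae ?_
        exact (ae_restrict_iff' measurableSet_closedBall).2 hae
    _ = ⨆ N, volume.restrict (closedBall c r) (W N) := hWmono.measure_iUnion
    _ ≤ _ := by
        refine iSup_le fun N => le_liminf_of_le (by isBoundedDefault) ?_
        filter_upwards [eventually_ge_atTop N] with n hn
        rw [Measure.restrict_apply' measurableSet_closedBall, inter_comm]
        refine le_trans (measure_mono ?_) (volume_inter_le_badVolume (V := V n) n c hr
          fun x hx => hx)
        refine inter_subset_inter_right _ fun x hx => ?_
        simp only [hW, mem_iInter] at hx
        exact hx n hn

theorem lintegral_enorm_sub_rpow_le_of_badVolume [CompleteSpace E] {f : (Fin d → ℝ) → E}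
    {c : Fin d → ℝ} {r : ℝ} (hr : 0 < r) (hf : IntegrableOn f (closedBall c r)) (y : E)
    {p : ℝ} (hp : 0 < p) {M : ℝ≥0∞}
    (hM : ∀ n, ∫⁻ t in Ioi (0 : ℝ), badVolume f n c r y t * ENNReal.ofReal (t ^ (p - 1)) ≤ M) :
    ∫⁻ x in closedBall c r, ‖f x - y‖ₑ ^ p ≤ ENNReal.ofReal p * M := by
  have h1 := lintegral_rpow_eq_lintegral_meas_lt_mul (volume.restrict (closedBall c r))
    (f := fun x => ‖f x - y‖) (.of_forall fun x => norm_nonneg _)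
    ((hf.aestronglyMeasurable.sub aestronglyMeasurable_const).norm.aemeasurable) hp
  have h2 : ∀ x, ‖f x - y‖ₑ ^ p = ENNReal.ofReal (‖f x - y‖ ^ p) := fun x => by
    rw [← ofReal_norm, ENNReal.ofReal_rpow_of_nonneg (norm_nonneg _) hp.le]
  simp only [h2]
  rw [h1]
  gcongr
  calc _ ≤ ∫⁻ t in Ioi (0 : ℝ), liminf (fun n => badVolume f (n + 1) c r y t *
        ENNReal.ofReal (t ^ (p - 1))) atTop := by
        refine lintegral_mono fun t => ?_
        have h3 := ENNReal.le_liminf_mul (f := atTop)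
          (u := fun n => badVolume f (n + 1) c r y t)
          (v := fun _ => ENNReal.ofReal (t ^ (p - 1)))
        rw [liminf_const] at h3
        refine le_trans ?_ h3
        gcongr
        exact volume_norm_sub_gt_le_liminf hr hf y t
    _ ≤ liminf (fun n => ∫⁻ t in Ioi (0 : ℝ), badVolume f (n + 1) c r y t *
        ENNReal.ofReal (t ^ (p - 1))) atTop :=
        lintegral_liminf_le fun n => (measurable_badVolume f _ c hr y).mul (by fun_prop)
    _ ≤ M := by
        refine liminf_le_of_le (by isBoundedDefault) fun b hb => ?_
        obtain ⟨n, hn⟩ := hb.exists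
        exact hn.trans (hM _)

theorem lintegral_Ioi_zero_comp_two_mul (p : ℝ) (φ : ℝ → ℝ≥0∞) :
    ∫⁻ t in Ioi (0 : ℝ), φ t * ENNReal.ofReal (t ^ (p - 1)) =
      ENNReal.ofReal (2 ^ p) *
        ∫⁻ t in Ioi (0 : ℝ), φ (2 * t) * ENNReal.ofReal (t ^ (p - 1)) := by
  have himg : (fun t : ℝ => 2 * t) '' Ioi 0 = Ioi 0 := by
    rw [image_mul_left_Ioi (by norm_num), mul_zero]
  have h := lintegral_image_eq_lintegral_abs_deriv_mul (f := fun t : ℝ => 2 * t)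
    (s := Ioi 0) (f' := fun _ => 2) measurableSet_Ioi
    (fun x _ => by simpa using ((hasDerivAt_id x).const_mul (2 : ℝ)).hasDerivWithinAt)
    (fun x _ y _ hxy => by simpa using hxy)
    (fun t => φ t * ENNReal.ofReal (t ^ (p - 1)))
  rw [himg] at h
  rw [h, ← lintegral_const_mul' _ _ ENNReal.ofReal_ne_top]
  refine setLIntegral_congr_fun measurableSet_Ioi fun t ht => ?_
  have ht0 : (0 : ℝ) < t := ht
  have h2 : (2 : ℝ) * (2 * t) ^ (p - 1) = 2 ^ p * t ^ (p - 1) := by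
    rw [Real.mul_rpow (by norm_num) ht0.le, ← mul_assoc]
    congr 1
    rw [Real.rpow_sub_one (by norm_num)]
    ring
  calc ENNReal.ofReal |2| * (φ (2 * t) * ENNReal.ofReal ((2 * t) ^ (p - 1)))
      = φ (2 * t) * (ENNReal.ofReal 2 * ENNReal.ofReal ((2 * t) ^ (p - 1))) := by
        rw [abs_of_pos (by norm_num : (0 : ℝ) < 2)]; ring
    _ = φ (2 * t) * (ENNReal.ofReal (2 ^ p) * ENNReal.ofReal (t ^ (p - 1))) := by
        rw [← ENNReal.ofReal_mul (by norm_num), h2, ENNReal.ofReal_mul (by positivity)]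
    _ = _ := by ring

theorem lintegral_badVolume_lt_top (f : (Fin d → ℝ) → E) (n : ℕ) (c : Fin d → ℝ) {r : ℝ}
    (hr : 0 < r) (y : E) {p : ℝ} (hp : 1 ≤ p) :
    ∫⁻ t in Ioi (0 : ℝ), badVolume f n c r y t * ENNReal.ofReal (t ^ (p - 1)) < ∞ := by
  obtain ⟨T, hT⟩ := exists_badVolume_eq_zero f n c r y
  calc ∫⁻ t in Ioi (0 : ℝ), badVolume f n c r y t * ENNReal.ofReal (t ^ (p - 1))
      ≤ ∫⁻ t in Ioi (0 : ℝ), (Iio T).indicator (fun _ => volume (closedBall c r) *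
          ENNReal.ofReal (T ^ (p - 1))) t := by
        refine setLIntegral_mono' measurableSet_Ioi fun t ht => ?_
        by_cases h : t < T
        · rw [indicator_of_mem (show t ∈ Iio T from h)]
          have := badVolume_le_volume f n c hr y t
          have ht0 : (0 : ℝ) ≤ t := le_of_lt ht
          gcongr
        · rw [hT t (not_lt.1 h)]
          simp
    _ = volume (closedBall c r) * ENNReal.ofReal (T ^ (p - 1)) * volume (Iio T ∩ Ioi 0) := by
        rw [lintegral_indicator measurableSet_Iio, lintegral_const, Measure.restrict_restrict
          measurableSet_Iio, Measure.restrict_apply_univ]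
    _ < ∞ := by
        rw [inter_comm, Ioi_inter_Iio]
        exact ENNReal.mul_lt_top (ENNReal.mul_lt_top
          (volume_closedBall_ne_top c r).lt_top ENNReal.ofReal_lt_top) (by simp)

theorem le_two_mul_of_le_half_add {a b : ℝ≥0∞} (ha : a ≠ ∞) (h : a ≤ 2⁻¹ * a + b) : a ≤ 2 * b := by
  have h1 : a + a ≤ a + 2 * b := by
    calc a + a = 2 * a := (two_mul a).symm
      _ ≤ 2 * (2⁻¹ * a + b) := by gcongr
      _ = a + 2 * b := by
        rw [mul_add, ← mul_assoc, ENNReal.mul_inv_cancel (by norm_num) (by norm_num), one_mul]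
  exact (ENNReal.add_le_add_iff_left ha).1 h1

/-- A local Fefferman-Stein inequality on cubes: control of the mean oscillations of `f` over all
subcubes by the `L^q` means of `g` gives control of the `L^p` oscillation of `f`, for `q < p`. -/
theorem exists_lintegral_enorm_sub_cubeAvg_le (d : ℕ) {p q : ℝ} (hq : 1 < q) (hqp : q < p)
    (K : ℝ≥0) :
    ∃ C : ℝ≥0, ∀ {E : Type*} [NormedAddCommGroup E] [NormedSpace ℝ E] [CompleteSpace E]
      (f : (Fin d → ℝ) → E) (g : (Fin d → ℝ) → ℝ≥0) (_ : Measurable g) (c₀ : Fin d → ℝ) (r₀ : ℝ)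
      (_ : 0 < r₀) (_ : IntegrableOn f (closedBall c₀ r₀))
      (_ : ∀ c r, 0 < r → closedBall c r ⊆ closedBall c₀ r₀ →
        ∫⁻ x in closedBall c r, ‖f x - cubeAvg f c r‖ₑ ≤
          K * (volume (closedBall c r)) ^ (1 - 1 / q) *
            (∫⁻ x in closedBall c r, (g x : ℝ≥0∞) ^ q) ^ (1 / q)),
      ∫⁻ x in closedBall c₀ r₀, ‖f x - cubeAvg f c₀ r₀‖ₑ ^ p ≤
        C * ∫⁻ x in closedBall c₀ r₀, (g x : ℝ≥0∞) ^ p := by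
  set γ : ℝ := (2 ^ p * 2 ^ d * (K + 1) * 2)⁻¹ with hγdef
  have hγ : 0 < γ := by positivity
  clear_value γ
  set A : ℝ := 2 ^ p * 2 * (γ ^ q)⁻¹ * ((p - q)⁻¹ * (2 / γ) ^ (p - q)) with hA
  have hpq : 0 < p - q := by linarith
  have hA0 : 0 ≤ A := by positivity
  refine ⟨Real.toNNReal (p * (2 * A)), ?_⟩
  intro E _ _ _ f g hg c₀ r₀ hr₀ hf hosc
  set y := cubeAvg f c₀ r₀ with hy
  set I := ∫⁻ x in closedBall c₀ r₀, (g x : ℝ≥0∞) ^ p with hI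
  set ν := (volume.restrict (closedBall c₀ r₀)).withDensity (fun x => (g x : ℝ≥0∞) ^ q) with hν
  have hgq : Measurable fun x => (g x : ℝ≥0∞) ^ q := by fun_prop
  have hνI : ENNReal.ofReal (p - q) * ∫⁻ t in Ioi (0 : ℝ), ν {x | t < 2 / γ * g x} *
      ENNReal.ofReal (t ^ (p - q - 1)) = ENNReal.ofReal ((2 / γ) ^ (p - q)) * I := by
    rw [← lintegral_rpow_eq_lintegral_meas_lt_mul ν (f := fun x => 2 / γ * (g x : ℝ))
      (.of_forall fun x => by positivity) (by fun_prop) hpq, hν,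
      lintegral_withDensity_eq_lintegral_mul _ hgq (by fun_prop), hI,
      ← lintegral_const_mul' _ _ ENNReal.ofReal_ne_top]
    refine lintegral_congr fun x => ?_
    rw [Pi.mul_apply, Real.mul_rpow (by positivity) (by positivity),
      ENNReal.ofReal_mul (by positivity), ← ENNReal.ofReal_rpow_of_nonneg (x := (g x : ℝ))
          (by positivity) hpq.le,
      ENNReal.ofReal_coe_nnreal, mul_left_comm, ← ENNReal.rpow_add_of_nonneg _ _ (by linarith)
      hpq.le, add_sub_cancel]
  have hΦ : ∀ n, ∫⁻ t in Ioi (0 : ℝ), badVolume f n c₀ r₀ y t * ENNReal.ofReal (t ^ (p - 1)) ≤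
      ENNReal.ofReal (2 * A) * I := by
    intro n
    set Φ := ∫⁻ t in Ioi (0 : ℝ), badVolume f n c₀ r₀ y t * ENNReal.ofReal (t ^ (p - 1)) with hΦd
    have hΦt : Φ ≠ ∞ := (lintegral_badVolume_lt_top f n c₀ hr₀ y (by linarith)).ne
    have key : Φ ≤ 2⁻¹ * Φ + ENNReal.ofReal A * I := by
      calc Φ = ENNReal.ofReal (2 ^ p) *
            ∫⁻ t in Ioi (0 : ℝ), badVolume f n c₀ r₀ y (2 * t) *
              ENNReal.ofReal (t ^ (p - 1)) := lintegral_Ioi_zero_comp_two_mul p _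
        _ ≤ ENNReal.ofReal (2 ^ p) *
            ∫⁻ t in Ioi (0 : ℝ), (2 ^ d * K * ENNReal.ofReal γ *
              (badVolume f n c₀ r₀ y t * ENNReal.ofReal (t ^ (p - 1))) +
              ENNReal.ofReal (2 * (γ ^ q)⁻¹) * (ν {x | t < 2 / γ * g x} *
              ENNReal.ofReal (t ^ (p - q - 1)))) := by
            refine mul_le_mul_right ?_ _
            refine setLIntegral_mono' measurableSet_Ioi fun t ht => ?_
            have ht0 : (0 : ℝ) < t := ht
            have h1 := badVolume_two_mul_le hq hf hosc hγ ht0 n c₀ hr₀ subset_rfl y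
              (by simpa [hy] using ht0.le)
            have hms : MeasurableSet {x | t < 2 / γ * (g x : ℝ)} :=
              measurableSet_lt measurable_const (by fun_prop)
            rw [lintegral_indicator hms, ← withDensity_apply _ hms, ← hν] at h1
            refine (mul_le_mul_left h1 _).trans_eq ?_
            have h2 : ENNReal.ofReal (t ^ (p - q - 1)) =
                ENNReal.ofReal (t ^ (p - 1)) * (ENNReal.ofReal (t ^ q))⁻¹ := by
              rw [show p - q - 1 = (p - 1) - q by ring, Real.rpow_sub ht0 (p - 1),
                ENNReal.ofReal_div_of_pos (by positivity), div_eq_mul_inv]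
            have h3 : (ENNReal.ofReal (γ * t) ^ q)⁻¹ =
                ENNReal.ofReal (γ ^ q)⁻¹ * (ENNReal.ofReal (t ^ q))⁻¹ := by
              rw [ENNReal.ofReal_rpow_of_pos (by positivity), Real.mul_rpow hγ.le ht0.le,
                ENNReal.ofReal_mul (by positivity), ENNReal.mul_inv (by simp) (by simp),
                ENNReal.ofReal_inv_of_pos (by positivity)]
            rw [h2, h3, ENNReal.ofReal_mul (by norm_num), ENNReal.ofReal_ofNat]
            ring
        _ = ENNReal.ofReal (2 ^ p) * (2 ^ d * K * ENNReal.ofReal γ) * Φ +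
            ENNReal.ofReal (2 ^ p) * (ENNReal.ofReal (2 * (γ ^ q)⁻¹) *
              ∫⁻ t in Ioi (0 : ℝ), ν {x | t < 2 / γ * g x} *
              ENNReal.ofReal (t ^ (p - q - 1))) := by
            rw [lintegral_add_left, lintegral_const_mul', lintegral_const_mul', mul_add,
                ← mul_assoc]
            · finiteness
            · finiteness
            · exact ((measurable_badVolume f _ c₀ hr₀ y).mul (by fun_prop)).const_mul _
        _ ≤ 2⁻¹ * Φ + ENNReal.ofReal A * I := by
            gcongr ?_ * _ + ?_
            · rw [show (2⁻¹ : ℝ≥0∞) = ENNReal.ofReal (2⁻¹) by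
                  rw [ENNReal.ofReal_inv_of_pos (by norm_num)]; simp,
                ← ENNReal.ofReal_coe_nnreal (p := K), show (2 : ℝ≥0∞) ^ d =
                    ENNReal.ofReal (2 ^ d) by
                  rw [ENNReal.ofReal_pow (by norm_num)]; simp,
                ← ENNReal.ofReal_mul (by positivity), ← ENNReal.ofReal_mul (by positivity),
                ← ENNReal.ofReal_mul (by positivity)]
              refine ENNReal.ofReal_le_ofReal ?_
              rw [hγdef, ← mul_assoc, ← div_eq_mul_inv, div_le_iff₀ (by positivity)]
              have : (0 : ℝ) ≤ 2 ^ p * 2 ^ d := by positivity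
              nlinarith
            · refine le_of_eq ?_
              set J := ∫⁻ t in Ioi (0 : ℝ), ν {x | t < 2 / γ * g x} *
                ENNReal.ofReal (t ^ (p - q - 1))
              calc _ = ENNReal.ofReal (2 ^ p) * (ENNReal.ofReal (2 * (γ ^ q)⁻¹) *
                      (ENNReal.ofReal (p - q)⁻¹ * (ENNReal.ofReal (p - q) * J))) := by
                    rw [← mul_assoc (ENNReal.ofReal (p - q)⁻¹),
                        ← ENNReal.ofReal_mul (by positivity),
                      inv_mul_cancel₀ hpq.ne']
                    simp
                _ = _ := by
                    rw [hνI, ← mul_assoc, ← mul_assoc, ← mul_assoc,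
                      ← ENNReal.ofReal_mul (by positivity), ← ENNReal.ofReal_mul (by positivity),
                      ← ENNReal.ofReal_mul (by positivity), hA]
                    congr 2
                    ring
    rw [ENNReal.ofReal_mul (by norm_num), mul_assoc, ENNReal.ofReal_ofNat]
    exact le_two_mul_of_le_half_add hΦt key
  refine (lintegral_enorm_sub_rpow_le_of_badVolume hr₀ hf y (by linarith) hΦ).trans_eq ?_
  rw [← mul_assoc, ← ENNReal.ofReal_mul (by linarith)]
  rfl

end FeffermanStein

section InteriorToAllCubes

variable {d : ℕ} {E : Type*} [NormedAddCommGroup E]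

/-- The quantity `|S|^{1-1/q} (∫_S g^q)^{1/q}`, an upper bound for `∫_S g` when `1 < q`. -/
noncomputable def holderBound (g : (Fin d → ℝ) → ℝ≥0) (q : ℝ) (S : Set (Fin d → ℝ)) : ℝ≥0∞ :=
  volume S ^ (1 - 1 / q) * (∫⁻ x in S, (g x : ℝ≥0∞) ^ q) ^ (1 / q)

theorem one_sub_one_div_nonneg {q : ℝ} (hq : 1 < q) : 0 ≤ 1 - 1 / q := by
  have : 1 / q ≤ 1 := by rw [div_le_one (by linarith)]; exact hq.le
  linarith

theorem holderBound_mono (g : (Fin d → ℝ) → ℝ≥0) {q : ℝ} (hq : 1 < q) {S T : Set (Fin d → ℝ)}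
    (h : S ⊆ T) : holderBound g q S ≤ holderBound g q T := by
  have := one_sub_one_div_nonneg hq
  rw [holderBound, holderBound]
  gcongr

theorem lintegral_le_holderBound {g : (Fin d → ℝ) → ℝ≥0} (hg : Measurable g) {q : ℝ} (hq : 1 < q)
    (S : Set (Fin d → ℝ)) : ∫⁻ x in S, (g x : ℝ≥0∞) ≤ holderBound g q S := by
  have hpq : q.HolderConjugate (1 - 1 / q)⁻¹ := by
    rw [Real.holderConjugate_iff]
    refine ⟨hq, ?_⟩
    rw [inv_inv]; field_simp; ring
  have h := ENNReal.lintegral_mul_le_Lp_mul_Lq (volume.restrict S) hpq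
    (f := fun x => (g x : ℝ≥0∞)) (g := fun _ => 1) (by fun_prop) (by fun_prop)
  simpa [holderBound, mul_comm] using h

theorem enorm_sub_mul_measure_le {α : Type*} [MeasurableSpace α] {μ : Measure α} {f : α → E}
    (hf : AEStronglyMeasurable f μ) (y y' : E) :
    ‖y - y'‖ₑ * μ univ ≤ ∫⁻ x, ‖f x - y‖ₑ ∂μ + ∫⁻ x, ‖f x - y'‖ₑ ∂μ := by
  have hm : AEMeasurable (fun x => ‖f x - y‖ₑ) μ := (hf.sub aestronglyMeasurable_const).enorm
  rw [← lintegral_const, ← lintegral_add_left' hm]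
  refine lintegral_mono fun x => ?_
  have : y - y' = (f x - y') - (f x - y) := by abel
  rw [this, add_comm]
  exact enorm_sub_le

theorem enorm_sub_mul_le_of_chain {Y : (Fin d → ℝ) → E} {S : Set (Fin d → ℝ)} (hS : Convex ℝ S)
    {σ : ℝ} {v a : ℝ≥0∞}
    (h : ∀ z ∈ S, ∀ w ∈ S, dist z w ≤ σ → ‖Y z - Y w‖ₑ * v ≤ a) (m : ℕ) :
    ∀ z ∈ S, ∀ w ∈ S, dist z w ≤ m * σ → ‖Y z - Y w‖ₑ * v ≤ m * a := by
  induction m with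
  | zero =>
    intro z _ w _ hzw
    have : z = w := dist_le_zero.1 (by simpa using hzw)
    simp [this]
  | succ m ih =>
    intro z hz w hw hzw
    push_cast at hzw
    have hm : (0 : ℝ) < m + 1 := by positivity
    set w' := AffineMap.lineMap w z ((m : ℝ) / (m + 1)) with hw'
    have hmem : w' ∈ S := hS.lineMap_mem hw hz ⟨by positivity, by
      rw [div_le_one hm]; linarith⟩
    have h1 : dist z w' ≤ σ := by
      rw [dist_comm, hw', dist_lineMap_right, Real.norm_eq_abs, abs_of_nonneg, dist_comm]
      · have : 1 - (m : ℝ) / (m + 1) = (m + 1 : ℝ)⁻¹ := by field_simp; ring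
        rw [this, inv_mul_le_iff₀ hm]
        exact hzw
      · rw [sub_nonneg, div_le_one hm]; linarith
    have h2 : dist w' w ≤ m * σ := by
      rw [hw', dist_lineMap_left, Real.norm_eq_abs, abs_of_nonneg (by positivity), dist_comm,
        div_mul_eq_mul_div, div_le_iff₀ hm]
      calc (m : ℝ) * dist z w ≤ m * ((m + 1) * σ) := by gcongr
        _ = _ := by ring
    calc ‖Y z - Y w‖ₑ * v ≤ (‖Y z - Y w'‖ₑ + ‖Y w' - Y w‖ₑ) * v := by
          gcongr
          rw [← sub_add_sub_cancel (Y z) (Y w') (Y w)]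
          exact enorm_add_le _ _
      _ = ‖Y z - Y w'‖ₑ * v + ‖Y w' - Y w‖ₑ * v := add_mul _ _ _
      _ ≤ a + m * a := add_le_add (h z hz w' hmem h1) (ih w' hmem w hw h2)
      _ = _ := by push_cast; ring

theorem sum_holderBound_le {ι : Type*} (s : Finset ι) (S : ι → Set (Fin d → ℝ))
    (g : (Fin d → ℝ) → ℝ≥0) {q : ℝ} (hq : 1 < q) :
    ∑ i ∈ s, holderBound g q (S i) ≤ (∑ i ∈ s, volume (S i)) ^ (1 - 1 / q) *
      (∑ i ∈ s, ∫⁻ x in S i, (g x : ℝ≥0∞) ^ q) ^ (1 / q) := by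
  have hpq : (1 - 1 / q)⁻¹.HolderConjugate q := by
    refine Real.HolderConjugate.symm ?_
    rw [Real.holderConjugate_iff]
    refine ⟨hq, ?_⟩
    rw [inv_inv]; field_simp; ring
  have h0 : 1 - 1 / q ≠ 0 := by
    have := hpq.pos
    rw [inv_pos] at this
    exact this.ne'
  have h := ENNReal.inner_le_Lp_mul_Lq s (fun i => volume (S i) ^ (1 - 1 / q))
    (fun i => (∫⁻ x in S i, (g x : ℝ≥0∞) ^ q) ^ (1 / q)) hpq
  have hq0 : q ≠ 0 := by linarith
  simp only [← ENNReal.rpow_mul, mul_inv_cancel₀ h0, ENNReal.rpow_one, one_div_mul_cancel hq0,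
    one_div (1 - 1 / q)⁻¹, inv_inv] at h
  exact h

theorem card_compl_interior_le (d : ℕ) {κ N : ℕ} (hN : 0 < N) (hκN : 2 * κ ≤ N) :
    (((Fintype.piFinset fun _ : Fin d =>
      (Finset.univ.filter fun k : Fin N => κ ≤ k ∧ k + κ < N))ᶜ).card : ℝ) ≤
      d * (2 * κ / N) * N ^ d := by
  have hN' : (0 : ℝ) < N := by exact_mod_cast hN
  set s := Finset.univ.filter fun k : Fin N => κ ≤ k ∧ k + κ < N with hs
  have h1 : N ≤ s.card + 2 * κ := by
    have h2 : (Finset.univ : Finset (Fin N)) ⊆ s ∪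
        ((Finset.univ.filter fun k : Fin N => (k : ℕ) < κ) ∪
          (Finset.univ.filter fun k : Fin N => N ≤ k + κ)) := by
      intro k _
      simp only [hs, Finset.mem_union, Finset.mem_filter, Finset.mem_univ, true_and]
      omega
    have h3 : (Finset.univ.filter fun k : Fin N => (k : ℕ) < κ).card ≤ κ := by
      refine (Finset.card_le_card_of_injOn (t := Finset.range κ) (fun k : Fin N => (k : ℕ))
        (fun k hk => ?_) (fun a _ b _ h =>
            by simpa [Fin.ext_iff] using h)).trans_eq (Finset.card_range κ)
      simpa using hk
    have h4 : (Finset.univ.filter fun k : Fin N => N ≤ k + κ).card ≤ κ := by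
      refine (Finset.card_le_card_of_injOn (t := Finset.Ico (N - κ) N) (fun k : Fin N => (k : ℕ))
        (fun k hk => ?_) (fun a _ b _ h => by simpa [Fin.ext_iff] using h)).trans ?_
      · simp only [Finset.coe_filter, Finset.mem_univ, true_and, mem_ofPred_eq,
          Finset.coe_Ico, mem_Ico] at hk ⊢
        omega
      · rw [Nat.card_Ico]
        omega
    have h5 := Finset.card_le_card h2
    rw [Finset.card_univ, Fintype.card_fin] at h5
    have h6 := Finset.card_union_le s ((Finset.univ.filter fun k : Fin N => (k : ℕ) < κ) ∪
          (Finset.univ.filter fun k : Fin N => N ≤ k + κ))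
    have h7 := Finset.card_union_le (Finset.univ.filter fun k : Fin N => (k : ℕ) < κ)
          (Finset.univ.filter fun k : Fin N => N ≤ k + κ)
    omega
  have h1' : (N : ℝ) - 2 * κ ≤ s.card := by
    have : (N : ℝ) ≤ s.card + 2 * κ := by exact_mod_cast h1
    linarith
  have hκN' : 2 * (κ : ℝ) ≤ N := by exact_mod_cast hκN
  rw [Finset.card_compl, Nat.cast_sub (Finset.card_le_univ _), Fintype.card_piFinset]
  simp only [Finset.prod_const, Finset.card_univ, Fintype.card_fin, Fintype.card_pi]
  push_cast
  have h8 := one_add_mul_le_pow (a := -(2 * κ / N : ℝ)) (by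
    have : 2 * (κ : ℝ) / N ≤ 1 := by rwa [div_le_one hN']
    linarith) d
  have h9 : (1 + -(2 * κ / N : ℝ)) ^ d * N ^ d ≤ (s.card : ℝ) ^ d := by
    rw [← mul_pow]
    have : (1 + -(2 * κ / N : ℝ)) * N = N - 2 * κ := by field_simp; ring
    rw [this]
    exact pow_le_pow_left₀ (by linarith) h1' d
  have h10 : (0 : ℝ) ≤ (N : ℝ) ^ d := by positivity
  nlinarith [mul_le_mul_of_nonneg_right h8 h10]

theorem exists_grid_size (d κ : ℕ) {q : ℝ} (hq : 1 < q) :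
    ∃ N : ℕ, 0 < N ∧ 2 * κ ≤ N ∧ (1 + κ ^ d) * ((d : ℝ) * (2 * κ / N)) ≤ 1 / 2 ∧
      (1 + κ ^ d) * ((d : ℝ) * (2 * κ / N)) ^ (1 - 1 / q) ≤ 1 / 2 := by
  have hpos : 0 < 1 - 1 / q := by
    have : 1 / q < 1 := by rw [div_lt_one (by linarith)]; exact hq
    linarith
  have h1 : Tendsto (fun N : ℕ => (d : ℝ) * (2 * κ / N)) atTop (𝓝 0) := by
    simpa using (tendsto_const_div_atTop_nhds_zero_nat (2 * (κ : ℝ))).const_mul (d : ℝ)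
  have h2 : Tendsto (fun N : ℕ => (1 + (κ : ℝ) ^ d) * ((d : ℝ) * (2 * κ / N))) atTop (𝓝 0) := by
    simpa using h1.const_mul (1 + (κ : ℝ) ^ d)
  have h3 : Tendsto (fun N : ℕ => (1 + (κ : ℝ) ^ d) * ((d : ℝ) * (2 * κ / N)) ^ (1 - 1 / q)) atTop
      (𝓝 0) := by
    have := (h1.rpow_const (p := 1 - 1 / q) (Or.inr hpos.le)).const_mul (1 + (κ : ℝ) ^ d)
    rwa [Real.zero_rpow hpos.ne', mul_zero] at this
  have h := (h2.eventually_le_const (show (0 : ℝ) < 1 / 2 by norm_num)).and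
    (h3.eventually_le_const (show (0 : ℝ) < 1 / 2 by norm_num))
  obtain ⟨N, ⟨h4, h5⟩, h6⟩ := (h.and (eventually_ge_atTop (2 * κ + 1))).exists
  exact ⟨N, by omega, by omega, h4, h5⟩

theorem exists_oscillation_improvement (d : ℕ) {q : ℝ} (hq : 1 < q) {κ : ℕ} (hκ : 1 ≤ κ) :
    ∃ C : ℝ≥0, ∀ {E : Type*} [NormedAddCommGroup E] (f : (Fin d → ℝ) → E)
      (g : (Fin d → ℝ) → ℝ≥0) (D₀ : Set (Fin d → ℝ))
      (_ : AEStronglyMeasurable f (volume.restrict D₀)) (K A B : ℝ≥0)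
      (_ : ∀ c r, 0 < r → closedBall c (κ * r) ⊆ D₀ →
        ∃ y, ∫⁻ x in closedBall c r, ‖f x - y‖ₑ ≤ K * holderBound g q (closedBall c (κ * r)))
      (_ : ∀ c r, 0 < r → closedBall c r ⊆ D₀ →
        ∃ y, ∫⁻ x in closedBall c r, ‖f x - y‖ₑ ≤
          A * holderBound g q (closedBall c r) + B * volume (closedBall c r))
      (c : Fin d → ℝ) (r : ℝ) (_ : 0 < r) (_ : closedBall c r ⊆ D₀),
      ∃ y, ∫⁻ x in closedBall c r, ‖f x - y‖ₑ ≤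
        (A / 2 + C * K : ℝ≥0) * holderBound g q (closedBall c r) +
          (B / 2 : ℝ≥0) * volume (closedBall c r) := by
  obtain ⟨N, hN, hκN, hθ1, hθ2⟩ := exists_grid_size d κ hq
  refine ⟨N ^ d * ((1 + κ ^ d) + κ ^ d + (2 * κ) ^ d * (κ * N * 2)), ?_⟩
  intro E _ f g D₀ hf K A B hloc hAB c r hr hD
  have hN' : (0 : ℝ) < N := by exact_mod_cast hN
  have hκ' : (0 : ℝ) < κ := by exact_mod_cast hκ
  have hκ1 : (1 : ℝ) ≤ κ := by exact_mod_cast hκ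
  set ρ := r / N with hρd
  have hρ : 0 < ρ := by positivity
  have hNρ : N * ρ = r := by rw [hρd]; field_simp
  have hρr : ρ ≤ r := by
    have : (1 : ℝ) ≤ N := by exact_mod_cast hN
    nlinarith
  set σ := ρ / κ with hσd
  have hσ : 0 < σ := by positivity
  have hκσ : κ * σ = ρ := by rw [hσd]; field_simp
  set M := holderBound g q (closedBall c r) with hM
  set v := volume (closedBall c ρ) with hv
  have hvol : ∀ z s, 0 ≤ s → volume (closedBall z s) = volume (closedBall c s) := fun z s hs => by
    rw [volume_closedBall z hs, volume_closedBall c hs]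
  have hvσ : ∀ z, v = κ ^ d * volume (closedBall z σ) := fun z => by
    rw [hv, ← hκσ, volume_closedBall_mul c z hσ.le hκ'.le, ENNReal.ofReal_pow hκ'.le]
    simp
  have hvσ2 : ∀ z, v = (2 * κ) ^ d * volume (closedBall z (σ / 2)) := fun z => by
    rw [hv, ← hκσ, show κ * σ = 2 * κ * (σ / 2) by ring,
      volume_closedBall_mul c z (by positivity) (by positivity), ENNReal.ofReal_pow (by positivity)]
    simp [ENNReal.ofReal_mul]
  have hmeas : ∀ z s, closedBall z s ⊆ closedBall c r →
      AEStronglyMeasurable f (volume.restrict (closedBall z s)) := fun z s hs =>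
    hf.mono_measure (Measure.restrict_mono_set _ (hs.trans hD))
  -- small cubes around all admissible centers
  have hY : ∀ z, ∃ y, z ∈ closedBall c (r - ρ) →
      ∫⁻ x in closedBall z σ, ‖f x - y‖ₑ ≤ K * M := by
    intro z
    by_cases hz : z ∈ closedBall c (r - ρ)
    · have hsub : closedBall z (κ * σ) ⊆ closedBall c r := by
        rw [hκσ]
        refine closedBall_subset_closedBall' ?_
        rw [mem_closedBall] at hz
        linarith
      obtain ⟨y, hy⟩ := hloc z σ hσ (hsub.trans hD)
      exact ⟨y, fun _ => hy.trans (by gcongr; exact holderBound_mono g hq hsub)⟩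
    · exact ⟨0, fun h => absurd h hz⟩
  choose Y hY using hY
  have hsubσ : ∀ z ∈ closedBall c (r - ρ), closedBall z ρ ⊆ closedBall c r := fun z hz => by
    refine closedBall_subset_closedBall' ?_
    rw [mem_closedBall] at hz
    linarith
  have hσρ : σ ≤ ρ := by rw [← hκσ]; nlinarith
  have hchain : ∀ z ∈ closedBall c (r - ρ), ‖Y z - Y c‖ₑ * volume (closedBall c (σ / 2)) ≤
      ((κ * N : ℕ) : ℝ≥0∞) * (K * M + K * M) := by
    intro z hz
    refine enorm_sub_mul_le_of_chain (convex_closedBall c (r - ρ)) (σ := σ) ?_ (κ * N) z hz c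
      (mem_closedBall_self (by linarith)) ?_
    · intro z hz w hw hzw
      have hmz : dist (midpoint ℝ z w) z ≤ σ / 2 := by
        rw [dist_midpoint_left, Real.norm_ofNat]; linarith
      have hmw : dist (midpoint ℝ z w) w ≤ σ / 2 := by
        rw [dist_midpoint_right, Real.norm_ofNat]; linarith
      have hbz : closedBall (midpoint ℝ z w) (σ / 2) ⊆ closedBall z σ :=
        closedBall_subset_closedBall' (by linarith)
      have hbw : closedBall (midpoint ℝ z w) (σ / 2) ⊆ closedBall w σ :=
        closedBall_subset_closedBall' (by linarith)
      have h1 := enorm_sub_mul_measure_le (hmeas (midpoint ℝ z w) (σ / 2)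
        (hbz.trans ((closedBall_subset_closedBall hσρ).trans (hsubσ z hz)))) (Y z) (Y w)
      rw [Measure.restrict_apply_univ, hvol _ _ (by positivity)] at h1
      refine h1.trans (add_le_add ?_ ?_)
      · exact (lintegral_mono_set hbz).trans (hY z hz)
      · exact (lintegral_mono_set hbw).trans (hY w hw)
    · rw [mem_closedBall] at hz
      push_cast
      calc dist z c ≤ r := by linarith
        _ = κ * N * σ := by rw [← hNρ, ← hκσ]; ring
  set Gd := Fintype.piFinset fun _ : Fin d =>
      (Finset.univ.filter fun k : Fin N => κ ≤ k ∧ k + κ < N) with hGd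
  set D := fun n : Fin d → Fin N => closedBall (gridCenter N c r n) ρ with hDdef
  have hDsub : ∀ n, D n ⊆ closedBall c r := fun n => closedBall_gridCenter_subset hN c hr.le n
  set bad : (Fin d → Fin N) → ℝ≥0∞ := fun n =>
    if n ∈ Gd then 0 else A * holderBound g q (D n) + B * v with hbad
  have hcenter : ∀ n, gridCenter N c r n ∈ closedBall c (r - ρ) := by
    intro n
    rw [mem_closedBall, dist_pi_le_iff (by linarith)]
    intro i
    have h0 : (0 : ℝ) ≤ (n i : ℕ) := by positivity
    have h1 : ((n i : ℕ) : ℝ) + 1 ≤ N := by exact_mod_cast (n i).2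
    rw [Real.dist_eq, gridCenter, abs_le, ← hρd]
    constructor <;> nlinarith
  have hgood : ∀ n ∈ Gd, closedBall (gridCenter N c r n) (κ * ρ) ⊆ closedBall c r := by
    intro n hn
    refine closedBall_subset_closedBall' ?_
    rw [add_comm, ← le_sub_iff_add_le]
    have hκN' : 2 * (κ : ℝ) ≤ N := by exact_mod_cast hκN
    rw [dist_pi_le_iff (by rw [← hNρ]; nlinarith)]
    intro i
    have hi := Fintype.mem_piFinset.1 hn i
    simp only [Finset.mem_filter, Finset.mem_univ, true_and] at hi
    have h0 : (κ : ℝ) ≤ (n i : ℕ) := by exact_mod_cast hi.1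
    have h1 : ((n i : ℕ) : ℝ) + κ + 1 ≤ N := by exact_mod_cast hi.2
    rw [Real.dist_eq, gridCenter, abs_le, ← hρd]
    constructor <;> nlinarith
  have hy : ∀ n, ∃ y, ∫⁻ x in D n, ‖f x - y‖ₑ ≤ K * M + bad n := by
    intro n
    by_cases hn : n ∈ Gd
    · obtain ⟨y, hy⟩ := hloc _ ρ hρ ((hgood n hn).trans hD)
      refine ⟨y, hy.trans (le_add_right ?_)⟩
      gcongr
      exact holderBound_mono g hq (hgood n hn)
    · obtain ⟨y, hy⟩ := hAB _ ρ hρ ((hDsub n).trans hD)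
      refine ⟨y, hy.trans (le_add_left ?_)⟩
      simp only [hbad, hn, if_false]
      rw [hvol _ _ hρ.le]
  choose y hy using hy
  have hcell : ∀ n, ∫⁻ x in D n, ‖f x - Y c‖ₑ ≤ (1 + κ ^ d) * bad n +
      ((1 + κ ^ d) + κ ^ d + (2 * κ) ^ d * (κ * N * 2)) * (K * M) := by
    intro n
    set z := gridCenter N c r n with hz
    have hDσ : closedBall z σ ⊆ D n := closedBall_subset_closedBall hσρ
    have h1 := enorm_sub_mul_measure_le (hmeas z σ (hDσ.trans (hDsub n))) (y n) (Y z)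
    rw [Measure.restrict_apply_univ] at h1
    have h2 : ‖y n - Y z‖ₑ * v ≤ κ ^ d * ((K * M + bad n) + K * M) := by
      rw [hvσ z, mul_left_comm]
      gcongr
      refine h1.trans (add_le_add ((lintegral_mono_set hDσ).trans (hy n)) (hY z (hcenter n)))
    have h3 : ‖Y z - Y c‖ₑ * v ≤ (2 * κ) ^ d * ((κ * N : ℕ) * (K * M + K * M)) := by
      rw [hvσ2 c, mul_left_comm]
      exact mul_le_mul_right (hchain z (hcenter n)) _
    calc ∫⁻ x in D n, ‖f x - Y c‖ₑ
        ≤ ∫⁻ x in D n, (‖f x - y n‖ₑ + (‖y n - Y z‖ₑ + ‖Y z - Y c‖ₑ)) := by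
          refine lintegral_mono fun x => ?_
          calc ‖f x - Y c‖ₑ = ‖(f x - y n) + ((y n - Y z) + (Y z - Y c))‖ₑ := by
                congr 1; abel
            _ ≤ _ := (enorm_add_le _ _).trans (by gcongr; exact enorm_add_le _ _)
      _ = (∫⁻ x in D n, ‖f x - y n‖ₑ) + (‖y n - Y z‖ₑ * v + ‖Y z - Y c‖ₑ * v) := by
          rw [lintegral_add_right _ measurable_const, lintegral_const,
            Measure.restrict_apply_univ, hvol _ _ hρ.le, add_mul, ← hv]
      _ ≤ (K * M + bad n) + (κ ^ d * ((K * M + bad n) + K * M) +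
            (2 * κ) ^ d * ((κ * N : ℕ) * (K * M + K * M))) := by
          exact add_le_add (hy n) (add_le_add h2 h3)
      _ = _ := by push_cast; ring
  refine ⟨Y c, ?_⟩
  rw [lintegral_grid hN c hr]
  have hbadsum : (1 + κ ^ d) * ∑ n, bad n ≤
      (2⁻¹ : ℝ≥0) * (A * M + B * volume (closedBall c r)) := by
    set θ : ℝ := d * (2 * κ / N) with hθ
    have hθ0 : 0 ≤ θ := by positivity
    have hcard : ((Gdᶜ.card : ℕ) : ℝ≥0∞) * v ≤ ENNReal.ofReal θ * volume (closedBall c r) := by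
      have hV : volume (closedBall c r) = ENNReal.ofReal (N ^ d) * v := by
        rw [← hNρ, volume_closedBall_mul c c hρ.le hN'.le]
      rw [hV, ← mul_assoc, ← ENNReal.ofReal_mul hθ0, ← ENNReal.ofReal_natCast]
      gcongr
      exact card_compl_interior_le d hN hκN
    have hsum : ∑ n, bad n = A * ∑ n ∈ Gdᶜ, holderBound g q (D n) + B * (Gdᶜ.card * v) := by
      rw [← Finset.sum_add_sum_compl Gd]
      have h1 : ∑ n ∈ Gd, bad n = 0 := Finset.sum_eq_zero fun n hn => by simp [hbad, hn]
      have h2 : ∑ n ∈ Gdᶜ, bad n = ∑ n ∈ Gdᶜ, (A * holderBound g q (D n) + B * v) :=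
        Finset.sum_congr rfl fun n hn => by
          rw [Finset.mem_compl] at hn
          simp [hbad, hn]
      rw [h1, h2, zero_add, Finset.sum_add_distrib, Finset.mul_sum, Finset.sum_const]
      simp only [nsmul_eq_mul]
      ring
    have hq1 := one_sub_one_div_nonneg hq
    have hq0 : 0 ≤ 1 / q := by positivity
    have hh : ∑ n ∈ Gdᶜ, holderBound g q (D n) ≤ ENNReal.ofReal (θ ^ (1 - 1 / q)) * M := by
      refine (sum_holderBound_le _ D g hq).trans ?_
      have h1 : ∑ n ∈ Gdᶜ, volume (D n) = Gdᶜ.card * v := by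
        rw [Finset.sum_congr rfl fun n _ => hvol _ _ hρ.le, Finset.sum_const, nsmul_eq_mul]
      have h2 : ∑ n ∈ Gdᶜ, ∫⁻ x in D n, (g x : ℝ≥0∞) ^ q ≤
          ∫⁻ x in closedBall c r, (g x : ℝ≥0∞) ^ q := by
        rw [lintegral_grid hN c hr]
        exact Finset.sum_le_sum_of_subset (Finset.subset_univ _)
      rw [h1, hM, holderBound, ← ENNReal.ofReal_rpow_of_nonneg hθ0 hq1, ← mul_assoc,
        ← ENNReal.mul_rpow_of_nonneg _ _ hq1]
      gcongr
    have hhalf : ∀ x : ℝ, (1 + κ ^ d) * x ≤ 1 / 2 →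
        (1 + κ ^ d : ℝ≥0∞) * ENNReal.ofReal x ≤ (2⁻¹ : ℝ≥0) := by
      intro x hx
      have h1 : (1 + κ ^ d : ℝ≥0∞) = ENNReal.ofReal (1 + κ ^ d) := by
        rw [ENNReal.ofReal_add (by norm_num) (by positivity), ENNReal.ofReal_pow (by positivity)]
        simp
      rw [h1, ← ENNReal.ofReal_mul (by positivity), ← ENNReal.ofReal_coe_nnreal]
      refine ENNReal.ofReal_le_ofReal (hx.trans_eq ?_)
      norm_num
    calc (1 + κ ^ d) * ∑ n, bad n
        ≤ (1 + κ ^ d) * (A * (ENNReal.ofReal (θ ^ (1 - 1 / q)) * M) +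
            B * (ENNReal.ofReal θ * volume (closedBall c r))) := by
          rw [hsum]
          gcongr
      _ = A * (((1 + κ ^ d) * ENNReal.ofReal (θ ^ (1 - 1 / q))) * M) +
          B * (((1 + κ ^ d) * ENNReal.ofReal θ) * volume (closedBall c r)) := by ring
      _ ≤ A * ((2⁻¹ : ℝ≥0) * M) + B * ((2⁻¹ : ℝ≥0) * volume (closedBall c r)) := by
          gcongr
          · exact hhalf _ hθ2
          · exact hhalf _ hθ1
      _ = _ := by ring
  calc ∑ n, ∫⁻ x in D n, ‖f x - Y c‖ₑ
      ≤ ∑ n, ((1 + κ ^ d) * bad n +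
      ((1 + κ ^ d) + κ ^ d + (2 * κ) ^ d * (κ * N * 2)) * (K * M)) :=
        Finset.sum_le_sum fun n _ => hcell n
    _ = (1 + κ ^ d) * ∑ n, bad n +
        N ^ d * (((1 + κ ^ d) + κ ^ d + (2 * κ) ^ d * (κ * N * 2)) * (K * M)) := by
        rw [Finset.sum_add_distrib, ← Finset.mul_sum, Finset.sum_const, Finset.card_univ]
        simp
    _ ≤ (2⁻¹ : ℝ≥0) * (A * M + B * volume (closedBall c r)) +
        N ^ d * (((1 + κ ^ d) + κ ^ d + (2 * κ) ^ d * (κ * N * 2)) * (K * M)) := by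
        gcongr
    _ = _ := by
        rw [div_eq_mul_inv, div_eq_mul_inv]
        push_cast
        ring

/-- If the oscillation of `f` on a cube is controlled by `g` on a concentric dilated cube, and
`‖f‖ ≤ g + L`, then the oscillation on any cube is controlled by `g` on the same cube, with a
constant independent of `L`. -/
theorem exists_oscillation_le_of_dilated (d : ℕ) {q : ℝ} (hq : 1 < q) {κ : ℕ} (hκ : 1 ≤ κ)
    (K : ℝ≥0) :
    ∃ C : ℝ≥0, ∀ {E : Type*} [NormedAddCommGroup E] [NormedSpace ℝ E] [CompleteSpace E]
      (f : (Fin d → ℝ) → E)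
      (g : (Fin d → ℝ) → ℝ≥0) (_ : Measurable g) (D₀ : Set (Fin d → ℝ)) (_ : IntegrableOn f D₀)
      (L : ℝ≥0) (_ : ∀ x ∈ D₀, ‖f x‖ ≤ g x + L)
      (_ : ∀ c r, 0 < r → closedBall c (κ * r) ⊆ D₀ →
        ∃ y, ∫⁻ x in closedBall c r, ‖f x - y‖ₑ ≤ K * holderBound g q (closedBall c (κ * r)))
      (c : Fin d → ℝ) (r : ℝ) (_ : 0 < r) (_ : closedBall c r ⊆ D₀),
      ∫⁻ x in closedBall c r, ‖f x - cubeAvg f c r‖ₑ ≤ C * holderBound g q (closedBall c r) := by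
  obtain ⟨C', hC'⟩ := exists_oscillation_improvement d hq hκ
  set A : ℝ≥0 := 1 + 2 * (C' * K) with hA
  refine ⟨2 * A, ?_⟩
  intro E _ _ _ f g hg D₀ hf L hL hloc c r hr hD
  have hclaim : ∀ k : ℕ, ∀ c r, 0 < r → closedBall c r ⊆ D₀ →
      ∃ y, ∫⁻ x in closedBall c r, ‖f x - y‖ₑ ≤
        A * holderBound g q (closedBall c r) + (L / 2 ^ k : ℝ≥0) * volume (closedBall c r) := by
    intro k
    induction k with
    | zero =>
      intro c r hr hD
      refine ⟨0, ?_⟩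
      calc ∫⁻ x in closedBall c r, ‖f x - 0‖ₑ ≤ ∫⁻ x in closedBall c r, ((g x : ℝ≥0∞) + L) := by
            refine setLIntegral_mono' measurableSet_closedBall fun x hx => ?_
            rw [sub_zero, ← ENNReal.coe_add, enorm_le_coe]
            exact_mod_cast hL x (hD hx)
        _ = (∫⁻ x in closedBall c r, (g x : ℝ≥0∞)) + L * volume (closedBall c r) := by
            rw [lintegral_add_right _ measurable_const, lintegral_const,
              Measure.restrict_apply_univ]
        _ ≤ _ := by
            rw [pow_zero, div_one]
            gcongr
            refine (lintegral_le_holderBound hg hq _).trans ?_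
            refine le_mul_of_one_le_left' ?_
            rw [hA]
            exact_mod_cast le_self_add
    | succ k ih =>
      intro c r hr hD
      obtain ⟨y, hy⟩ := hC' f g D₀ hf.aestronglyMeasurable K A (L / 2 ^ k) hloc ih c r hr hD
      refine ⟨y, hy.trans ?_⟩
      have h1 : A / 2 + C' * K ≤ A := by
        rw [← NNReal.coe_le_coe, hA]
        push_cast
        linarith
      have h2 : L / 2 ^ k / 2 = L / 2 ^ (k + 1) := by rw [div_div, pow_succ]
      rw [h2]
      gcongr
  have hlim : ∀ k : ℕ, ∫⁻ x in closedBall c r, ‖f x - cubeAvg f c r‖ₑ ≤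
      2 * (A * holderBound g q (closedBall c r) +
        (L / 2 ^ k : ℝ≥0) * volume (closedBall c r)) := by
    intro k
    obtain ⟨y, hy⟩ := hclaim k c r hr hD
    have h1 := enorm_cubeAvg_sub_mul_le hr (hf.mono_set hD) y
    calc ∫⁻ x in closedBall c r, ‖f x - cubeAvg f c r‖ₑ
        ≤ ∫⁻ x in closedBall c r, (‖f x - y‖ₑ + ‖cubeAvg f c r - y‖ₑ) := by
          refine lintegral_mono fun x => ?_
          rw [← sub_sub_sub_cancel_right (f x) (cubeAvg f c r) y]
          exact enorm_sub_le
      _ = (∫⁻ x in closedBall c r, ‖f x - y‖ₑ) +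
          ‖cubeAvg f c r - y‖ₑ * volume (closedBall c r) := by
          rw [lintegral_add_right _ measurable_const, lintegral_const, Measure.restrict_apply_univ]
      _ ≤ 2 * ∫⁻ x in closedBall c r, ‖f x - y‖ₑ := by
          rw [two_mul]
          gcongr
      _ ≤ _ := by gcongr
  have htend : Tendsto (fun k : ℕ => 2 * (A * holderBound g q (closedBall c r) +
        (L / 2 ^ k : ℝ≥0) * volume (closedBall c r))) atTop
      (𝓝 (2 * (A * holderBound g q (closedBall c r) + (0 : ℝ≥0) * volume (closedBall c r)))) := by
    have h0 : Tendsto (fun k : ℕ => L / 2 ^ k) atTop (𝓝 0) := by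
      have := (tendsto_pow_atTop_nhds_zero_of_lt_one (r := (2⁻¹ : ℝ≥0)) (by simp)
        (inv_lt_one_of_one_lt₀ (by norm_num))).const_mul L
      simpa [div_eq_mul_inv] using this
    refine ENNReal.Tendsto.const_mul (tendsto_const_nhds.add ?_) (Or.inr (by norm_num))
    exact ENNReal.Tendsto.mul_const (ENNReal.tendsto_coe.2 h0)
      (Or.inr (volume_closedBall_ne_top c r))
  refine (ge_of_tendsto' htend hlim).trans_eq ?_
  push_cast
  ring

end InteriorToAllCubes

section MeanValue

open scoped ContDiff

variable {d : ℕ}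

/-- The partial derivative in the `j`-th coordinate direction. -/
noncomputable def pd (j : Fin d) (φ : (Fin d → ℝ) → ℝ) (x : Fin d → ℝ) : ℝ :=
  fderiv ℝ φ x (Pi.single j 1)

/-- A smooth cutoff on the line, equal to `1` for `s ≤ 1/4` and to `0` for `1/2 ≤ s`. -/
noncomputable def cutoff (s : ℝ) : ℝ := Real.smoothTransition (2 - 4 * s)

theorem contDiff_cutoff : ContDiff ℝ ∞ cutoff :=
  Real.smoothTransition.contDiff.comp (contDiff_const.sub (contDiff_const.mul contDiff_id))

theorem cutoff_nonneg (s : ℝ) : 0 ≤ cutoff s := Real.smoothTransition.nonneg _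

theorem cutoff_le_one (s : ℝ) : cutoff s ≤ 1 := Real.smoothTransition.le_one _

theorem cutoff_of_le {s : ℝ} (hs : s ≤ 1 / 4) : cutoff s = 1 :=
  Real.smoothTransition.one_of_one_le (by linarith)

theorem cutoff_of_ge {s : ℝ} (hs : 1 / 2 ≤ s) : cutoff s = 0 :=
  Real.smoothTransition.zero_of_nonpos (by linarith)

/-- The squared Euclidean norm on `Fin d → ℝ`. -/
def nsq (w : Fin d → ℝ) : ℝ := ∑ i, w i ^ 2

theorem contDiff_nsq : ContDiff ℝ ∞ (nsq : (Fin d → ℝ) → ℝ) := by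
  unfold nsq
  fun_prop

theorem norm_sq_le_nsq (w : Fin d → ℝ) : ‖w‖ ^ 2 ≤ nsq w := by
  have h0 : 0 ≤ nsq w := Finset.sum_nonneg fun i _ => sq_nonneg _
  refine Real.le_sqrt (norm_nonneg _) h0 |>.1 ?_
  refine (pi_norm_le_iff_of_nonneg (Real.sqrt_nonneg _)).2 fun i => ?_
  refine Real.le_sqrt_of_sq_le ?_
  rw [Real.norm_eq_abs, sq_abs]
  exact Finset.single_le_sum (f := fun i => w i ^ 2) (fun i _ => sq_nonneg _) (Finset.mem_univ i)

theorem nsq_le_mul_norm_sq (w : Fin d → ℝ) : nsq w ≤ d * ‖w‖ ^ 2 := by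
  calc nsq w ≤ ∑ _i : Fin d, ‖w‖ ^ 2 := Finset.sum_le_sum fun i _ => by
        rw [← sq_abs]
        exact pow_le_pow_left₀ (abs_nonneg _) (norm_le_pi_norm w i) 2
    _ = _ := by simp

theorem hasFDerivAt_nsq_apply (w : Fin d → ℝ) (j : Fin d) :
    pd j nsq w = 2 * w j := by
  have : HasFDerivAt (nsq : (Fin d → ℝ) → ℝ)
      (∑ i, (2 * w i) • (ContinuousLinearMap.proj i : (Fin d → ℝ) →L[ℝ] ℝ)) w := by
    unfold nsq
    refine HasFDerivAt.fun_sum fun i _ => ?_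
    have := (hasFDerivAt_apply (𝕜 := ℝ) i w).pow 2
    simpa using this
  rw [pd, this.fderiv]
  simp [Pi.single_apply]

/-- The unnormalized radial kernel at scale `t`. -/
noncomputable def bump (t : ℝ) (w : Fin d → ℝ) : ℝ := (t ^ d)⁻¹ * cutoff (nsq w / t ^ 2)

/-- A radial vector field whose divergence is the derivative of `bump` in the scale. -/
noncomputable def bumpField (t : ℝ) (k : Fin d) (w : Fin d → ℝ) : ℝ :=
  -(t ^ (d + 1))⁻¹ * (w k * cutoff (nsq w / t ^ 2))

theorem contDiff_bump (t : ℝ) : ContDiff ℝ ∞ (bump t : (Fin d → ℝ) → ℝ) :=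
  contDiff_const.mul (contDiff_cutoff.comp (contDiff_nsq.div_const _))

theorem contDiff_bumpField (t : ℝ) (k : Fin d) : ContDiff ℝ ∞ (bumpField t k) :=
  contDiff_const.mul ((contDiff_apply ℝ ℝ k).mul (contDiff_cutoff.comp (contDiff_nsq.div_const _)))

theorem cutoff_nsq_of_le_norm {t : ℝ} (ht : 0 < t) {w : Fin d → ℝ} (hw : 3 / 4 * t ≤ ‖w‖) :
    cutoff (nsq w / t ^ 2) = 0 := by
  apply cutoff_of_ge
  rw [le_div_iff₀ (by positivity)]
  have := norm_sq_le_nsq w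
  nlinarith [pow_le_pow_left₀ (by positivity) hw 2, pow_pos ht 2]

theorem tsupport_subset_closedBall {X : Type*} [PseudoMetricSpace X] {x : X} {r : ℝ} {φ : X → ℝ}
    (h : ∀ w, r ≤ dist w x → φ w = 0) : tsupport φ ⊆ closedBall x r := by
  refine closure_minimal (fun w hw => ?_) isClosed_closedBall
  rw [mem_closedBall]
  by_contra hcon
  exact hw (h w (not_le.1 hcon).le)

theorem bump_of_le_norm {t : ℝ} (ht : 0 < t) {w : Fin d → ℝ} (hw : 3 / 4 * t ≤ ‖w‖) :
    bump t w = 0 := by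
  rw [bump, cutoff_nsq_of_le_norm ht hw, mul_zero]

theorem bumpField_of_le_norm {t : ℝ} (ht : 0 < t) (k : Fin d) {w : Fin d → ℝ}
    (hw : 3 / 4 * t ≤ ‖w‖) : bumpField t k w = 0 := by
  rw [bumpField, cutoff_nsq_of_le_norm ht hw, mul_zero, mul_zero]

theorem pd_bumpField {t : ℝ} (j k : Fin d) (w : Fin d → ℝ) :
    pd j (bumpField t k) w = -(t ^ (d + 1))⁻¹ *
      ((if j = k then 1 else 0) * cutoff (nsq w / t ^ 2) +
        w k * (deriv cutoff (nsq w / t ^ 2) * (2 * w j / t ^ 2))) := by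
  have h1 : HasFDerivAt (fun w : Fin d → ℝ => nsq w / t ^ 2)
      ((t ^ 2)⁻¹ • fderiv ℝ nsq w) w := by
    have := ((contDiff_nsq (d := d)).differentiable (by simp) w).hasFDerivAt.const_mul (t ^ 2)⁻¹
    simpa [div_eq_inv_mul] using this
  have h2 := (contDiff_cutoff.differentiable (by simp) (nsq w / t ^ 2)).hasDerivAt.comp_hasFDerivAt
    w h1
  have h3 := ((hasFDerivAt_apply (𝕜 := ℝ) k w).mul h2).const_mul (-(t ^ (d + 1))⁻¹)
  have h4 := hasFDerivAt_nsq_apply w j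
  rw [pd] at h4
  rw [pd]
  unfold bumpField
  erw [h3.fderiv]
  simp only [Pi.single_apply, _root_.smul_apply, _root_.add_apply, h4,
    ContinuousLinearMap.proj_apply, Function.comp_apply, smul_eq_mul, eq_comm (a := j)]
  split_ifs <;> ring

theorem pd_bumpField_comm {t : ℝ} (j k : Fin d) (w : Fin d → ℝ) :
    pd j (bumpField t k) w = pd k (bumpField t j) w := by
  rw [pd_bumpField, pd_bumpField]
  simp only [eq_comm (a := k)]
  ring

theorem hasDerivAt_bump {t : ℝ} (ht : t ≠ 0) (w : Fin d → ℝ) :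
    HasDerivAt (fun t => bump t w) (∑ k, pd k (bumpField t k) w) t := by
  have h1 : HasDerivAt (fun t : ℝ => nsq w / t ^ 2) (nsq w * (-(2 * t) / (t ^ 2) ^ 2)) t := by
    have := ((hasDerivAt_pow 2 t).fun_inv (pow_ne_zero 2 ht)).const_mul (nsq w)
    simpa [div_eq_mul_inv] using this
  have h2 := (contDiff_cutoff.differentiable (by simp) (nsq w / t ^ 2)).hasDerivAt.comp t h1
  have h3 := ((hasDerivAt_pow d t).fun_inv (pow_ne_zero d ht)).mul h2
  refine h3.congr_deriv ?_
  simp only [pd_bumpField, Function.comp_apply, if_true, one_mul]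
  have h5 : ∑ k, w k * (deriv cutoff (nsq w / t ^ 2) * (2 * w k / t ^ 2))
      = nsq w * (2 * deriv cutoff (nsq w / t ^ 2) / t ^ 2) := by
    rw [nsq, Finset.sum_mul]
    exact Finset.sum_congr rfl fun k _ => by ring
  rw [← Finset.mul_sum, Finset.sum_add_distrib, h5]
  simp only [Finset.sum_const, Finset.card_univ, Fintype.card_fin, nsmul_eq_mul]
  rcases Nat.eq_zero_or_pos d with rfl | hd
  · simp; field_simp
  · obtain ⟨n, rfl⟩ : ∃ n, d = n + 1 := ⟨d - 1, by omega⟩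
    simp only [Nat.add_sub_cancel]
    field_simp
    ring

/-- `h` is curl-free in the sense of distributions. -/
def IsCurlFree (h : (Fin d → ℝ) → Fin d → ℝ) : Prop :=
  ∀ φ : (Fin d → ℝ) → ℝ, ContDiff ℝ ∞ φ → HasCompactSupport φ → ∀ i j,
    ∫ y, h y i * pd j φ y = ∫ y, h y j * pd i φ y

/-- `h` is divergence-free in the open set `U` in the sense of distributions. -/
def IsDivFreeOn (h : (Fin d → ℝ) → Fin d → ℝ) (U : Set (Fin d → ℝ)) : Prop :=
  ∀ φ : (Fin d → ℝ) → ℝ, ContDiff ℝ ∞ φ → HasCompactSupport φ → tsupport φ ⊆ U →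
    ∑ i, ∫ y, h y i * pd i φ y = 0

theorem pd_comp_sub_left {φ : (Fin d → ℝ) → ℝ} (hφ : ContDiff ℝ ∞ φ) (x : Fin d → ℝ) (j : Fin d)
    (y : Fin d → ℝ) :
    pd j (fun y => φ (x - y)) y = -pd j φ (x - y) := by
  have h1 := (hφ.differentiable (by simp) (x - y)).hasFDerivAt.comp y
    ((hasFDerivAt_id y).const_sub x)
  rw [pd, pd]
  erw [h1.fderiv]
  simp

theorem continuous_pd {φ : (Fin d → ℝ) → ℝ} (hφ : ContDiff ℝ ∞ φ) (j : Fin d) :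
    Continuous (pd j φ) :=
  (hφ.continuous_fderiv (by simp)).clm_apply continuous_const

theorem hasCompactSupport_pd {φ : (Fin d → ℝ) → ℝ} (hφ : HasCompactSupport φ) (j : Fin d) :
    HasCompactSupport (pd j φ) :=
  hφ.fderiv_apply ℝ _

theorem pd_eq_zero_of_notMem {φ : (Fin d → ℝ) → ℝ} {x : Fin d → ℝ} (hx : x ∉ tsupport φ)
    (j : Fin d) : pd j φ x = 0 := by
  rw [pd, fderiv_of_notMem_tsupport (𝕜 := ℝ) hx]
  rfl

theorem tsupport_bumpField_comp {t : ℝ} (ht : 0 < t) (k : Fin d) (x : Fin d → ℝ) :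
    tsupport (fun y => bumpField t k (x - y)) ⊆ closedBall x (3 / 4 * t) :=
  tsupport_subset_closedBall fun y hy => bumpField_of_le_norm ht k (by
    rwa [← dist_eq_norm, dist_comm])

theorem hasCompactSupport_of_tsupport_subset {x : Fin d → ℝ} {r : ℝ} {φ : (Fin d → ℝ) → ℝ}
    (h : tsupport φ ⊆ closedBall x r) : HasCompactSupport φ :=
  (isCompact_closedBall x r).of_isClosed_subset (isClosed_tsupport φ) h

theorem sum_integral_mul_pd_bumpField_eq_zero {h : (Fin d → ℝ) → Fin d → ℝ}
    (hc : IsCurlFree h) {z : Fin d → ℝ} {ρ : ℝ} (hd : IsDivFreeOn h (ball z ρ))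
    {x : Fin d → ℝ} {t : ℝ} (ht : 0 < t) (hx : dist x z + t ≤ ρ) (j : Fin d) :
    ∑ k, ∫ y, h y j * pd k (bumpField t k) (x - y) = 0 := by
  have hsm : ∀ k, ContDiff ℝ ∞ fun y => bumpField t k (x - y) := fun k =>
    (contDiff_bumpField t k).comp (contDiff_const.sub contDiff_id)
  have hcs : ∀ k, HasCompactSupport fun y => bumpField t k (x - y) := fun k =>
    hasCompactSupport_of_tsupport_subset (tsupport_bumpField_comp ht k x)
  have h1 := hd _ (hsm j) (hcs j) ((tsupport_bumpField_comp ht j x).trans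
    (closedBall_subset_ball' (by linarith [dist_comm x z])))
  simp only [pd_comp_sub_left (contDiff_bumpField t _), mul_neg, integral_neg,
      Finset.sum_neg_distrib, neg_eq_zero] at h1
  rw [← h1]
  refine Finset.sum_congr rfl fun k _ => ?_
  have h2 := hc _ (hsm k) (hcs k) j k
  simp only [pd_comp_sub_left (contDiff_bumpField t _), mul_neg, integral_neg, neg_inj] at h2
  rw [h2]
  simp only [pd_bumpField_comm j k]

theorem exists_bound_deriv_bump {a b : ℝ} (ha : 0 < a) (hb : 0 < b) :
    ∃ B : ℝ, ∀ t ∈ Icc a b, ∀ w : Fin d → ℝ,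
      ‖∑ k, pd k (bumpField t k) w‖ ≤ (closedBall 0 b).indicator (fun _ => B) w := by
  have hcont : ContinuousOn (fun q : ℝ × (Fin d → ℝ) => ∑ k, pd k (bumpField q.1 k) q.2)
      (Icc a b ×ˢ closedBall 0 b) := by
    simp only [pd_bumpField]
    have hne : ∀ q ∈ Icc a b ×ˢ closedBall (0 : Fin d → ℝ) b, q.1 ≠ 0 := fun q hq =>
      (ha.trans_le hq.1.1).ne'
    have hs : ContinuousOn (fun q : ℝ × (Fin d → ℝ) => nsq q.2 / q.1 ^ 2)
        (Icc a b ×ˢ closedBall 0 b) :=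
      ((contDiff_nsq.continuous.comp continuous_snd).continuousOn).div (by fun_prop)
        fun q hq => pow_ne_zero 2 (hne q hq)
    have hf : ContinuousOn (fun q : ℝ × (Fin d → ℝ) => cutoff (nsq q.2 / q.1 ^ 2))
        (Icc a b ×ˢ closedBall 0 b) := contDiff_cutoff.continuous.comp_continuousOn hs
    have hf' : ContinuousOn (fun q : ℝ × (Fin d → ℝ) => deriv cutoff (nsq q.2 / q.1 ^ 2))
        (Icc a b ×ˢ closedBall 0 b) :=
      (contDiff_cutoff.continuous_deriv (by simp)).comp_continuousOn hs
    have hi : ContinuousOn (fun q : ℝ × (Fin d → ℝ) => (q.1 ^ (d + 1))⁻¹)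
        (Icc a b ×ˢ closedBall 0 b) :=
      ContinuousOn.inv₀ (by fun_prop) fun q hq => pow_ne_zero _ (hne q hq)
    have hw : ∀ k, ContinuousOn (fun q : ℝ × (Fin d → ℝ) => 2 * q.2 k / q.1 ^ 2)
        (Icc a b ×ˢ closedBall 0 b) := fun k =>
      ContinuousOn.div (by fun_prop) (by fun_prop) fun q hq => pow_ne_zero _ (hne q hq)
    refine continuousOn_finsetSum _ fun k _ => hi.neg.mul ((continuousOn_const.mul hf).add
      (ContinuousOn.mul (by fun_prop) (hf'.mul (hw k))))
  obtain ⟨B, hB⟩ :=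
      (isCompact_Icc.prod (isCompact_closedBall (0 : Fin d → ℝ) b)).exists_bound_of_continuousOn
          hcont
  refine ⟨B, fun t ht w => ?_⟩
  by_cases hw : w ∈ closedBall (0 : Fin d → ℝ) b
  · rw [indicator_of_mem hw]
    exact hB (t, w) ⟨ht, hw⟩
  · rw [indicator_of_notMem hw]
    have ht0 : 0 < t := ha.trans_le ht.1
    have : ∀ k, pd k (bumpField t k) w = 0 := fun k => by
      refine pd_eq_zero_of_notMem (fun hw' => hw ?_) k
      refine closedBall_subset_closedBall (by nlinarith [ht.2]) (tsupport_subset_closedBall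
        (fun w hw => bumpField_of_le_norm ht0 k ?_) hw' : w ∈ closedBall 0 (3 / 4 * t))
      simpa using hw
    simp [this]

theorem integrable_mul_comp_sub {h : (Fin d → ℝ) → ℝ} (hh : LocallyIntegrable h volume)
    {φ : (Fin d → ℝ) → ℝ} (hφ : Continuous φ) (hφc : HasCompactSupport φ) (x : Fin d → ℝ) :
    Integrable (fun y => h y * φ (x - y)) := by
  refine hh.integrable_smul_right_of_hasCompactSupport (g := fun y => φ (x - y))
    (hφ.comp (continuous_const.sub continuous_id)) ?_
  exact hφc.comp_homeomorph (Homeomorph.subLeft x)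

theorem hasCompactSupport_bump {t : ℝ} (ht : 0 < t) :
    HasCompactSupport (bump t : (Fin d → ℝ) → ℝ) := by
  refine hasCompactSupport_of_tsupport_subset (x := 0) (r := 3 / 4 * t) (tsupport_subset_closedBall
    fun y hy => bump_of_le_norm ht ?_)
  simpa using hy

theorem hasCompactSupport_bumpField {t : ℝ} (ht : 0 < t) (k : Fin d) :
    HasCompactSupport (bumpField t k) := by
  refine hasCompactSupport_of_tsupport_subset (x := 0) (r := 3 / 4 * t) (tsupport_subset_closedBall
    fun y hy => bumpField_of_le_norm ht k ?_)
  simpa using hy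

theorem hasDerivAt_integral_mul_bump {h : (Fin d → ℝ) → ℝ} (hh : LocallyIntegrable h volume)
    (x : Fin d → ℝ) {t : ℝ} (ht : 0 < t) :
    HasDerivAt (fun t => ∫ y, h y * bump t (x - y))
      (∑ k, ∫ y, h y * pd k (bumpField t k) (x - y)) t := by
  obtain ⟨B, hB⟩ := exists_bound_deriv_bump (d := d) (half_pos ht) (b := 2 * t) (by positivity)
  have hfint : ∀ k, Integrable fun y => h y * pd k (bumpField t k) (x - y) := fun k =>
    integrable_mul_comp_sub hh (continuous_pd (contDiff_bumpField t k) k)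
      (hasCompactSupport_pd (hasCompactSupport_bumpField ht k) k) x
  have := (hasDerivAt_integral_of_dominated_loc_of_deriv_le (𝕜 := ℝ) (μ := volume) (x₀ := t)
    (s := Icc (t / 2) (2 * t)) (F := fun t y => h y * bump t (x - y))
    (F' := fun t y => h y * ∑ k, pd k (bumpField t k) (x - y))
    (bound := fun y => ‖h y‖ * (closedBall x (2 * t)).indicator (fun _ => B) y)
    (Icc_mem_nhds (by linarith) (by linarith)) ?_ ?_ ?_ ?_ ?_ ?_).2
  · refine this.congr_deriv ?_
    simp only [Finset.mul_sum]
    exact integral_finsetSum _ fun k _ => hfint k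
  · filter_upwards with s
    exact hh.aestronglyMeasurable.mul ((contDiff_bump s).continuous.comp
      (continuous_const.sub continuous_id)).aestronglyMeasurable
  · exact integrable_mul_comp_sub hh (contDiff_bump t).continuous (hasCompactSupport_bump ht) x
  · simp only [Finset.mul_sum]
    exact (integrable_finsetSum _ fun k _ => hfint k).aestronglyMeasurable
  · filter_upwards with y s hs
    rw [norm_mul]
    gcongr
    refine (hB s hs (x - y)).trans_eq ?_
    have : x - y ∈ closedBall (0 : Fin d → ℝ) (2 * t) ↔ y ∈ closedBall x (2 * t) := by
      rw [mem_closedBall_zero_iff, mem_closedBall, dist_comm, dist_eq_norm]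
    by_cases hy : y ∈ closedBall x (2 * t)
    · rw [indicator_of_mem hy, indicator_of_mem (this.2 hy)]
    · rw [indicator_of_notMem hy, indicator_of_notMem (this.not.2 hy)]
  · have h1 : IntegrableOn (fun y => ‖h y‖ * B) (closedBall x (2 * t)) :=
      ((hh.integrableOn_isCompact (isCompact_closedBall x (2 * t))).norm).mul_const B
    refine (h1.integrable_indicator measurableSet_closedBall).congr ?_
    filter_upwards with y
    by_cases hy : y ∈ closedBall x (2 * t)
    · simp [indicator_of_mem hy]
    · simp [indicator_of_notMem hy]
  · filter_upwards with y s hs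
    exact (hasDerivAt_bump (by linarith [hs.1]) (x - y)).const_mul (h y)

/-- The total mass of the radial kernel. -/
noncomputable def bumpMass (d : ℕ) : ℝ := ∫ w : Fin d → ℝ, bump 1 w

theorem bump_nonneg {t : ℝ} (ht : 0 < t) (w : Fin d → ℝ) : 0 ≤ bump t w :=
  mul_nonneg (by positivity) (cutoff_nonneg _)

theorem bump_le {t : ℝ} (ht : 0 < t) (w : Fin d → ℝ) : bump t w ≤ (t ^ d)⁻¹ :=
  mul_le_of_le_one_right (by positivity) (cutoff_le_one _)

theorem bumpMass_pos (d : ℕ) : 0 < bumpMass d := by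
  refine (contDiff_bump 1).continuous.integral_pos_of_hasCompactSupport_nonneg_nonzero
    (hasCompactSupport_bump one_pos) (bump_nonneg one_pos) (x := 0) ?_
  simp [bump, nsq, cutoff_of_le]

theorem bump_eq_bump_one {t : ℝ} (w : Fin d → ℝ) : bump t w = (t ^ d)⁻¹ * bump 1 (t⁻¹ • w) := by
  simp only [bump, nsq, one_pow, inv_one, one_mul, div_one, Pi.smul_apply, smul_eq_mul]
  congr 2
  rw [Finset.sum_div]
  refine Finset.sum_congr rfl fun i _ => ?_
  rw [mul_pow, inv_pow, div_eq_inv_mul]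

theorem integral_bump {t : ℝ} (ht : 0 < t) : ∫ w : Fin d → ℝ, bump t w = bumpMass d := by
  simp only [bump_eq_bump_one (t := t)]
  rw [integral_const_mul, Measure.integral_comp_inv_smul volume (bump 1) t]
  simp only [Module.finrank_fin_fun, smul_eq_mul]
  rw [abs_of_pos (by positivity), inv_mul_cancel_left₀ (by positivity), bumpMass]

theorem tendsto_integral_mul_bump {h : (Fin d → ℝ) → ℝ} (hh : LocallyIntegrable h volume) :
    ∀ᵐ x, Tendsto (fun t => ∫ y, h y * bump t (x - y)) (𝓝[>] 0) (𝓝 (bumpMass d * h x)) := by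
  filter_upwards [IsUnifLocDoublingMeasure.ae_tendsto_average_norm_sub volume hh 1] with x hx
  have h1 := hx (ι := ℝ) (l := 𝓝[>] 0) (fun _ => x) id tendsto_id (by
    filter_upwards [self_mem_nhdsWithin] with t ht
    exact mem_closedBall_self (by simpa using le_of_lt ht))
  rw [tendsto_iff_norm_sub_tendsto_zero]
  refine squeeze_zero' (Eventually.of_forall fun _ => norm_nonneg _) ?_
    (by simpa using h1.const_mul ((2 : ℝ) ^ d))
  filter_upwards [self_mem_nhdsWithin] with t (ht : 0 < t)
  have hbi := integrable_mul_comp_sub hh (contDiff_bump t).continuous (hasCompactSupport_bump ht) x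
  have hci : Integrable fun y => bump t (x - y) := by
    simpa using integrable_mul_comp_sub (h := fun _ => 1) (locallyIntegrable_const 1)
      (contDiff_bump t).continuous (hasCompactSupport_bump ht) x
  have h2 : bumpMass d * h x = ∫ y, h x * bump t (x - y) := by
    rw [integral_const_mul, integral_sub_left_eq_self (fun y => bump t y), integral_bump ht,
        mul_comm]
  rw [h2, ← integral_sub hbi (hci.const_mul _), setAverage_eq, smul_eq_mul, Measure.real,
    Real.volume_pi_closedBall _ ht.le]
  have hvol : (ENNReal.ofReal ((2 * t) ^ Fintype.card (Fin d))).toReal = (2 * t) ^ d := by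
    rw [ENNReal.toReal_ofReal (by positivity), Fintype.card_fin]
  rw [hvol, mul_pow, mul_inv, ← mul_assoc, ← mul_assoc, mul_inv_cancel₀ (by positivity), one_mul,
    ← integral_const_mul]
  have hon : Integrable fun y => (closedBall x t).indicator (fun y =>
      (t ^ d)⁻¹ * ‖h y - h x‖) y := by
    refine IntegrableOn.integrable_indicator ?_ measurableSet_closedBall
    exact (((hh.integrableOn_isCompact (isCompact_closedBall x t)).sub
      (integrableOn_const (measure_closedBall_lt_top.ne))).norm).const_mul _
  rw [← integral_indicator measurableSet_closedBall]
  refine norm_integral_le_of_norm_le hon (Eventually.of_forall fun y => ?_)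
  rw [← sub_mul, norm_mul]
  by_cases hy : y ∈ closedBall x t
  · rw [indicator_of_mem hy, mul_comm]
    gcongr
    rw [Real.norm_of_nonneg (bump_nonneg ht _)]
    · exact bump_le ht _
    · exact le_rfl
  · rw [indicator_of_notMem hy, bump_of_le_norm ht]
    · simp
    · rw [mem_closedBall, dist_comm, dist_eq_norm, not_le] at hy
      linarith

/-- The normalized radial kernel at scale `t`. -/
noncomputable def kernel (t : ℝ) (w : Fin d → ℝ) : ℝ := (bumpMass d)⁻¹ * bump t w

/-- **Weyl's lemma**, as a mean value formula for curl-free and divergence-free fields. -/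
theorem ae_eq_integral_mul_kernel {h : (Fin d → ℝ) → Fin d → ℝ}
    (hh : LocallyIntegrable h volume) (hc : IsCurlFree h) {z : Fin d → ℝ} {ρ : ℝ}
    (hd : IsDivFreeOn h (ball z ρ)) {r t : ℝ} (ht : 0 < t) (hr : r + t < ρ) :
    ∀ᵐ x, x ∈ closedBall z r → ∀ j, h x j = ∫ y, h y j * kernel t (x - y) := by
  have hhj : ∀ j, LocallyIntegrable (fun y => h y j) volume := fun j x => by
    obtain ⟨s, hs, hi⟩ := hh x
    exact ⟨s, hs, Integrable.eval hi j⟩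
  filter_upwards [ae_all_iff.2 fun j => tendsto_integral_mul_bump (hhj j)] with x hx hxz j
  have hder : ∀ s ∈ Ioo 0 (ρ - r), HasDerivAt (fun t => ∫ y, h y j * bump t (x - y)) 0 s := by
    intro s hs
    have := hasDerivAt_integral_mul_bump (hhj j) x hs.1
    rwa [sum_integral_mul_pd_bumpField_eq_zero hc hd hs.1
      (by linarith [hs.2, mem_closedBall.1 hxz]) j] at this
  have hconst : ∀ s ∈ Ioo 0 (ρ - r), ∫ y, h y j * bump s (x - y) = ∫ y, h y j * bump t (x - y) :=
    fun s hs => isOpen_Ioo.is_const_of_deriv_eq_zero isPreconnected_Ioo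
      (fun u hu => (hder u hu).differentiableAt.differentiableWithinAt)
      (fun u hu => (hder u hu).deriv) hs ⟨ht, by linarith⟩
  have hlim : Tendsto (fun s => ∫ y, h y j * bump s (x - y)) (𝓝[>] 0)
      (𝓝 (∫ y, h y j * bump t (x - y))) := by
    refine tendsto_const_nhds.congr' ?_
    filter_upwards [Ioo_mem_nhdsGT (show (0 : ℝ) < ρ - r by linarith)] with s hs
    exact (hconst s hs).symm
  have := tendsto_nhds_unique (hx j) hlim
  simp only [kernel, mul_left_comm _ (bumpMass d)⁻¹]
  rw [integral_const_mul, ← this, inv_mul_cancel_left₀ (bumpMass_pos d).ne']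

theorem contDiff_kernel (t : ℝ) : ContDiff ℝ ∞ (kernel t : (Fin d → ℝ) → ℝ) :=
  contDiff_const.mul (contDiff_bump t)

theorem kernel_nonneg {t : ℝ} (ht : 0 < t) (w : Fin d → ℝ) : 0 ≤ kernel t w :=
  mul_nonneg (inv_nonneg.2 (bumpMass_pos d).le) (bump_nonneg ht w)

theorem kernel_of_le_norm {t : ℝ} (ht : 0 < t) {w : Fin d → ℝ} (hw : 3 / 4 * t ≤ ‖w‖) :
    kernel t w = 0 := by
  rw [kernel, bump_of_le_norm ht hw, mul_zero]

theorem hasCompactSupport_kernel {t : ℝ} (ht : 0 < t) :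
    HasCompactSupport (kernel t : (Fin d → ℝ) → ℝ) :=
  (hasCompactSupport_bump ht).mul_left

theorem integrable_kernel_sub {t : ℝ} (ht : 0 < t) (x : Fin d → ℝ) :
    Integrable fun y => kernel t (x - y) := by
  simpa using integrable_mul_comp_sub (h := fun _ => 1) (locallyIntegrable_const 1)
    (contDiff_kernel t).continuous (hasCompactSupport_kernel ht) x

theorem integral_kernel_sub {t : ℝ} (ht : 0 < t) (x : Fin d → ℝ) :
    ∫ y, kernel t (x - y) = 1 := by
  rw [integral_sub_left_eq_self (fun y => kernel t y)]
  simp only [kernel]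
  rw [integral_const_mul, integral_bump ht, inv_mul_cancel₀ (bumpMass_pos d).ne']

theorem exists_lipschitz_kernel (d : ℕ) : ∃ L : ℝ≥0, ∀ t : ℝ, 0 < t → ∀ w w' : Fin d → ℝ,
    |kernel t w - kernel t w'| ≤ L / t ^ (d + 1) * ‖w - w'‖ := by
  obtain ⟨L, hL⟩ := ((contDiff_kernel (d := d) 1).of_le (m := 1)
      (by simp)).lipschitzWith_of_hasCompactSupport (hasCompactSupport_kernel one_pos) one_ne_zero
  refine ⟨L, fun t ht w w' => ?_⟩
  have hk : ∀ w : Fin d → ℝ, kernel t w = (t ^ d)⁻¹ * kernel 1 (t⁻¹ • w) := fun w => by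
    rw [kernel, bump_eq_bump_one, kernel]
    ring
  rw [hk, hk, ← mul_sub, abs_mul, abs_of_pos (by positivity)]
  have := hL.dist_le_mul (t⁻¹ • w) (t⁻¹ • w')
  rw [Real.dist_eq, dist_eq_norm, ← smul_sub, norm_smul, norm_inv,
      Real.norm_of_nonneg ht.le] at this
  calc (t ^ d)⁻¹ * |kernel 1 (t⁻¹ • w) - kernel 1 (t⁻¹ • w')|
      ≤ (t ^ d)⁻¹ * (L * (t⁻¹ * ‖w - w'‖)) := by gcongr
    _ = _ := by rw [pow_succ]; field_simp

/-- Interior Lipschitz estimate for curl-free and divergence-free fields. -/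
theorem exists_norm_sub_le_of_isDivFreeOn (d : ℕ) : ∃ C : ℝ≥0, ∀ {h : (Fin d → ℝ) → Fin d → ℝ},
    LocallyIntegrable h volume → IsCurlFree h → ∀ {z : Fin d → ℝ} {r t : ℝ}, 0 < t →
    IsDivFreeOn h (ball z (r + 2 * t)) → ∀ y₀ : Fin d → ℝ,
    ∀ᵐ x, x ∈ closedBall z r → ∀ᵐ x', x' ∈ closedBall z r →
      ‖h x - h x'‖ ≤ C / t ^ (d + 1) * ‖x - x'‖ * ∫ y in closedBall z (r + t), ‖h y - y₀‖ := by
  obtain ⟨L, hL⟩ := exists_lipschitz_kernel d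
  refine ⟨L, fun {h} hh hc {z r t} ht hd y₀ => ?_⟩
  have hhj : ∀ j, LocallyIntegrable (fun y => h y j) volume := fun j x => by
    obtain ⟨s, hs, hi⟩ := hh x
    exact ⟨s, hs, Integrable.eval hi j⟩
  have hae := ae_eq_integral_mul_kernel hh hc hd ht (r := r) (by linarith)
  filter_upwards [hae] with x hx hxz
  filter_upwards [hae] with x' hx' hxz'
  have hon : IntegrableOn (fun y => ‖h y - y₀‖) (closedBall z (r + t)) :=
    ((hh.integrableOn_isCompact (isCompact_closedBall z (r + t))).sub
      (integrableOn_const measure_closedBall_lt_top.ne)).norm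
  refine (pi_norm_le_iff_of_nonneg (mul_nonneg (by positivity)
    (integral_nonneg fun _ => norm_nonneg _))).2 fun j => ?_
  have hk := fun x : Fin d → ℝ => integrable_kernel_sub ht x
  have hhk : ∀ x, Integrable fun y => h y j * kernel t (x - y) := fun x =>
    integrable_mul_comp_sub (hhj j) (contDiff_kernel t).continuous (hasCompactSupport_kernel ht) x
  have heq : (h x - h x') j = ∫ y, (h y j - y₀ j) * (kernel t (x - y) - kernel t (x' - y)) := by
    have h1 : ∫ y, (h y j * kernel t (x - y) - h y j * kernel t (x' - y)) = h x j - h x' j := by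
      rw [integral_sub (hhk x) (hhk x'), ← hx hxz j, ← hx' hxz' j]
    have h2 : ∫ y, y₀ j * (kernel t (x - y) - kernel t (x' - y)) = 0 := by
      rw [integral_const_mul, integral_sub (hk x) (hk x'), integral_kernel_sub ht,
        integral_kernel_sub ht, sub_self, mul_zero]
    have h3 := integral_sub ((hhk x).sub (hhk x')) (((hk x).sub (hk x')).const_mul (y₀ j))
    simp only [Pi.sub_apply] at h3
    rw [h1, h2, sub_zero] at h3
    rw [Pi.sub_apply, ← h3]
    refine integral_congr_ae (Eventually.of_forall fun y => ?_)
    simp only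
    ring
  rw [heq, ← integral_const_mul, ← integral_indicator measurableSet_closedBall]
  refine norm_integral_le_of_norm_le (IntegrableOn.integrable_indicator (hon.const_mul _)
    measurableSet_closedBall) (Eventually.of_forall fun y => ?_)
  rw [norm_mul]
  by_cases hy : y ∈ closedBall z (r + t)
  · rw [indicator_of_mem hy, mul_comm]
    gcongr
    · refine (hL t ht _ _).trans_eq ?_
      rw [sub_sub_sub_cancel_right]
    · exact norm_le_pi_norm (h y - y₀) j
  · have hfar : ∀ x ∈ closedBall z r, kernel t (x - y) = 0 := fun x hx => by
      apply kernel_of_le_norm ht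
      rw [mem_closedBall, not_le] at hy
      rw [← dist_eq_norm]
      linarith [dist_triangle y x z, mem_closedBall.1 hx, dist_comm x y]
    rw [indicator_of_notMem hy, hfar x hxz, hfar x' hxz']
    simp

end MeanValue

section GradientProjection

variable {d : ℕ}

theorem contDiff_pd {φ : (Fin d → ℝ) → ℝ} (hφ : ContDiff ℝ ((⊤ : ℕ∞) : WithTop ℕ∞) φ) (j : Fin d) :
    ContDiff ℝ ((⊤ : ℕ∞) : WithTop ℕ∞) (pd j φ) :=
  (hφ.fderiv_right (by simp)).clm_apply contDiff_const

theorem pd_pd_comm {φ : (Fin d → ℝ) → ℝ} (hφ : ContDiff ℝ ((⊤ : ℕ∞) : WithTop ℕ∞) φ) (i j : Fin d)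
    (x : Fin d → ℝ) : pd i (pd j φ) x = pd j (pd i φ) x := by
  have hd : DifferentiableAt ℝ (fderiv ℝ φ) x :=
    (hφ.fderiv_right (m := 1) (by norm_cast)).differentiable (by simp) x
  have h : ∀ j, fderiv ℝ (pd j φ) x = (fderiv ℝ (fderiv ℝ φ) x).flip (Pi.single j 1) := fun j => by
    unfold pd
    rw [fderiv_clm_apply hd (by fun_prop)]
    simp
  have hs := (hφ.contDiffAt (x := x)).isSymmSndFDerivAt
    (by simpa using WithTop.coe_le_coe.2 (le_top : (2 : ℕ∞) ≤ ⊤))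
  rw [pd, pd, h, h]
  exact hs _ _

theorem ae_lineDeriv_eq_pd {v : (Fin d → ℝ) → ℝ} {C : ℝ≥0} (hv : LipschitzWith C v) :
    ∀ᵐ x, ∀ j, lineDeriv ℝ v x (Pi.single j 1) = pd j v x := by
  filter_upwards [hv.ae_differentiableAt] with x hx j
  exact hx.lineDeriv_eq_fderiv

theorem isCurlFree_gradient {v : (Fin d → ℝ) → ℝ} {C : ℝ≥0} (hv : LipschitzWith C v) :
    IsCurlFree fun x j => pd j v x := by
  intro φ hφ hφc i j
  have key : ∀ i j, ∫ y, pd i v y * pd j φ y = -∫ y, pd i (pd j φ) y * v y := fun i j => by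
    have hsm := contDiff_pd hφ j
    have hcs := hasCompactSupport_pd hφc j
    obtain ⟨D, hD⟩ := (hsm.of_le (m := 1) (by norm_cast)).lipschitzWith_of_hasCompactSupport
      hcs one_ne_zero
    have h1 := hv.integral_lineDeriv_mul_eq (μ := volume) hD hcs (Pi.single i 1)
    have h2 : ∫ y, pd i v y * pd j φ y = ∫ y, lineDeriv ℝ v y (Pi.single i 1) * pd j φ y :=
      integral_congr_ae (by
        filter_upwards [ae_lineDeriv_eq_pd hv] with y hy
        rw [hy])
    rw [h2, h1, ← integral_neg]
    refine integral_congr_ae (Eventually.of_forall fun y => ?_)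
    simp only
    rw [(hsm.differentiable (by simp) y).lineDeriv_eq_fderiv, map_neg, neg_mul]
    rfl
  simp only
  rw [key, key]
  simp only [pd_pd_comm hφ i j]

/-- Square-integrable vector fields, with the Euclidean inner product. -/
noncomputable abbrev L2Field (d : ℕ) :=
    Lp (EuclideanSpace ℝ (Fin d)) 2 (volume : Measure (Fin d → ℝ))

theorem memLp_toEuclidean {F : (Fin d → ℝ) → Fin d → ℝ} {p : ℝ≥0∞} (hF : MemLp F p volume) :
    MemLp (fun x => WithLp.toLp 2 (F x)) p volume :=
  (EuclideanSpace.equiv (Fin d) ℝ).symm.toContinuousLinearMap.comp_memLp' hF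

theorem memLp_ofEuclidean {F : (Fin d → ℝ) → EuclideanSpace ℝ (Fin d)} {p : ℝ≥0∞}
    (hF : MemLp F p volume) : MemLp (fun x => WithLp.ofLp (F x)) p volume :=
  (EuclideanSpace.equiv (Fin d) ℝ).toContinuousLinearMap.comp_memLp' hF

theorem memLp_gradient {φ : (Fin d → ℝ) → ℝ} (hφ : ContDiff ℝ ((⊤ : ℕ∞) : WithTop ℕ∞) φ)
    (hφc : HasCompactSupport φ) : MemLp (fun x j => pd j φ x) 2 volume :=
  memLp_pi_iff.2 fun j =>
      (continuous_pd hφ j).memLp_of_hasCompactSupport (hasCompactSupport_pd hφc j)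

/-- The closed subspace of `L²` generated by gradients of test functions. -/
noncomputable def gradientSpace (d : ℕ) : Submodule ℝ (L2Field d) :=
  (Submodule.span ℝ {G | ∃ (φ : (Fin d → ℝ) → ℝ) (hφ : ContDiff ℝ ((⊤ : ℕ∞) : WithTop ℕ∞) φ)
    (hφc : HasCompactSupport φ),
      G = (memLp_toEuclidean (memLp_gradient hφ hφc)).toLp _}).topologicalClosure

instance : CompleteSpace (gradientSpace d) :=
  (Submodule.isClosed_topologicalClosure _).completeSpace_coe

open Classical in
/-- The Helmholtz projection of a vector field onto the gradients. -/
noncomputable def gradProj (F : (Fin d → ℝ) → Fin d → ℝ) (x : Fin d → ℝ) : Fin d → ℝ :=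
  if hF : MemLp F 2 volume then
    WithLp.ofLp ((gradientSpace d).starProjection ((memLp_toEuclidean hF).toLp _) x)
  else 0

theorem gradProj_eq {F : (Fin d → ℝ) → Fin d → ℝ} (hF : MemLp F 2 volume) :
    gradProj F = fun x =>
      WithLp.ofLp ((gradientSpace d).starProjection ((memLp_toEuclidean hF).toLp _) x) := by
  funext x
  rw [gradProj, dif_pos hF]

theorem memLp_gradProj {F : (Fin d → ℝ) → Fin d → ℝ} (hF : MemLp F 2 volume) :
    MemLp (gradProj F) 2 volume := by
  rw [gradProj_eq hF]
  exact memLp_ofEuclidean (Lp.memLp _)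

theorem toLp_gradProj {F : (Fin d → ℝ) → Fin d → ℝ} (hF : MemLp F 2 volume) :
    (memLp_toEuclidean (memLp_gradProj hF)).toLp _ =
      (gradientSpace d).starProjection ((memLp_toEuclidean hF).toLp _) := by
  refine Lp.ext ?_
  filter_upwards [MemLp.coeFn_toLp (memLp_toEuclidean (memLp_gradProj hF))] with x hx
  rw [hx, gradProj_eq hF]

theorem inner_toLp_eq_integral {F H : (Fin d → ℝ) → Fin d → ℝ} (hF : MemLp F 2 volume)
    (hH : MemLp H 2 volume) :
    inner ℝ ((memLp_toEuclidean hF).toLp _ : L2Field d) ((memLp_toEuclidean hH).toLp _) =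
      ∫ x, ∑ i, F x i * H x i := by
  rw [L2.inner_def]
  refine integral_congr_ae ?_
  filter_upwards [MemLp.coeFn_toLp (memLp_toEuclidean hF), MemLp.coeFn_toLp (memLp_toEuclidean hH)]
    with x h1 h2
  rw [h1, h2, PiLp.inner_apply]
  refine Finset.sum_congr rfl fun i _ => ?_
  simp [mul_comm]

theorem integral_gradProj_mul_comm {F H : (Fin d → ℝ) → Fin d → ℝ} (hF : MemLp F 2 volume)
    (hH : MemLp H 2 volume) :
    ∫ x, ∑ i, gradProj F x i * H x i = ∫ x, ∑ i, F x i * gradProj H x i := by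
  rw [← inner_toLp_eq_integral (memLp_gradProj hF) hH, ← inner_toLp_eq_integral hF
    (memLp_gradProj hH), toLp_gradProj hF, toLp_gradProj hH]
  exact Submodule.inner_starProjection_left_eq_right _ _ _

theorem integral_sum_sq_gradProj_le {F : (Fin d → ℝ) → Fin d → ℝ} (hF : MemLp F 2 volume) :
    ∫ x, ∑ i, gradProj F x i * gradProj F x i ≤ ∫ x, ∑ i, F x i * F x i := by
  rw [← inner_toLp_eq_integral (memLp_gradProj hF) (memLp_gradProj hF),
    ← inner_toLp_eq_integral hF hF, toLp_gradProj hF, real_inner_self_eq_norm_sq,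
    real_inner_self_eq_norm_sq]
  exact pow_le_pow_left₀ (norm_nonneg _) (Submodule.norm_starProjection_apply_le _ _) 2

theorem integrable_mul_of_memLp {f g : (Fin d → ℝ) → ℝ} (hf : MemLp f 2 volume)
    (hg : MemLp g 2 volume) : Integrable fun x => f x * g x :=
  hf.integrable_mul hg

theorem sum_integral_gradProj_mul_pd {F : (Fin d → ℝ) → Fin d → ℝ} (hF : MemLp F 2 volume)
    {φ : (Fin d → ℝ) → ℝ} (hφ : ContDiff ℝ ((⊤ : ℕ∞) : WithTop ℕ∞) φ) (hφc : HasCompactSupport φ) :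
    ∑ i, ∫ x, gradProj F x i * pd i φ x = ∑ i, ∫ x, F x i * pd i φ x := by
  have hg := memLp_gradient hφ hφc
  have hi : ∀ {H : (Fin d → ℝ) → Fin d → ℝ}, MemLp H 2 volume →
      ∑ i, ∫ x, H x i * pd i φ x = ∫ x, ∑ i, H x i * pd i φ x := fun hH => by
    rw [integral_finsetSum]
    exact fun i _ => integrable_mul_of_memLp (memLp_pi_iff.1 hH i) (memLp_pi_iff.1 hg i)
  rw [hi hF, hi (memLp_gradProj hF), ← inner_toLp_eq_integral hF hg,
    ← inner_toLp_eq_integral (memLp_gradProj hF) hg, toLp_gradProj hF,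
    Submodule.inner_starProjection_left_eq_right, (gradientSpace d).starProjection_eq_self_iff.2]
  exact Submodule.le_topologicalClosure _ (Submodule.subset_span ⟨φ, hφ, hφc, rfl⟩)

theorem isCurlFree_gradProj {F : (Fin d → ℝ) → Fin d → ℝ} (hF : MemLp F 2 volume) :
    IsCurlFree (gradProj F) := by
  intro φ hφ hφc i j
  have hg := memLp_pi_iff.1 (memLp_gradient hφ hφc)
  set c : (Fin d → ℝ) → Fin d → ℝ := fun x k =>
    (if k = i then pd j φ x else 0) - if k = j then pd i φ x else 0 with hc
  have hcm : MemLp c 2 volume := memLp_pi_iff.2 fun k => by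
    refine MemLp.sub ?_ ?_ <;> split_ifs
    exacts [hg j, MemLp.zero, hg i, MemLp.zero]
  have hpair : ∀ {H : (Fin d → ℝ) → Fin d → ℝ}, MemLp H 2 volume → ∫ x, ∑ k, H x k * c x k =
      (∫ y, H y i * pd j φ y) - ∫ y, H y j * pd i φ y := fun hH => by
    rw [← integral_sub (integrable_mul_of_memLp (memLp_pi_iff.1 hH i) (hg j))
      (integrable_mul_of_memLp (memLp_pi_iff.1 hH j) (hg i))]
    refine integral_congr_ae (Eventually.of_forall fun x => ?_)
    simp [hc, mul_sub, Finset.sum_sub_distrib]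
  have hle : gradientSpace d ≤ (ℝ ∙ ((memLp_toEuclidean hcm).toLp _ : L2Field d))ᗮ := by
    refine Submodule.topologicalClosure_minimal _ (Submodule.span_le.2 ?_)
      (Submodule.isClosed_orthogonal _)
    rintro _ ⟨ψ, hψ, hψc, rfl⟩
    rw [SetLike.mem_coe, Submodule.mem_orthogonal_singleton_iff_inner_left,
      inner_toLp_eq_integral (memLp_gradient hψ hψc) hcm, hpair (memLp_gradient hψ hψc),
          sub_eq_zero]
    obtain ⟨D, hD⟩ := (hψ.of_le (m := 1) (by norm_cast)).lipschitzWith_of_hasCompactSupport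
      hψc one_ne_zero
    exact isCurlFree_gradient hD φ hφ hφc i j
  rw [← sub_eq_zero, ← hpair (memLp_gradProj hF), ← inner_toLp_eq_integral (memLp_gradProj hF) hcm,
    toLp_gradProj hF]
  exact Submodule.mem_orthogonal_singleton_iff_inner_left.1
    (hle (Submodule.starProjection_apply_mem _ _))

end GradientProjection

section BoundedMeanOscillation

variable {d : ℕ}

theorem volume_real_closedBall (c : Fin d → ℝ) {r : ℝ} (hr : 0 ≤ r) :
    volume.real (closedBall c r) = (2 * r) ^ d := by
  rw [Measure.real, volume_closedBall c hr, ENNReal.toReal_ofReal (by positivity)]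

theorem setIntegral_const_add_closedBall {f : (Fin d → ℝ) → ℝ} {c : Fin d → ℝ} {r : ℝ} (hr : 0 ≤ r)
    (hf : IntegrableOn f (closedBall c r)) (a : ℝ) :
    ∫ x in closedBall c r, (a + f x) = a * (2 * r) ^ d + ∫ x in closedBall c r, f x := by
  have h : IntegrableOn (fun _ => a) (closedBall c r) :=
    integrableOn_const measure_closedBall_lt_top.ne
  rw [integral_add h hf, setIntegral_const, volume_real_closedBall c hr, smul_eq_mul, mul_comm]

theorem memLp_indicator_of_norm_le_one {ξ : (Fin d → ℝ) → Fin d → ℝ} (hξ : Measurable ξ)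
    (hξ1 : ∀ x, ‖ξ x‖ ≤ 1) (c : Fin d → ℝ) (r : ℝ) (p : ℝ≥0∞) :
    MemLp ((closedBall c r).indicator ξ) p volume := by
  rw [memLp_indicator_iff_restrict measurableSet_closedBall]
  have : IsFiniteMeasure (volume.restrict (closedBall c r)) :=
    ⟨by simpa using measure_closedBall_lt_top⟩
  exact MemLp.of_bound hξ.aestronglyMeasurable 1 (Eventually.of_forall hξ1)

theorem norm_le_one_add_sum_sq (v : Fin d → ℝ) : ‖v‖ ≤ 1 + ∑ i, v i * v i := by
  have h := norm_sq_le_nsq v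
  have : nsq v = ∑ i, v i * v i := Finset.sum_congr rfl fun i _ => sq (v i)
  nlinarith [norm_nonneg v, sq_nonneg (‖v‖ - 1)]

theorem integral_norm_gradProj_le {F : (Fin d → ℝ) → Fin d → ℝ} (hF : MemLp F 2 volume)
    {c c' : Fin d → ℝ} {r : ℝ} (hr : 0 ≤ r)
    (hF1 : ∀ x, ∑ i, F x i * F x i ≤ (closedBall c' r).indicator (fun _ => (d : ℝ)) x) :
    ∫ x in closedBall c r, ‖gradProj F x‖ ≤ (1 + d) * (2 * r) ^ d := by
  have hP := memLp_gradProj hF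
  have hsq : Integrable fun x => ∑ i, gradProj F x i * gradProj F x i :=
    integrable_finsetSum _ fun i _ =>
      integrable_mul_of_memLp (memLp_pi_iff.1 hP i) (memLp_pi_iff.1 hP i)
  calc ∫ x in closedBall c r, ‖gradProj F x‖
      ≤ ∫ x in closedBall c r, (1 + ∑ i, gradProj F x i * gradProj F x i) := by
        refine setIntegral_mono ?_ ?_ fun x => norm_le_one_add_sum_sq _
        · exact ((hP.locallyIntegrable (by norm_num)).integrableOn_isCompact
            (isCompact_closedBall c r)).norm
        · exact (integrableOn_const measure_closedBall_lt_top.ne).add hsq.integrableOn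
    _ = (2 * r) ^ d + ∫ x in closedBall c r, ∑ i, gradProj F x i * gradProj F x i := by
        rw [setIntegral_const_add_closedBall hr hsq.integrableOn, one_mul]
    _ ≤ (2 * r) ^ d + ∫ x, ∑ i, gradProj F x i * gradProj F x i := by
        refine add_le_add le_rfl (setIntegral_le_integral hsq (Eventually.of_forall fun x =>
          Finset.sum_nonneg fun i _ => mul_self_nonneg _))
    _ ≤ (2 * r) ^ d + ∫ x, ∑ i, F x i * F x i := by
        exact add_le_add le_rfl (integral_sum_sq_gradProj_le hF)
    _ ≤ (2 * r) ^ d + ∫ x, (closedBall c' r).indicator (fun _ => (d : ℝ)) x := by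
        gcongr
        · exact integrable_finsetSum _ fun i _ =>
            integrable_mul_of_memLp (memLp_pi_iff.1 hF i) (memLp_pi_iff.1 hF i)
        · exact (integrableOn_const measure_closedBall_lt_top.ne).integrable_indicator
            measurableSet_closedBall
        · exact hF1
    _ = (1 + d) * (2 * r) ^ d := by
        rw [integral_indicator measurableSet_closedBall, setIntegral_const,
          volume_real_closedBall c' hr, smul_eq_mul]
        ring

theorem sum_mul_self_indicator_le {ξ : (Fin d → ℝ) → Fin d → ℝ} (hξ1 : ∀ x, ‖ξ x‖ ≤ 1)
    (S : Set (Fin d → ℝ)) (x : Fin d → ℝ) :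
    ∑ i, S.indicator ξ x i * S.indicator ξ x i ≤ S.indicator (fun _ => (d : ℝ)) x := by
  by_cases hx : x ∈ S
  · simp only [indicator_of_mem hx]
    calc ∑ i, ξ x i * ξ x i ≤ ∑ _i : Fin d, (1 : ℝ) := Finset.sum_le_sum fun i _ => by
          have := (norm_le_pi_norm (ξ x) i).trans (hξ1 x)
          rw [Real.norm_eq_abs] at this
          rw [← abs_mul_abs_self]
          exact mul_le_one₀ this (abs_nonneg _) this
      _ = d := by simp
  · simp [indicator_of_notMem hx]

theorem IsCurlFree.sub {h h' : (Fin d → ℝ) → Fin d → ℝ} (hh : LocallyIntegrable h volume)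
    (hh' : LocallyIntegrable h' volume) (hc : IsCurlFree h) (hc' : IsCurlFree h') :
    IsCurlFree (h - h') := by
  intro φ hφ hφc i j
  have hfint : ∀ {h : (Fin d → ℝ) → Fin d → ℝ}, LocallyIntegrable h volume → ∀ i j,
      Integrable fun y => h y i * pd j φ y := fun {h} hh i j => by
    have hi : LocallyIntegrable (fun y => h y i) volume := fun x => by
      obtain ⟨s, hs, hs'⟩ := hh x
      exact ⟨s, hs, Integrable.eval hs' i⟩
    exact hi.integrable_smul_right_of_hasCompactSupport (continuous_pd hφ j)
      (hasCompactSupport_pd hφc j)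
  simp only [Pi.sub_apply, sub_mul]
  rw [integral_sub (hfint hh i j) (hfint hh' i j), integral_sub (hfint hh j i) (hfint hh' j i),
    hc φ hφ hφc i j, hc' φ hφ hφc i j]

theorem isDivFreeOn_gradProj_sub {F F' : (Fin d → ℝ) → Fin d → ℝ} (hF : MemLp F 2 volume)
    (hF' : MemLp F' 2 volume) {U : Set (Fin d → ℝ)} (hU : ∀ x ∈ U, F x = F' x) :
    IsDivFreeOn (gradProj F - gradProj F') U := by
  intro φ hφ hφc hφU
  have hg := memLp_pi_iff.1 (memLp_gradient hφ hφc)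
  simp only [Pi.sub_apply, sub_mul]
  have h1 : ∀ i, ∫ y, (gradProj F y i * pd i φ y - gradProj F' y i * pd i φ y) =
      (∫ y, gradProj F y i * pd i φ y) - ∫ y, gradProj F' y i * pd i φ y := fun i =>
    integral_sub (integrable_mul_of_memLp (memLp_pi_iff.1 (memLp_gradProj hF) i) (hg i))
      (integrable_mul_of_memLp (memLp_pi_iff.1 (memLp_gradProj hF') i) (hg i))
  simp only [h1, Finset.sum_sub_distrib]
  rw [sum_integral_gradProj_mul_pd hF hφ hφc, sum_integral_gradProj_mul_pd hF' hφ hφc, sub_eq_zero]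
  refine Finset.sum_congr rfl fun i _ => integral_congr_ae (Eventually.of_forall fun y => ?_)
  by_cases hy : y ∈ tsupport φ
  · simp only [hU y (hφU hy)]
  · simp [pd_eq_zero_of_notMem hy]

/-- One step of the Campanato iteration for the projection of a bounded field. -/
theorem exists_campanato_step (d : ℕ) : ∃ C : ℝ, 0 ≤ C ∧ ∀ {ξ : (Fin d → ℝ) → Fin d → ℝ},
    Measurable ξ → (∀ x, ‖ξ x‖ ≤ 1) → MemLp ξ 2 volume → ∀ (c y : Fin d → ℝ) (ρ θ K : ℝ), 0 < ρ →
    0 < θ → θ ≤ 1 / 4 → ∫ x in closedBall c ρ, ‖gradProj ξ x - y‖ ≤ K * (2 * ρ) ^ d →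
    ∃ y', ∫ x in closedBall c (θ * ρ), ‖gradProj ξ x - y'‖ ≤
      (C * θ * (K + (1 + d)) + (1 + d) / θ ^ d) * (2 * (θ * ρ)) ^ d := by
  obtain ⟨L, hL⟩ := exists_norm_sub_le_of_isDivFreeOn d
  refine ⟨L * 4 ^ (d + 1) * 2 ^ (d + 1), by positivity,
    fun {ξ} hξ hξ1 hξ2 c y ρ θ K hρ hθ hθ4 hK => ?_⟩
  have hηm := memLp_indicator_of_norm_le_one hξ hξ1 c ρ 2
  set η := gradProj ((closedBall c ρ).indicator ξ) with hη
  set w := gradProj ξ - η with hw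
  have hξli : LocallyIntegrable (gradProj ξ) volume :=
    (memLp_gradProj hξ2).locallyIntegrable (by norm_num)
  have hηli : LocallyIntegrable η volume := (memLp_gradProj hηm).locallyIntegrable (by norm_num)
  have hwli : LocallyIntegrable w volume := hξli.sub hηli
  have hwc : IsCurlFree w := (isCurlFree_gradProj hξ2).sub hξli hηli (isCurlFree_gradProj hηm)
  have hwd : IsDivFreeOn w (ball c (θ * ρ + 2 * (ρ / 4))) :=
    isDivFreeOn_gradProj_sub hξ2 hηm fun x hx => by
      rw [indicator_of_mem (ball_subset_closedBall.trans
        (closedBall_subset_closedBall (by nlinarith)) hx)]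
  have hη1 : ∫ x in closedBall c ρ, ‖η x‖ ≤ (1 + d) * (2 * ρ) ^ d :=
    integral_norm_gradProj_le hηm hρ.le (sum_mul_self_indicator_le hξ1 _)
  have hfint : ∀ {f : (Fin d → ℝ) → Fin d → ℝ}, LocallyIntegrable f volume → ∀ y r,
      IntegrableOn (fun x => f x - y) (closedBall c r) := fun hf y r =>
    (hf.integrableOn_isCompact (isCompact_closedBall c r)).sub
      (integrableOn_const measure_closedBall_lt_top.ne)
  have hηi : ∀ r, IntegrableOn η (closedBall c r) := fun r =>
    hηli.integrableOn_isCompact (isCompact_closedBall c r)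
  have hwint : ∫ x in closedBall c (θ * ρ + ρ / 4), ‖w x - y‖ ≤ (K + (1 + d)) * (2 * ρ) ^ d := by
    calc ∫ x in closedBall c (θ * ρ + ρ / 4), ‖w x - y‖ ≤ ∫ x in closedBall c ρ, ‖w x - y‖ := by
          refine setIntegral_mono_set (hfint hwli y ρ).norm
            (Eventually.of_forall fun _ => norm_nonneg _)
            (closedBall_subset_closedBall (by nlinarith)).eventuallyLE
      _ ≤ ∫ x in closedBall c ρ, (‖gradProj ξ x - y‖ + ‖η x‖) := by
          refine setIntegral_mono (hfint hwli y ρ).norm ((hfint hξli y ρ).norm.add (hηi ρ).norm)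
            fun x => ?_
          simp only
          rw [hw, Pi.sub_apply, sub_right_comm]
          exact norm_sub_le _ _
      _ = (∫ x in closedBall c ρ, ‖gradProj ξ x - y‖) + ∫ x in closedBall c ρ, ‖η x‖ :=
          integral_add (hfint hξli y ρ).norm (hηi ρ).norm
      _ ≤ _ := by linarith
  obtain ⟨x₀, hx₀, hx₀'⟩ : ∃ x₀ ∈ closedBall c (θ * ρ), ∀ᵐ x', x' ∈ closedBall c (θ * ρ) →
      ‖w x₀ - w x'‖ ≤ L / (ρ / 4) ^ (d + 1) * ‖x₀ - x'‖ *
        ∫ y' in closedBall c (θ * ρ + ρ / 4), ‖w y' - y‖ := by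
    have hae := ae_imp_of_ae_restrict (s := closedBall c (θ * ρ)) (ae_restrict_of_ae
      (hL hwli hwc (by positivity) hwd y))
    by_contra hcon
    refine volume_closedBall_pos c (mul_pos hθ hρ) (measure_mono_null (fun x hx => ?_)
        (ae_iff.1 hae))
    intro hx'
    exact hcon ⟨x, hx, hx' hx hx⟩
  refine ⟨w x₀, ?_⟩
  have hb : ∀ᵐ x ∂volume.restrict (closedBall c (θ * ρ)), ‖gradProj ξ x - w x₀‖ ≤
      L * 4 ^ (d + 1) * 2 ^ (d + 1) * θ * (K + (1 + d)) + ‖η x‖ := by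
    filter_upwards [ae_restrict_of_ae hx₀', ae_restrict_mem measurableSet_closedBall] with x hx hxm
    have h1 : ‖x₀ - x‖ ≤ 2 * (θ * ρ) := by
      rw [← dist_eq_norm]
      linarith [dist_triangle_right x₀ x c, mem_closedBall.1 hx₀, mem_closedBall.1 hxm]
    have hKnn : 0 ≤ (K + (1 + d)) * (2 * ρ) ^ d :=
      (integral_nonneg fun _ => norm_nonneg _).trans hwint
    have h2 : ‖w x₀ - w x‖ ≤ L * 4 ^ (d + 1) * 2 ^ (d + 1) * θ * (K + (1 + d)) := by
      calc ‖w x₀ - w x‖ ≤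
          L / (ρ / 4) ^ (d + 1) * (2 * (θ * ρ)) * ((K + (1 + d)) * (2 * ρ) ^ d) := by
            refine (hx hxm).trans ?_
            gcongr
        _ = _ := by
            rw [div_pow, mul_pow 2 ρ d, pow_succ ρ, pow_succ (2 : ℝ)]
            field_simp
    have h3 : gradProj ξ x - w x₀ = (w x - w x₀) + η x := by
      rw [hw]
      simp only [Pi.sub_apply]
      abel
    rw [h3]
    refine (norm_add_le _ _).trans ?_
    rw [norm_sub_rev]
    gcongr
  calc ∫ x in closedBall c (θ * ρ), ‖gradProj ξ x - w x₀‖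
      ≤ ∫ x in closedBall c (θ * ρ),
          (L * 4 ^ (d + 1) * 2 ^ (d + 1) * θ * (K + (1 + d)) + ‖η x‖) :=
        integral_mono_ae (hfint hξli _ _).norm
          ((integrableOn_const measure_closedBall_lt_top.ne).add (hηi _).norm) hb
    _ = L * 4 ^ (d + 1) * 2 ^ (d + 1) * θ * (K + (1 + d)) * (2 * (θ * ρ)) ^ d +
          ∫ x in closedBall c (θ * ρ), ‖η x‖ := by
        rw [setIntegral_const_add_closedBall (by positivity) (hηi _).norm]
    _ ≤ L * 4 ^ (d + 1) * 2 ^ (d + 1) * θ * (K + (1 + d)) * (2 * (θ * ρ)) ^ d +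
          (1 + d) * (2 * ρ) ^ d := by
        gcongr
        refine le_trans (setIntegral_mono_set (hηi ρ).norm
          (Eventually.of_forall fun _ => norm_nonneg _)
          (closedBall_subset_closedBall (by nlinarith)).eventuallyLE) hη1
    _ = _ := by
        rw [add_mul]
        rw [mul_left_comm 2 θ ρ, mul_pow θ]
        field_simp

/-- The projection of a bounded field has bounded mean oscillation. -/
theorem exists_integral_norm_gradProj_sub_le (d : ℕ) : ∃ K : ℝ, 0 ≤ K ∧
    ∀ {ξ : (Fin d → ℝ) → Fin d → ℝ}, Measurable ξ → (∀ x, ‖ξ x‖ ≤ 1) → ∀ (c₀ : Fin d → ℝ) (r₀ : ℝ),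
    0 < r₀ → (∀ x, x ∉ closedBall c₀ r₀ → ξ x = 0) → ∀ (c : Fin d → ℝ) (r : ℝ), 0 < r → r ≤ r₀ →
    ∃ y, ∫ x in closedBall c r, ‖gradProj ξ x - y‖ ≤ K * (2 * r) ^ d := by
  obtain ⟨C, hC, hstep⟩ := exists_campanato_step d
  set θ : ℝ := (2 * C + 4)⁻¹ with hθ
  have hθ0 : 0 < θ := by positivity
  have hθ4 : θ ≤ 1 / 4 := by
    rw [hθ, one_div]
    exact inv_anti₀ (by norm_num) (by linarith)
  have hCθ : C * θ ≤ 1 / 2 := by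
    rw [hθ, ← div_eq_mul_inv, div_le_div_iff₀ (by positivity) (by norm_num)]
    linarith
  set K : ℝ := (1 + d) + 2 * ((1 + d) / θ ^ d) with hK
  have hK0 : 0 ≤ K := by positivity
  refine ⟨K / θ ^ d, by positivity, fun {ξ} hξ hξ1 c₀ r₀ hr₀ hsupp c r hr hrr => ?_⟩
  have hind : (closedBall c₀ r₀).indicator ξ = ξ := by
    rw [indicator_eq_self]
    intro x hx
    by_contra hcon
    exact hx (hsupp x hcon)
  have hξ2 : MemLp ξ 2 volume := hind ▸ memLp_indicator_of_norm_le_one hξ hξ1 c₀ r₀ 2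
  have hiter : ∀ k : ℕ, ∃ y, ∫ x in closedBall c (θ ^ k * r₀), ‖gradProj ξ x - y‖ ≤
      K * (2 * (θ ^ k * r₀)) ^ d := by
    intro k
    induction k with
    | zero =>
      refine ⟨0, ?_⟩
      simp only [sub_zero, pow_zero, one_mul]
      refine (integral_norm_gradProj_le hξ2 hr₀.le (c' := c₀) ?_).trans ?_
      · simpa only [hind] using sum_mul_self_indicator_le hξ1 (closedBall c₀ r₀)
      · gcongr
        rw [hK]
        have : 0 ≤ (1 + d : ℝ) / θ ^ d := by positivity
        linarith
    | succ k ih =>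
      obtain ⟨y, hy⟩ := ih
      obtain ⟨y', hy'⟩ := hstep hξ hξ1 hξ2 c y (θ ^ k * r₀) θ K (by positivity) hθ0 hθ4 hy
      refine ⟨y', ?_⟩
      rw [pow_succ' θ, mul_assoc]
      refine hy'.trans ?_
      gcongr
      nlinarith [show (0 : ℝ) ≤ 1 + d by positivity, show 0 ≤ (1 + d : ℝ) / θ ^ d by positivity]
  obtain ⟨k, hk1, hk2⟩ := exists_nat_pow_near_of_lt_one (div_pos hr hr₀)
    ((div_le_one hr₀).2 hrr) hθ0 (by linarith)
  rw [lt_div_iff₀ hr₀] at hk1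
  rw [div_le_iff₀ hr₀] at hk2
  obtain ⟨y, hy⟩ := hiter k
  refine ⟨y, ?_⟩
  have hli : LocallyIntegrable (gradProj ξ) volume :=
    (memLp_gradProj hξ2).locallyIntegrable (by norm_num)
  calc ∫ x in closedBall c r, ‖gradProj ξ x - y‖
      ≤ ∫ x in closedBall c (θ ^ k * r₀), ‖gradProj ξ x - y‖ :=
        setIntegral_mono_set ((hli.integrableOn_isCompact (isCompact_closedBall c _)).sub
          (integrableOn_const measure_closedBall_lt_top.ne)).norm
          (Eventually.of_forall fun _ => norm_nonneg _)
          (closedBall_subset_closedBall hk2).eventuallyLE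
    _ ≤ K * (2 * (θ ^ k * r₀)) ^ d := hy
    _ ≤ K * (2 * (r / θ)) ^ d := by
        gcongr
        rw [le_div_iff₀ hθ0]
        rw [pow_succ] at hk1
        nlinarith
    _ = _ := by
        rw [mul_div_assoc', div_pow]
        ring

end BoundedMeanOscillation

section Duality

variable {d : ℕ}

theorem lintegral_enorm_sub_cubeAvg_le {E : Type*} [NormedAddCommGroup E] [NormedSpace ℝ E]
    [CompleteSpace E] {f : (Fin d → ℝ) → E} {c : Fin d → ℝ} {r : ℝ} (hr : 0 < r)
    (hf : IntegrableOn f (closedBall c r)) (y : E) :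
    ∫⁻ x in closedBall c r, ‖f x - cubeAvg f c r‖ₑ ≤ 2 * ∫⁻ x in closedBall c r, ‖f x - y‖ₑ := by
  calc ∫⁻ x in closedBall c r, ‖f x - cubeAvg f c r‖ₑ
      ≤ ∫⁻ x in closedBall c r, (‖f x - y‖ₑ + ‖cubeAvg f c r - y‖ₑ) := lintegral_mono fun x => by
        rw [← sub_sub_sub_cancel_right (f x) (cubeAvg f c r) y]
        exact enorm_sub_le
    _ = (∫⁻ x in closedBall c r, ‖f x - y‖ₑ) + ‖cubeAvg f c r - y‖ₑ * volume (closedBall c r) := by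
        rw [lintegral_add_right _ measurable_const, setLIntegral_const]
    _ ≤ _ := by
        rw [two_mul]
        gcongr
        exact enorm_cubeAvg_sub_mul_le hr hf y

theorem holderBound_one (q : ℝ) (c : Fin d → ℝ) {r : ℝ} (hr : 0 < r) :
    holderBound (fun _ => 1) q (closedBall c r) = volume (closedBall c r) := by
  rw [holderBound]
  simp only [ENNReal.coe_one, ENNReal.one_rpow, lintegral_const, one_mul,
    Measure.restrict_apply_univ]
  rw [← ENNReal.rpow_add _ _ (volume_closedBall_pos c hr) (volume_closedBall_ne_top c r),
    sub_add_cancel, ENNReal.rpow_one]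

theorem locallyIntegrable_gradProj {F : (Fin d → ℝ) → Fin d → ℝ} (hF : MemLp F 2 volume) :
    LocallyIntegrable (gradProj F) volume :=
  (memLp_gradProj hF).locallyIntegrable (by norm_num)

theorem indicator_eq_self_of_eq_zero {ξ : (Fin d → ℝ) → Fin d → ℝ} {S : Set (Fin d → ℝ)}
    (h : ∀ x, x ∉ S → ξ x = 0) : S.indicator ξ = ξ := by
  rw [indicator_eq_self]
  intro x hx
  by_contra hcon
  exact hx (h x hcon)

theorem exists_lintegral_gradProj_rpow_le (d : ℕ) {p : ℝ} (hp : 1 < p) : ∃ C : ℝ≥0,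
    ∀ {ξ : (Fin d → ℝ) → Fin d → ℝ}, Measurable ξ → (∀ x, ‖ξ x‖ ≤ 1) → ∀ (c : Fin d → ℝ) (r : ℝ),
    0 < r → (∀ x, x ∉ closedBall c r → ξ x = 0) →
    ∫⁻ x in closedBall c r, ‖gradProj ξ x‖ₑ ^ p ≤ C * volume (closedBall c r) := by
  obtain ⟨K, hK0, hK⟩ := exists_integral_norm_gradProj_sub_le d
  have hq1 : 1 < (1 + p) / 2 := by linarith
  obtain ⟨C, hC⟩ := exists_lintegral_enorm_sub_cubeAvg_le d hq1
    (show (1 + p) / 2 < p by linarith) (2 * K.toNNReal)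
  refine ⟨2 ^ (p - 1) * (C + (1 + d) ^ p), fun {ξ} hξ hξ1 c r hr hsupp => ?_⟩
  have hind := indicator_eq_self_of_eq_zero hsupp
  have hξ2 : MemLp ξ 2 volume := hind ▸ memLp_indicator_of_norm_le_one hξ hξ1 c r 2
  have hfint : ∀ c' r', IntegrableOn (gradProj ξ) (closedBall c' r') := fun c' r' =>
    (locallyIntegrable_gradProj hξ2).integrableOn_isCompact (isCompact_closedBall c' r')
  have h1 : ∫⁻ x in closedBall c r, ‖gradProj ξ x - cubeAvg (gradProj ξ) c r‖ₑ ^ p ≤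
      C * volume (closedBall c r) := by
    refine (hC (gradProj ξ) (fun _ => 1) measurable_const c r hr (hfint c r)
      fun c' r' hr' hsub => ?_).trans (by simp)
    rw [mul_assoc]
    change _ ≤ _ * holderBound (fun _ => 1) _ _
    have hr'r : r' ≤ r ∨ d = 0 := by
      rcases Nat.eq_zero_or_pos d with h | h
      · exact Or.inr h
      · left
        have hv := measure_mono (μ := volume) hsub
        rw [volume_closedBall _ hr'.le, volume_closedBall _ hr.le,
          ENNReal.ofReal_le_ofReal_iff (by positivity)] at hv
        have := (pow_le_pow_iff_left₀ (by positivity) (by positivity) h.ne').1 hv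
        linarith
    rw [holderBound_one _ _ hr']
    rcases hr'r with hr'r | rfl
    · obtain ⟨y, hy⟩ := hK hξ hξ1 c r hr hsupp c' r' hr' hr'r
      refine (lintegral_enorm_sub_cubeAvg_le hr' (hfint c' r') y).trans ?_
      have hi : IntegrableOn (fun x => gradProj ξ x - y) (closedBall c' r') :=
        (hfint c' r').sub (integrableOn_const measure_closedBall_lt_top.ne)
      rw [← ofReal_integral_norm_eq_lintegral_enorm hi]
      rw [volume_closedBall _ hr'.le]
      push_cast
      rw [mul_assoc]
      gcongr
      refine (ENNReal.ofReal_le_ofReal hy).trans ?_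
      rw [ENNReal.ofReal_mul hK0]
      rfl
    · have h0 : ∀ v : Fin 0 → ℝ, ‖v‖ₑ = 0 := fun v => by
        rw [Subsingleton.elim v 0, enorm_zero]
      simp only [h0, lintegral_const, zero_mul, zero_le]
  have h2 : ‖cubeAvg (gradProj ξ) c r‖ₑ ≤ 1 + d := by
    have h3 := enorm_cubeAvg_sub_mul_le hr (hfint c r) 0
    simp only [sub_zero] at h3
    rw [← ofReal_integral_norm_eq_lintegral_enorm (hfint c r)] at h3
    have h4 := integral_norm_gradProj_le hξ2 (c := c) (c' := c) hr.le
      (by simpa only [hind] using sum_mul_self_indicator_le hξ1 (closedBall c r))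
    have h5 := h3.trans (ENNReal.ofReal_le_ofReal h4)
    rw [ENNReal.ofReal_mul (by positivity), ← volume_closedBall c hr.le,
      ENNReal.mul_le_mul_iff_left (volume_closedBall_pos c hr) (volume_closedBall_ne_top c r)] at h5
    refine h5.trans_eq ?_
    rw [ENNReal.ofReal_add (by norm_num) (by positivity)]
    simp
  calc ∫⁻ x in closedBall c r, ‖gradProj ξ x‖ₑ ^ p
      ≤ ∫⁻ x in closedBall c r, 2 ^ (p - 1) * (‖gradProj ξ x - cubeAvg (gradProj ξ) c r‖ₑ ^ p +
          (1 + d) ^ p) := lintegral_mono fun x => by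
        calc ‖gradProj ξ x‖ₑ ^ p = ‖(gradProj ξ x - cubeAvg (gradProj ξ) c r) +
              cubeAvg (gradProj ξ) c r‖ₑ ^ p := by rw [sub_add_cancel]
          _ ≤ (‖gradProj ξ x - cubeAvg (gradProj ξ) c r‖ₑ + ‖cubeAvg (gradProj ξ) c r‖ₑ) ^ p := by
              gcongr
              exact enorm_add_le _ _
          _ ≤ 2 ^ (p - 1) * (‖gradProj ξ x - cubeAvg (gradProj ξ) c r‖ₑ ^ p +
              ‖cubeAvg (gradProj ξ) c r‖ₑ ^ p) := ENNReal.rpow_add_le_mul_rpow_add_rpow _ _ hp.le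
          _ ≤ _ := by gcongr
    _ = 2 ^ (p - 1) * ((∫⁻ x in closedBall c r,
          ‖gradProj ξ x - cubeAvg (gradProj ξ) c r‖ₑ ^ p) + (1 + d) ^ p * volume (closedBall c r))
              := by
        rw [lintegral_const_mul' _ _ (by simp), lintegral_add_right _ measurable_const,
          setLIntegral_const]
    _ ≤ 2 ^ (p - 1) * (C * volume (closedBall c r) + (1 + d) ^ p * volume (closedBall c r)) := by
        gcongr
    _ = _ := by
        have : 0 ≤ p - 1 := by linarith
        push_cast [ENNReal.coe_rpow_of_nonneg _ this, ENNReal.coe_rpow_of_nonneg _ (show 0 ≤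
            p by linarith)]
        ring

/-- `L^q`-estimate for the projection onto gradients, obtained by duality. -/
theorem exists_lintegral_gradProj_le (d : ℕ) {q : ℝ} (hq : 1 < q) : ∃ C : ℝ≥0,
    ∀ {F : (Fin d → ℝ) → Fin d → ℝ} (c : Fin d → ℝ) (r : ℝ), 0 < r → MemLp F 2 volume →
    (∀ x, x ∉ closedBall c r → F x = 0) →
    ∫⁻ x in closedBall c r, ‖gradProj F x‖ₑ ≤
      C * (volume (closedBall c r) ^ (1 - 1 / q) *
        (∫⁻ x in closedBall c r, ‖F x‖ₑ ^ q) ^ (1 / q)) := by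
  have hpq : q.HolderConjugate (1 - 1 / q)⁻¹ := by
    rw [Real.holderConjugate_iff]
    refine ⟨hq, ?_⟩
    rw [inv_inv]; field_simp; ring
  obtain ⟨C, hC⟩ := exists_lintegral_gradProj_rpow_le d hpq.symm.lt
  refine ⟨d * C ^ (1 - 1 / q), fun {F} c r hr hF hsupp => ?_⟩
  have hP := memLp_gradProj hF
  set D := closedBall c r with hD
  obtain ⟨P, hPm, hPP⟩ := hP.1
  set ξ : (Fin d → ℝ) → Fin d → ℝ := D.indicator fun x i => SignType.sign (P x i) with hξ
  have hsign : Measurable fun t : ℝ => ((SignType.sign t : SignType) : ℝ) := by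
    have : (fun t : ℝ => ((SignType.sign t : SignType) : ℝ)) =
        fun t => if 0 < t then 1 else if t < 0 then -1 else 0 := by
      ext t
      rw [sign_apply]
      split_ifs <;> simp
    rw [this]
    exact Measurable.ite measurableSet_Ioi measurable_const
      (Measurable.ite measurableSet_Iio measurable_const measurable_const)
  have hξm : Measurable ξ := by
    refine Measurable.indicator (measurable_pi_iff.2 fun i => ?_) measurableSet_closedBall
    exact hsign.comp ((measurable_pi_apply i).comp hPm.measurable)
  have hξ1 : ∀ x, ‖ξ x‖ ≤ 1 := fun x => by
    rw [hξ]
    by_cases hx : x ∈ D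
    · rw [indicator_of_mem hx, pi_norm_le_iff_of_nonneg zero_le_one]
      intro i
      rcases SignType.sign (P x i) with _ | _ | _ <;> simp
    · simp [indicator_of_notMem hx]
  have hξ0 : ∀ x, x ∉ D → ξ x = 0 := fun x hx => indicator_of_notMem hx _
  have hξ2 : MemLp ξ 2 volume :=
    indicator_eq_self_of_eq_zero hξ0 ▸ memLp_indicator_of_norm_le_one hξm hξ1 c r 2
  have hcomm := integral_gradProj_mul_comm hF hξ2
  have hPi : IntegrableOn (gradProj F) D :=
    (locallyIntegrable_gradProj hF).integrableOn_isCompact (isCompact_closedBall c r)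
  have hlow : ∫ x in D, ‖gradProj F x‖ ≤ ∫ x, ∑ i, gradProj F x i * ξ x i := by
    rw [← integral_indicator (measurableSet_closedBall : MeasurableSet D)]
    have hPn : IntegrableOn (fun x => ‖gradProj F x‖) D volume := hPi.norm
    refine integral_mono_ae (hPn.integrable_indicator measurableSet_closedBall)
      (integrable_finsetSum _ fun i _ =>
        integrable_mul_of_memLp (memLp_pi_iff.1 hP i) (memLp_pi_iff.1 hξ2 i)) ?_
    filter_upwards [hPP] with x hx
    by_cases hxD : x ∈ D
    · rw [indicator_of_mem hxD, hx]
      have : ∀ i, P x i * ξ x i = |P x i| := fun i => by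
        rw [hξ, indicator_of_mem hxD, mul_comm, sign_mul_self]
      simp only [this]
      rw [pi_norm_le_iff_of_nonneg (Finset.sum_nonneg fun i _ => abs_nonneg _)]
      intro i
      exact Finset.single_le_sum (f := fun i => |P x i|) (fun i _ => abs_nonneg _)
          (Finset.mem_univ i)
    · rw [indicator_of_notMem hxD]
      simp [hξ0 x hxD]
  have hup : ENNReal.ofReal (∫ x, ∑ i, F x i * gradProj ξ x i) ≤
      d * ∫⁻ x in D, ‖F x‖ₑ * ‖gradProj ξ x‖ₑ := by
    calc ENNReal.ofReal (∫ x, ∑ i, F x i * gradProj ξ x i)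
        ≤ ‖∫ x, ∑ i, F x i * gradProj ξ x i‖ₑ := by
          rw [← ofReal_norm]
          exact ENNReal.ofReal_le_ofReal (Real.le_norm_self _)
      _ ≤ ∫⁻ x, ‖∑ i, F x i * gradProj ξ x i‖ₑ := enorm_integral_le_lintegral_enorm _
      _ ≤ ∫⁻ x, D.indicator (fun x => d * (‖F x‖ₑ * ‖gradProj ξ x‖ₑ)) x :=
          lintegral_mono fun x => by
          by_cases hx : x ∈ D
          · rw [indicator_of_mem hx]
            refine (enorm_sum_le _ _).trans ?_
            calc ∑ i, ‖F x i * gradProj ξ x i‖ₑ ≤ ∑ _i : Fin d, ‖F x‖ₑ * ‖gradProj ξ x‖ₑ :=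
                  Finset.sum_le_sum fun i _ => by
                    rw [enorm_mul]
                    gcongr
                    · exact enorm_le_iff_norm_le.2 (norm_le_pi_norm _ i)
                    · exact enorm_le_iff_norm_le.2 (norm_le_pi_norm _ i)
              _ = _ := by simp
          · simp [hsupp x hx]
      _ = _ := by
          rw [lintegral_indicator measurableSet_closedBall, lintegral_const_mul' _ _ (by simp)]
  calc ∫⁻ x in D, ‖gradProj F x‖ₑ = ENNReal.ofReal (∫ x in D, ‖gradProj F x‖) :=
        (ofReal_integral_norm_eq_lintegral_enorm hPi).symm
    _ ≤ ENNReal.ofReal (∫ x, ∑ i, F x i * gradProj ξ x i) :=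
        ENNReal.ofReal_le_ofReal (hlow.trans_eq hcomm)
    _ ≤ d * ∫⁻ x in D, ‖F x‖ₑ * ‖gradProj ξ x‖ₑ := hup
    _ ≤ d * ((∫⁻ x in D, ‖F x‖ₑ ^ q) ^ (1 / q) *
        (∫⁻ x in D, ‖gradProj ξ x‖ₑ ^ (1 - 1 / q)⁻¹) ^ (1 / (1 - 1 / q)⁻¹)) := by
        gcongr
        exact ENNReal.lintegral_mul_le_Lp_mul_Lq _ hpq hF.1.restrict.enorm
          (memLp_gradProj hξ2).1.restrict.enorm
    _ ≤ d * ((∫⁻ x in D, ‖F x‖ₑ ^ q) ^ (1 / q) * (C * volume D) ^ (1 - 1 / q)) := by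
        have := one_sub_one_div_nonneg hq
        rw [one_div (1 - 1 / q)⁻¹, inv_inv]
        gcongr
        exact hC hξm hξ1 c r hr hξ0
    _ = _ := by
        have := one_sub_one_div_nonneg hq
        rw [ENNReal.mul_rpow_of_nonneg _ _ this]
        push_cast [ENNReal.coe_rpow_of_nonneg _ this]
        ring

end Duality

section Truncation

variable {d : ℕ}

theorem setLIntegral_comp_add_left (f : (Fin d → ℝ) → ℝ≥0∞) (x : Fin d → ℝ) (ρ : ℝ) :
    ∫⁻ w in closedBall 0 ρ, f (x + w) = ∫⁻ z in closedBall x ρ, f z := by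
  rw [← lintegral_indicator measurableSet_closedBall,
      ← lintegral_indicator measurableSet_closedBall,
    ← lintegral_add_left_eq_self ((closedBall x ρ).indicator f) x]
  refine lintegral_congr fun w => ?_
  simp only [indicator, mem_closedBall, dist_self_add_left, dist_zero_right]

theorem setLIntegral_comp_add_smul {f : (Fin d → ℝ) → ℝ≥0∞} (hf : Measurable f) (x : Fin d → ℝ)
    (ρ : ℝ) {t : ℝ} (ht : 0 < t) :
    ∫⁻ w in closedBall 0 ρ, f (x + t • w) =
      ENNReal.ofReal (t ^ d)⁻¹ * ∫⁻ z in closedBall x (t * ρ), f z := by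
  rw [← setLIntegral_comp_add_left f x, ← lintegral_indicator measurableSet_closedBall,
    ← lintegral_indicator measurableSet_closedBall]
  have hm : Measurable ((closedBall (0 : Fin d → ℝ) (t * ρ)).indicator fun w => f (x + w)) :=
    (hf.comp (measurable_const_add x)).indicator measurableSet_closedBall
  have h := Measure.map_addHaar_smul (volume : Measure (Fin d → ℝ)) ht.ne'
  rw [Module.finrank_fin_fun, abs_of_nonneg (by positivity)] at h
  rw [← smul_eq_mul, ← lintegral_smul_measure, ← h, lintegral_map hm (measurable_const_smul t)]
  refine lintegral_congr fun w => ?_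
  simp only [indicator, mem_closedBall, dist_zero_right, norm_smul, Real.norm_of_nonneg ht.le,
    mul_le_mul_iff_right₀ ht]

theorem enorm_sub_le_lintegral_fderiv {E F : Type*} [NormedAddCommGroup E] [NormedSpace ℝ E]
    [NormedAddCommGroup F] [NormedSpace ℝ F] [CompleteSpace F] {u : E → F} {x w : E}
    (hu : ∀ t ∈ Icc (0 : ℝ) 1, DifferentiableAt ℝ u (x + t • w))
    (hc : ContinuousOn (fun t : ℝ => fderiv ℝ u (x + t • w)) (Icc 0 1)) :
    ‖u (x + w) - u x‖ₑ ≤ ‖w‖ₑ * ∫⁻ t in Ioc (0 : ℝ) 1, ‖fderiv ℝ u (x + t • w)‖ₑ := by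
  have hd : ∀ t ∈ uIcc (0 : ℝ) 1,
      HasDerivAt (fun t : ℝ => u (x + t • w)) (fderiv ℝ u (x + t • w) w) t := fun t ht => by
    rw [uIcc_of_le zero_le_one] at ht
    have h1 : HasDerivAt (fun t : ℝ => x + t • w) w t := by
      simpa using ((hasDerivAt_id t).smul_const w).const_add x
    exact (hu t ht).hasFDerivAt.comp_hasDerivAt t h1
  have hci : ContinuousOn (fun t : ℝ => fderiv ℝ u (x + t • w) w) (uIcc 0 1) := by
    rw [uIcc_of_le zero_le_one]
    exact hc.clm_apply continuousOn_const
  have h := intervalIntegral.integral_eq_sub_of_hasDerivAt hd hci.intervalIntegrable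
  simp only [one_smul, zero_smul, add_zero] at h
  rw [← h, intervalIntegral.integral_of_le zero_le_one]
  refine (enorm_integral_le_lintegral_enorm _).trans ?_
  rw [← lintegral_const_mul' _ _ enorm_ne_top]
  refine lintegral_mono fun t => ?_
  rw [mul_comm]
  exact ContinuousLinearMap.le_opENorm _ _

theorem lintegral_enorm_sub_center_le {u : (Fin d → ℝ) → Fin d → ℝ} {x : Fin d → ℝ} {ρ : ℝ}
    (hu : ∀ z ∈ closedBall x ρ, DifferentiableAt ℝ u z)
    (hc : ContinuousOn (fderiv ℝ u) (closedBall x ρ)) (hρ : 0 < ρ) {K : ℝ≥0∞}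
    (hK : ∀ r, 0 < r → r ≤ ρ →
      ∫⁻ z in closedBall x r, ‖fderiv ℝ u z‖ₑ ≤ K * volume (closedBall x r)) :
    ∫⁻ z in closedBall x ρ, ‖u z - u x‖ₑ ≤ ENNReal.ofReal ρ * (K * volume (closedBall x ρ)) := by
  have hm : Measurable fun z => ‖fderiv ℝ u z‖ₑ := (measurable_fderiv ℝ u).enorm
  rw [← setLIntegral_comp_add_left (fun z => ‖u z - u x‖ₑ) x]
  calc ∫⁻ w in closedBall 0 ρ, ‖u (x + w) - u x‖ₑ
      ≤ ∫⁻ w in closedBall 0 ρ, ENNReal.ofReal ρ *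
          ∫⁻ t in Ioc (0 : ℝ) 1, ‖fderiv ℝ u (x + t • w)‖ₑ := by
        refine setLIntegral_mono' measurableSet_closedBall fun w hw => ?_
        rw [mem_closedBall_zero_iff] at hw
        have hmem : ∀ t ∈ Icc (0 : ℝ) 1, x + t • w ∈ closedBall x ρ := fun t ht => by
          rw [mem_closedBall, dist_self_add_left, norm_smul, Real.norm_of_nonneg ht.1]
          nlinarith [norm_nonneg w, ht.1, ht.2]
        refine (enorm_sub_le_lintegral_fderiv (fun t ht => hu _ (hmem t ht))
          (hc.comp (by fun_prop) hmem)).trans ?_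
        gcongr
        rw [← ofReal_norm]
        exact ENNReal.ofReal_le_ofReal hw
    _ = ENNReal.ofReal ρ * ∫⁻ t in Ioc (0 : ℝ) 1, ∫⁻ w in closedBall 0 ρ,
          ‖fderiv ℝ u (x + t • w)‖ₑ := by
        rw [lintegral_const_mul' _ _ ENNReal.ofReal_ne_top, lintegral_lintegral_swap]
        refine Measurable.aemeasurable ?_
        exact hm.comp (by fun_prop)
    _ ≤ ENNReal.ofReal ρ * ∫⁻ _t in Ioc (0 : ℝ) 1, K * volume (closedBall x ρ) := by
        refine mul_le_mul_right ?_ _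
        refine setLIntegral_mono' (measurableSet_Ioc (a := (0 : ℝ)) (b := 1)) fun t ht => ?_
        rw [setLIntegral_comp_add_smul hm x ρ ht.1]
        have h1 := hK (t * ρ) (mul_pos ht.1 hρ) (by nlinarith [ht.1, ht.2])
        rw [volume_closedBall_mul x x hρ.le ht.1.le] at h1
        refine (mul_le_mul_right h1 _).trans_eq ?_
        have h2 : ENNReal.ofReal (t ^ d)⁻¹ * ENNReal.ofReal (t ^ d) = 1 := by
          have : 0 < t ^ d := pow_pos ht.1 d
          rw [← ENNReal.ofReal_mul (by positivity), inv_mul_cancel₀ this.ne', ENNReal.ofReal_one]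
        rw [mul_left_comm K, ← mul_assoc, h2, one_mul]
    _ = _ := by simp

theorem measure_le_of_forall_exists_closedBall {S T : Set (Fin d → ℝ)} {G : (Fin d → ℝ) → ℝ≥0∞}
    {R : ℝ} (h : ∀ x ∈ S, ∃ ρ, 0 < ρ ∧ ρ ≤ R ∧ closedBall x ρ ⊆ T ∧
      volume (closedBall x ρ) ≤ ∫⁻ z in closedBall x ρ, G z) :
    volume S ≤ 4 ^ d * ∫⁻ z in T, G z := by
  choose! ρ hρ hρR hρT hρG using h
  obtain ⟨s, hsS, hdisj, hcov⟩ := Vitali.exists_disjoint_subfamily_covering_enlargement_closedBall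
    S id ρ R hρR 4 (by norm_num)
  simp only [id] at hdisj hcov
  have hs : s.Countable := hdisj.countable_of_nonempty_interior fun x hx =>
    ⟨x, ball_subset_interior_closedBall (mem_ball_self (hρ x (hsS hx)))⟩
  have hSs : S ⊆ ⋃ x ∈ s, closedBall x (4 * ρ x) := fun x hx => by
    obtain ⟨y, hy, hxy⟩ := hcov x hx
    exact mem_biUnion hy (hxy (mem_closedBall_self (hρ x hx).le))
  calc volume S ≤ volume (⋃ x ∈ s, closedBall x (4 * ρ x)) := measure_mono hSs
    _ ≤ ∑' x : s, volume (closedBall (x : Fin d → ℝ) (4 * ρ x)) := measure_biUnion_le _ hs _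
    _ ≤ ∑' x : s, 4 ^ d * ∫⁻ z in closedBall (x : Fin d → ℝ) (ρ x), G z := by
        refine ENNReal.tsum_le_tsum fun x => ?_
        rw [volume_closedBall_mul (x : Fin d → ℝ) x (hρ x (hsS x.2)).le (by norm_num),
          ENNReal.ofReal_pow (by norm_num), ENNReal.ofReal_ofNat]
        gcongr
        exact hρG x (hsS x.2)
    _ = 4 ^ d * ∫⁻ z in ⋃ x ∈ s, closedBall x (ρ x), G z := by
        rw [ENNReal.tsum_mul_left, lintegral_biUnion hs (fun _ _ => measurableSet_closedBall) hdisj]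
    _ ≤ _ := by
        refine mul_le_mul_right ?_ _
        exact lintegral_mono_set (iUnion₂_subset fun x hx => hρT x (hsS hx))

theorem norm_sub_le_of_lintegral_enorm_sub_le {u : (Fin d → ℝ) → Fin d → ℝ} {x y : Fin d → ℝ}
    {K : ℝ≥0} (hum : AEStronglyMeasurable u (volume.restrict (closedBall x (dist x y))))
    (hx : ∫⁻ z in closedBall x (dist x y), ‖u z - u x‖ₑ ≤
      ENNReal.ofReal (dist x y) * (K * volume (closedBall x (dist x y))))
    (hy : ∫⁻ z in closedBall y (dist x y), ‖u z - u y‖ₑ ≤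
      ENNReal.ofReal (dist x y) * (K * volume (closedBall y (dist x y)))) :
    dist (u x) (u y) ≤ 2 ^ d * 2 * K * dist x y := by
  rcases eq_or_ne x y with rfl | hxy
  · simp
  set ρ := dist x y with hρ
  have hρ0 : 0 < ρ := dist_pos.2 hxy
  set m := midpoint ℝ x y with hm
  have hmx : dist m x = ρ / 2 := by rw [hm, dist_midpoint_left]; norm_num; ring
  have hmy : dist m y = ρ / 2 := by rw [hm, dist_midpoint_right]; norm_num; ring
  have hsx : closedBall m (ρ / 2) ⊆ closedBall x ρ := closedBall_subset_closedBall' (by linarith)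
  have hsy : closedBall m (ρ / 2) ⊆ closedBall y ρ := closedBall_subset_closedBall' (by linarith)
  have hv : ∀ c, volume (closedBall c ρ) = 2 ^ d * volume (closedBall m (ρ / 2)) := fun c =>
    volume_eq_child c m hρ0
  have h1 := enorm_sub_mul_measure_le (hum.mono_measure (Measure.restrict_mono hsx le_rfl)) (u x)
      (u y)
  rw [Measure.restrict_apply_univ] at h1
  have h2 : ‖u x - u y‖ₑ * volume (closedBall m (ρ / 2)) ≤
      (2 ^ d * 2 * K * ENNReal.ofReal ρ) * volume (closedBall m (ρ / 2)) :=
    calc _ ≤ _ := h1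
      _ ≤ (∫⁻ z in closedBall x ρ, ‖u z - u x‖ₑ) + ∫⁻ z in closedBall y ρ, ‖u z - u y‖ₑ :=
        add_le_add (lintegral_mono_set hsx) (lintegral_mono_set hsy)
      _ ≤ _ := add_le_add hx hy
      _ = _ := by rw [hv x, hv y]; ring
  rw [ENNReal.mul_le_mul_iff_left (volume_closedBall_pos m (by positivity))
    (volume_closedBall_ne_top m _)] at h2
  rw [dist_eq_norm]
  have h3 : ‖u x - u y‖ₑ ≤ ENNReal.ofReal (2 ^ d * 2 * K * ρ) := by
    refine h2.trans_eq ?_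
    rw [ENNReal.ofReal_mul (by positivity), ENNReal.ofReal_mul (by positivity),
      ENNReal.ofReal_mul (by positivity), ENNReal.ofReal_pow (by norm_num)]
    simp
  rw [← ofReal_norm, ENNReal.ofReal_le_ofReal_iff (by positivity)] at h3
  exact h3

theorem ae_fderiv_eq_of_eqOn {u v : (Fin d → ℝ) → Fin d → ℝ} {s : Set (Fin d → ℝ)}
    (hs : MeasurableSet s) (hu : ∀ x ∈ s, DifferentiableAt ℝ u x)
    (hv : ∀ᵐ x, DifferentiableAt ℝ v x) (huv : EqOn u v s) :
    ∀ᵐ x, x ∈ s → fderiv ℝ v x = fderiv ℝ u x := by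
  set t := toMeasurable volume {x | ¬ DifferentiableAt ℝ v x} with ht
  have ht0 : volume t = 0 := by rw [ht, measure_toMeasurable]; exact hv
  have hvt : ∀ x, x ∉ t → DifferentiableAt ℝ v x := fun x hx => by
    by_contra hcon
    exact hx (subset_toMeasurable _ _ hcon)
  have hst : MeasurableSet (s \ t) := hs.diff (measurableSet_toMeasurable _ _)
  have happ : ApproximatesLinearOn (fun x => u x - v x) (0 : (Fin d → ℝ) →L[ℝ] (Fin d → ℝ))
      (s \ t) 0 :=
    fun x hx y hy => by
      simp [huv hx.1, huv hy.1]
  have h := happ.norm_fderiv_sub_le volume hst (fun x => fderiv ℝ u x - fderiv ℝ v x)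
    fun x hx => ((hu x hx.1).hasFDerivAt.sub (hvt x hx.2).hasFDerivAt).hasFDerivWithinAt
  filter_upwards [ae_imp_of_ae_restrict h, measure_eq_zero_iff_ae_notMem.1 ht0] with x hx hxt hxs
  have := hx ⟨hxs, hxt⟩
  rw [sub_zero, nonpos_iff_eq_zero, nnnorm_eq_zero, sub_eq_zero] at this
  exact this.symm

/-- Lipschitz truncation of a continuously differentiable map. -/
theorem exists_lipschitz_truncation {q : ℝ} (hq : 1 < q) {u : (Fin d → ℝ) → Fin d → ℝ}
    {U : Set (Fin d → ℝ)} (hU : IsOpen U) (hsub : closedBall 0 1 ⊆ U) (hu : ContDiffOn ℝ 1 u U)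
    {g : (Fin d → ℝ) → ℝ≥0} (hg : Measurable g)
    (hug : ∀ x ∈ closedBall 0 1, ‖fderiv ℝ u x‖ ≤ d * (g x + 1)) :
    ∃ v : (Fin d → ℝ) → Fin d → ℝ, LipschitzWith (2 ^ d * 2 * (d * 2)) v ∧
      ∃ N : Set (Fin d → ℝ), MeasurableSet N ∧
        volume N ≤ 4 ^ d * ∫⁻ x in closedBall 0 1, (g x : ℝ≥0∞) ^ q ∧
        ∀ᵐ x, x ∈ closedBall 0 (1 / 4) → x ∉ N → fderiv ℝ v x = fderiv ℝ u x := by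
  set B : Set (Fin d → ℝ) := {x | x ∈ closedBall 0 (1 / 4) ∧ ∃ ρ, 0 < ρ ∧ ρ ≤ 1 / 2 ∧
    volume (closedBall x ρ) ≤ ∫⁻ z in closedBall x ρ, (g z : ℝ≥0∞) ^ q} with hB
  have hball : ∀ x ∈ closedBall (0 : Fin d → ℝ) (1 / 4), ∀ ρ ≤ (1 / 2 : ℝ),
      closedBall x ρ ⊆ closedBall 0 1 := fun x hx ρ hρ =>
    closedBall_subset_closedBall' (by linarith [mem_closedBall.1 hx])
  have hBvol : volume B ≤ 4 ^ d * ∫⁻ x in closedBall 0 1, (g x : ℝ≥0∞) ^ q :=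
    measure_le_of_forall_exists_closedBall fun x hx => by
      obtain ⟨hx1, ρ, h1, h2, h3⟩ := hx
      exact ⟨ρ, h1, h2, hball x hx1 ρ h2, h3⟩
  have hdiff : ∀ x ∈ closedBall 0 1, DifferentiableAt ℝ u x := fun x hx =>
    (hu.differentiableOn one_ne_zero).differentiableAt (hU.mem_nhds (hsub hx))
  have hcont : ContinuousOn (fderiv ℝ u) (closedBall 0 1) :=
    (hu.continuousOn_fderiv_of_isOpen hU le_rfl).mono hsub
  have hgood : ∀ x ∈ closedBall (0 : Fin d → ℝ) (1 / 4) \ B, ∀ ρ, 0 < ρ → ρ ≤ 1 / 2 →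
      ∫⁻ z in closedBall x ρ, ‖fderiv ℝ u z‖ₑ ≤ (d * 2 : ℝ≥0) * volume (closedBall x ρ) := by
    intro x hx ρ hρ hρ2
    have hlt : ∫⁻ z in closedBall x ρ, (g z : ℝ≥0∞) ^ q ≤ volume (closedBall x ρ) := by
      by_contra hcon
      exact hx.2 ⟨hx.1, ρ, hρ, hρ2, (not_le.1 hcon).le⟩
    have hgle : ∫⁻ z in closedBall x ρ, (g z : ℝ≥0∞) ≤ volume (closedBall x ρ) := by
      refine (lintegral_le_holderBound hg hq _).trans ?_
      calc holderBound g q (closedBall x ρ) ≤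
            volume (closedBall x ρ) ^ (1 - 1 / q) * volume (closedBall x ρ) ^ (1 / q) := by
            rw [holderBound]
            gcongr
        _ = _ := by
            rw [← ENNReal.rpow_add _ _ (volume_closedBall_pos x hρ) (volume_closedBall_ne_top x ρ),
              sub_add_cancel, ENNReal.rpow_one]
    calc ∫⁻ z in closedBall x ρ, ‖fderiv ℝ u z‖ₑ ≤ ∫⁻ z in closedBall x ρ,
        d * ((g z : ℝ≥0∞) + 1) := by
          refine setLIntegral_mono' measurableSet_closedBall fun z hz => ?_
          have := ENNReal.ofReal_le_ofReal (hug z (hball x hx.1 ρ hρ2 hz))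
          rw [ofReal_norm, ENNReal.ofReal_mul (by positivity), ENNReal.ofReal_add (by positivity)
            (by positivity)] at this
          simpa using this
      _ = d * ((∫⁻ z in closedBall x ρ, (g z : ℝ≥0∞)) + volume (closedBall x ρ)) := by
          rw [lintegral_const_mul' _ _ (by simp), lintegral_add_right _ measurable_const,
            setLIntegral_const, one_mul]
      _ ≤ d * (volume (closedBall x ρ) + volume (closedBall x ρ)) := by gcongr
      _ = _ := by push_cast; ring
  have hlip : LipschitzOnWith (2 ^ d * 2 * (d * 2)) u (closedBall (0 : Fin d → ℝ) (1 / 4) \ B) := by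
    refine LipschitzOnWith.of_dist_le_mul fun x hx y hy => ?_
    rcases eq_or_ne x y with rfl | hxy
    · simp
    have hρ0 : 0 < dist x y := dist_pos.2 hxy
    have hρ : dist x y ≤ 1 / 2 := by
      linarith [dist_triangle_right x y 0, mem_closedBall.1 hx.1, mem_closedBall.1 hy.1]
    have key : ∀ x ∈ closedBall (0 : Fin d → ℝ) (1 / 4) \ B, ∀ ρ, 0 < ρ → ρ ≤ 1 / 2 →
        ∫⁻ z in closedBall x ρ, ‖u z - u x‖ₑ ≤
          ENNReal.ofReal ρ * ((d * 2 : ℝ≥0) * volume (closedBall x ρ)) := fun x hx ρ hρ hρ2 =>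
      lintegral_enorm_sub_center_le (fun z hz => hdiff z (hball x hx.1 ρ hρ2 hz))
        (hcont.mono (hball x hx.1 ρ hρ2)) hρ fun r hr hrρ => hgood x hx r hr (hrρ.trans hρ2)
    refine (norm_sub_le_of_lintegral_enorm_sub_le (K := d * 2) ?_ (key x hx _ hρ0 hρ)
      (key y hy _ hρ0 hρ)).trans_eq (by push_cast; ring)
    exact (hu.continuousOn.mono ((hball x hx.1 _ hρ).trans hsub)).aestronglyMeasurable
      measurableSet_closedBall
  obtain ⟨v, hv, huv⟩ := hlip.extend_pi
  refine ⟨v, hv, toMeasurable volume B, measurableSet_toMeasurable _ _,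
    (measure_toMeasurable B).trans_le hBvol, ?_⟩
  have hms : MeasurableSet (closedBall (0 : Fin d → ℝ) (1 / 4) \ toMeasurable volume B) :=
    measurableSet_closedBall.diff (measurableSet_toMeasurable _ _)
  filter_upwards [ae_fderiv_eq_of_eqOn hms
    (fun x hx => hdiff x (closedBall_subset_closedBall (by norm_num) hx.1)) hv.ae_differentiableAt
    (huv.mono (sdiff_subset_sdiff_right (subset_toMeasurable _ _)))] with x hx hx1 hx2
  exact hx ⟨hx1, hx2⟩

end Truncation

section Piola

variable {d : ℕ}

theorem det_add_updateRow_zero (A : Matrix (Fin d) (Fin d) ℝ) (i : Fin d) (b : Fin d → ℝ) :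
    (A + updateRow 0 i b).det = A.det + ∑ j, A.adjugate j i * b j := by
  have h1 : A + updateRow 0 i b = A.updateRow i (A i + b) := by
    ext k j
    by_cases hk : k = i
    · subst hk; simp
    · simp [updateRow_ne hk]
  have h2 : (A.updateRow i b).det = ∑ j, A.adjugate j i * b j := by
    rw [det_eq_sum_mul_adjugate_row _ i]
    refine Finset.sum_congr rfl fun j _ => ?_
    rw [adjugate_apply, adjugate_apply, updateRow_idem, updateRow_self, mul_comm]
  rw [h1, det_updateRow_add, updateRow_eq_self, h2]

theorem sum_choose_mul_det_eq_zero (A : Matrix (Fin d) (Fin d) ℝ) (M : ℝ) :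
    ∑ k ∈ Finset.range (d + 2), ((-1 : ℝ) ^ (d + 1 - k) * (d + 1).choose k) *
      ((k * M) • (1 : Matrix (Fin d) (Fin d) ℝ) + A).det = 0 := by
  set P : Polynomial ℝ := ((Polynomial.X : Polynomial ℝ) •
    (M • (1 : Matrix (Fin d) (Fin d) ℝ)).map (Polynomial.C : ℝ →+* Polynomial ℝ) +
    A.map (Polynomial.C : ℝ →+* Polynomial ℝ)).det with hP
  have hdeg : P.natDegree < d + 1 :=
    Nat.lt_succ_of_le ((Polynomial.natDegree_det_X_add_C_le (M • (1 : Matrix (Fin d) (Fin d) ℝ))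
      A).trans_eq (Fintype.card_fin d))
  have heval : ∀ t : ℝ, P.eval t = ((t * M) • (1 : Matrix (Fin d) (Fin d) ℝ) + A).det := fun t => by
    rw [hP, ← Polynomial.coe_evalRingHom, RingHom.map_det]
    congr 1
    ext i j
    simp only [RingHom.mapMatrix_apply, map_apply, Matrix.add_apply, Matrix.smul_apply, smul_eq_mul,
      Polynomial.coe_evalRingHom, Polynomial.eval_add, Polynomial.eval_mul, Polynomial.eval_X,
      Polynomial.eval_C, mul_assoc]
  have h := congrFun (Polynomial.fwdDiff_iter_eq_zero_of_degree_lt hdeg) 0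
  rw [fwdDiff_iter_eq_sum_shift] at h
  simp only [zero_add, nsmul_eq_mul, mul_one, heval, zsmul_eq_mul, Pi.zero_apply] at h
  rw [← h]
  refine Finset.sum_congr rfl fun k _ => ?_
  push_cast
  ring

theorem jac_eq_toMatrix' (v : (Fin d → ℝ) → Fin d → ℝ) (x : Fin d → ℝ) :
    jac v x = LinearMap.toMatrix' (fderiv ℝ v x : (Fin d → ℝ) →ₗ[ℝ] (Fin d → ℝ)) := by
  ext i j
  simp [jac, LinearMap.toMatrix'_apply]

theorem det_smul_id_add_fderiv (v : (Fin d → ℝ) → Fin d → ℝ) (x : Fin d → ℝ) (μ : ℝ) :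
    (μ • ContinuousLinearMap.id ℝ (Fin d → ℝ) + fderiv ℝ v x).det = (μ • 1 + jac v x).det := by
  rw [ContinuousLinearMap.det, ← LinearMap.det_toMatrix', jac_eq_toMatrix']
  congr 1
  ext i j
  simp [LinearMap.toMatrix'_apply, Matrix.one_apply, Pi.single_apply]

theorem det_smul_one_add_jac_pos {v : (Fin d → ℝ) → Fin d → ℝ} {L : ℝ≥0} (hv : LipschitzWith L v)
    {μ : ℝ} (hμ : L < μ) (x : Fin d → ℝ) : 0 < (μ • 1 + jac v x).det := by
  have hμ0 : 0 < μ := L.2.trans_lt hμ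
  have hne : ∀ t ∈ Icc (0 : ℝ) 1, (μ • (1 : Matrix (Fin d) (Fin d) ℝ) + t • jac v x).det ≠ 0 := by
    intro t ht h0
    obtain ⟨w, hw0, hw⟩ := exists_mulVec_eq_zero_iff.2 h0
    have h1 : jac v x *ᵥ w = fderiv ℝ v x w := by
      rw [jac_eq_toMatrix', LinearMap.toMatrix'_mulVec]
      rfl
    rw [add_mulVec, smul_mulVec, smul_mulVec, one_mulVec, h1] at hw
    have h2 : ‖μ • w‖ = ‖t • fderiv ℝ v x w‖ := by
      rw [eq_neg_of_add_eq_zero_left hw, norm_neg]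
    have h3 : ‖fderiv ℝ v x w‖ ≤ L * ‖w‖ :=
      (ContinuousLinearMap.le_opNorm _ _).trans (by gcongr; exact norm_fderiv_le_of_lipschitz ℝ hv)
    rw [norm_smul, norm_smul, Real.norm_of_nonneg hμ0.le, Real.norm_of_nonneg ht.1] at h2
    have h4 : 0 < ‖w‖ := norm_pos_iff.2 hw0
    nlinarith [ht.1, ht.2, norm_nonneg (fderiv ℝ v x w)]
  by_contra hcon
  have hc : ContinuousOn (fun t : ℝ => (μ • (1 : Matrix (Fin d) (Fin d) ℝ) + t • jac v x).det)
      (Icc 0 1) := by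
    apply Continuous.continuousOn
    apply Continuous.matrix_det
    fun_prop
  have h01 : (0 : ℝ) ∈ Icc ((fun t : ℝ => (μ • (1 : Matrix (Fin d) (Fin d) ℝ) + t • jac v x).det) 1)
      ((fun t : ℝ => (μ • (1 : Matrix (Fin d) (Fin d) ℝ) + t • jac v x).det) 0) := by
    refine ⟨by simpa using hcon, ?_⟩
    simp only [zero_smul, add_zero, det_smul, det_one]
    positivity
  obtain ⟨t, ht, ht0⟩ := intermediate_value_Icc' zero_le_one hc h01
  exact hne t ht ht0

theorem bijective_smul_add {v : (Fin d → ℝ) → Fin d → ℝ} {L : ℝ≥0} (hv : LipschitzWith L v)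
    {μ : ℝ} (hμ : L < μ) : Function.Bijective fun x => μ • x + v x := by
  have hμ0 : 0 < μ := L.2.trans_lt hμ
  rw [Function.bijective_iff_existsUnique]
  intro y
  have hcon : ContractingWith (L / μ.toNNReal) fun x => μ⁻¹ • (y - v x) := by
    constructor
    · rw [div_lt_one (by simpa using hμ0)]
      exact NNReal.coe_lt_coe.1 (by rwa [Real.coe_toNNReal _ hμ0.le])
    · refine LipschitzWith.of_dist_le_mul fun a b => ?_
      rw [dist_smul₀, dist_sub_left, NNReal.coe_div, Real.coe_toNNReal _ hμ0.le,
        Real.norm_of_nonneg (inv_nonneg.2 hμ0.le), div_eq_inv_mul, mul_assoc]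
      gcongr
      exact hv.dist_le_mul a b
  have hiff : ∀ x, μ • x + v x = y ↔ Function.IsFixedPt (fun x => μ⁻¹ • (y - v x)) x := fun x => by
    rw [Function.IsFixedPt, inv_smul_eq_iff₀ hμ0.ne', sub_eq_iff_eq_add, eq_comm]
  refine ⟨hcon.fixedPoint, (hiff _).2 hcon.fixedPoint_isFixedPt, fun x hx => ?_⟩
  exact hcon.fixedPoint_unique ((hiff x).1 hx)

theorem volume_image_eq_zero_of_lipschitzWith {w : (Fin d → ℝ) → Fin d → ℝ} {L : ℝ≥0}
    (hw : LipschitzWith L w) {s : Set (Fin d → ℝ)} (hs : volume s = 0) : volume (w '' s) = 0 := by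
  have h := hw.hausdorffMeasure_image_le (d := (Fintype.card (Fin d) : ℝ)) (by positivity) s
  rw [hausdorffMeasure_pi_real, hs, mul_zero] at h
  exact le_antisymm h zero_le

theorem setLIntegral_det_smul_one_add_jac {v : (Fin d → ℝ) → Fin d → ℝ} {L : ℝ≥0}
    (hv : LipschitzWith L v) {μ : ℝ} (hμ : L < μ) {K : Set (Fin d → ℝ)} (hK : MeasurableSet K) :
    ∫⁻ x in K, ENNReal.ofReal (μ • 1 + jac v x).det = volume ((fun x => μ • x + v x) '' K) := by
  set t := toMeasurable volume {x | ¬ DifferentiableAt ℝ v x} with ht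
  have ht0 : volume t = 0 := by rw [ht, measure_toMeasurable]; exact hv.ae_differentiableAt
  have hw : LipschitzWith (‖μ‖₊ + L) fun x => μ • x + v x := (lipschitzWith_smul μ).add hv
  have hae : (K \ t : Set _) =ᵐ[volume] K := sdiff_null_ae_eq_self ht0
  have himage : volume ((fun x => μ • x + v x) '' (K \ t)) = volume ((fun x =>
      μ • x + v x) '' K) := by
    refine le_antisymm (measure_mono (image_mono sdiff_subset)) ?_
    calc volume ((fun x => μ • x + v x) '' K)
        ≤ volume ((fun x => μ • x + v x) '' (K \ t) ∪ (fun x => μ • x + v x) '' t) := by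
          rw [← image_union]
          exact measure_mono (image_mono fun x hx => by
            by_cases h : x ∈ t
            · exact Or.inr h
            · exact Or.inl ⟨hx, h⟩)
      _ ≤ _ := (measure_union_le _ _).trans_eq (by
          rw [volume_image_eq_zero_of_lipschitzWith hw ht0, add_zero])
  rw [← himage, ← lintegral_abs_det_fderiv_eq_addHaar_image volume
    (hK.diff (measurableSet_toMeasurable _ _))
    (f' := fun x => μ • ContinuousLinearMap.id ℝ (Fin d → ℝ) + fderiv ℝ v x) (fun x hx => ?_)
    (bijective_smul_add hv hμ).injective.injOn, setLIntegral_congr hae]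
  · refine lintegral_congr fun x => ?_
    rw [det_smul_id_add_fderiv, abs_of_pos (det_smul_one_add_jac_pos hv hμ x)]
  · have hd : DifferentiableAt ℝ v x := by
      by_contra hcon
      exact hx.2 (subset_toMeasurable _ _ hcon)
    exact (((hasFDerivAt_id x).const_smul μ).add hd.hasFDerivAt).hasFDerivWithinAt

theorem measurable_det {α : Type*} [MeasurableSpace α] {A : α → Matrix (Fin d) (Fin d) ℝ}
    (hA : ∀ i j, Measurable fun x => A x i j) : Measurable fun x => (A x).det := by
  simp only [det_apply]
  refine Finset.measurable_sum _ fun σ _ => Measurable.const_smul ?_ _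
  exact Finset.measurable_prod _ fun i _ => hA _ _

theorem measurable_adjugate {α : Type*} [MeasurableSpace α] {A : α → Matrix (Fin d) (Fin d) ℝ}
    (hA : ∀ i j, Measurable fun x => A x i j) (i j : Fin d) :
    Measurable fun x => (A x).adjugate i j := by
  simp only [adjugate_apply]
  refine measurable_det fun k l => ?_
  by_cases hk : k = j
  · subst hk
    simp only [updateRow_self]
    exact measurable_const
  · simp only [updateRow_ne hk]
    exact hA k l

theorem abs_det_le {A : Matrix (Fin d) (Fin d) ℝ} {B : ℝ} (hA : ∀ i j, |A i j| ≤ B) :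
    |A.det| ≤ d.factorial * B ^ d := by
  have h := det_le (abv := AbsoluteValue.abs) (x := B) (A := A) hA
  rwa [Fintype.card_fin, nsmul_eq_mul] at h

theorem abs_adjugate_le {A : Matrix (Fin d) (Fin d) ℝ} {B : ℝ} (hB : 1 ≤ B)
    (hA : ∀ i j, |A i j| ≤ B) (i j : Fin d) : |A.adjugate i j| ≤ d.factorial * B ^ d := by
  rw [adjugate_apply]
  refine abs_det_le fun k l => ?_
  by_cases hk : k = j
  · subst hk
    rw [updateRow_self]
    by_cases hl : l = i
    · subst hl; simpa using hB
    · simpa [hl] using zero_le_one.trans hB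
  · rw [updateRow_ne hk]
    exact hA k l

theorem measurable_jac (v : (Fin d → ℝ) → Fin d → ℝ) (i j : Fin d) :
    Measurable fun x => jac v x i j := by
  have := (measurable_fderiv_apply_const ℝ v (Pi.single j 1))
  exact (measurable_pi_apply i).comp this

theorem abs_jac_le (v : (Fin d → ℝ) → Fin d → ℝ) (x : Fin d → ℝ) (i j : Fin d) :
    |jac v x i j| ≤ ‖fderiv ℝ v x‖ := by
  have h1 := (norm_le_pi_norm (fderiv ℝ v x (Pi.single j 1)) i).trans
    (ContinuousLinearMap.le_opNorm _ _)
  rw [Pi.norm_single, norm_one, mul_one] at h1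
  exact h1

theorem setIntegral_det_eq_of_eqOn_compl {v v' : (Fin d → ℝ) → Fin d → ℝ} {L : ℝ≥0}
    (hv : LipschitzWith L v) (hv' : LipschitzWith L v') {K : Set (Fin d → ℝ)} (hK : MeasurableSet K)
    (hvv' : ∀ x, x ∉ K → v x = v' x) {μ : ℝ} (hμ : L < μ) :
    ∫ x in K, (μ • 1 + jac v x).det = ∫ x in K, (μ • 1 + jac v' x).det := by
  have himage : (fun x => μ • x + v x) '' K = (fun x => μ • x + v' x) '' K := by
    have h : (fun x => μ • x + v x) '' Kᶜ = (fun x => μ • x + v' x) '' Kᶜ :=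
      image_congr fun x hx => by simp only [hvv' x hx]
    rwa [image_compl_eq (bijective_smul_add hv hμ), image_compl_eq (bijective_smul_add hv' hμ),
      compl_inj_iff] at h
  have hm : ∀ v : (Fin d → ℝ) → Fin d → ℝ, Measurable fun x => (μ • 1 + jac v x).det := fun v =>
    measurable_det fun i j => (measurable_jac v _ _).const_add _
  rw [integral_eq_lintegral_of_nonneg_ae
      (Eventually.of_forall fun x => (det_smul_one_add_jac_pos hv hμ x).le)
      (hm v).aestronglyMeasurable,
    integral_eq_lintegral_of_nonneg_ae
      (Eventually.of_forall fun x => (det_smul_one_add_jac_pos hv' hμ x).le)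
      (hm v').aestronglyMeasurable,
    setLIntegral_det_smul_one_add_jac hv hμ hK, setLIntegral_det_smul_one_add_jac hv' hμ hK, himage]

theorem jac_add_single {v : (Fin d → ℝ) → Fin d → ℝ} {φ : (Fin d → ℝ) → ℝ} {x : Fin d → ℝ}
    (hv : DifferentiableAt ℝ v x) (hφ : DifferentiableAt ℝ φ x) (i : Fin d) :
    jac (fun x => v x + Pi.single i (φ x)) x = jac v x + updateRow 0 i fun j => pd j φ x := by
  have h := hv.hasFDerivAt.add
    ((ContinuousLinearMap.single ℝ (fun _ : Fin d => ℝ) i).hasFDerivAt.comp x hφ.hasFDerivAt)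
  ext k j
  have h1 : fderiv ℝ (fun x => v x + Pi.single i (φ x)) x = _ := h.fderiv
  rw [jac, of_apply, h1]
  by_cases hk : k = i
  · subst hk
    simp [jac, pd]
  · simp [jac, pd, hk]

theorem isDivFreeOn_adjugate_jac {v : (Fin d → ℝ) → Fin d → ℝ} {L : ℝ≥0} (hv : LipschitzWith L v)
    (i : Fin d) (U : Set (Fin d → ℝ)) : IsDivFreeOn (fun x j => (jac v x).adjugate j i) U := by
  intro φ hφ hφc _
  have hKm : MeasurableSet (tsupport φ) := (isClosed_tsupport φ).measurableSet
  have hKf : volume (tsupport φ) ≠ ∞ := hφc.isCompact.measure_lt_top.ne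
  obtain ⟨D, hD⟩ := (hφ.of_le (m := 1) (by norm_cast)).lipschitzWith_of_hasCompactSupport
    hφc one_ne_zero
  set v' : (Fin d → ℝ) → Fin d → ℝ := fun x => v x + Pi.single i (φ x) with hv'def
  have hv' : LipschitzWith (L + D) v' := hv.add (LipschitzWith.of_dist_le_mul fun x y => by
    rw [dist_eq_norm, ← Pi.single_sub, Pi.norm_single, ← dist_eq_norm]
    exact hD.dist_le_mul x y)
  have hvv' : ∀ x, x ∉ tsupport φ → v' x = v x := fun x hx => by
    simp [hv'def, image_eq_zero_of_notMem_tsupport hx]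
  have hfint : ∀ {w : (Fin d → ℝ) → Fin d → ℝ} {B : ℝ≥0}, LipschitzWith B w → ∀ μ : ℝ,
      IntegrableOn (fun x => (μ • 1 + jac w x).det) (tsupport φ) := fun {w B} hw μ => by
    refine Measure.integrableOn_of_bounded (M := d.factorial * (|μ| + B) ^ d) hKf
      (measurable_det fun k l => (measurable_jac w _ _).const_add _).aestronglyMeasurable
      (Eventually.of_forall fun x => abs_det_le fun k l => ?_)
    refine (abs_add_le _ _).trans (add_le_add ?_
      ((abs_jac_le w x k l).trans (norm_fderiv_le_of_lipschitz ℝ hw)))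
    by_cases hkl : k = l
    · simp [hkl]
    · simp [one_apply_ne hkl]
  have hM : ∀ k : ℕ, k ≠ 0 →
      ∫ x in tsupport φ, ((k * ((L + D : ℝ≥0) + 1 : ℝ)) • 1 + jac v' x).det =
      ∫ x in tsupport φ, ((k * ((L + D : ℝ≥0) + 1 : ℝ)) • 1 + jac v x).det := fun k hk => by
    refine setIntegral_det_eq_of_eqOn_compl hv' (hv.weaken le_self_add) hKm hvv' ?_
    have h1 : (1 : ℝ) ≤ k := by exact_mod_cast Nat.one_le_iff_ne_zero.2 hk
    nlinarith [(L + D).coe_nonneg]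
  have hsum : ∀ {w : (Fin d → ℝ) → Fin d → ℝ} {B : ℝ≥0}, LipschitzWith B w →
      ∑ k ∈ Finset.range (d + 2), ((-1 : ℝ) ^ (d + 1 - k) * (d + 1).choose k) *
        ∫ x in tsupport φ, ((k * ((L + D : ℝ≥0) + 1 : ℝ)) • 1 + jac w x).det = 0 :=
    fun {w B} hw => by
    simp only [← integral_const_mul]
    rw [← integral_finsetSum _ fun k _ => (hfint hw _).const_mul _]
    simp only [sum_choose_mul_det_eq_zero, integral_zero]
  have h0 : ∫ x in tsupport φ, (jac v' x).det = ∫ x in tsupport φ, (jac v x).det := by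
    have h1 := (hsum hv').trans (hsum hv).symm
    rw [Finset.sum_range_succ', Finset.sum_range_succ' (n := d + 1),
      Finset.sum_congr rfl fun k _ => by rw [hM (k + 1) k.succ_ne_zero], add_right_inj] at h1
    simpa using h1
  have hfint0 : ∀ {w : (Fin d → ℝ) → Fin d → ℝ} {B : ℝ≥0}, LipschitzWith B w →
      IntegrableOn (fun x => (jac w x).det) (tsupport φ) := fun hw => by
    simpa using hfint hw 0
  have hadj : ∀ j, Integrable fun x => (jac v x).adjugate j i * pd j φ x := fun j =>
    ((continuous_pd hφ j).integrable_of_hasCompactSupport (hasCompactSupport_pd hφc j)).bdd_mul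
      (c := d.factorial * (L + 1 : ℝ) ^ d)
      (measurable_adjugate (measurable_jac v) j i).aestronglyMeasurable
      (Eventually.of_forall fun x => abs_adjugate_le (by simp) (fun k l =>
        ((abs_jac_le v x k l).trans (norm_fderiv_le_of_lipschitz ℝ hv)).trans (by simp)) j i)
  rw [← integral_finsetSum _ fun j _ => hadj j, ← setIntegral_eq_integral_of_forall_compl_eq_zero
    (s := tsupport φ) fun x hx => Finset.sum_eq_zero fun j _ => by
      rw [pd_eq_zero_of_notMem hx, mul_zero]]
  rw [← sub_eq_zero, ← integral_sub (hfint0 hv') (hfint0 hv)] at h0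
  rw [← h0]
  refine integral_congr_ae (ae_restrict_of_ae ?_)
  filter_upwards [hv.ae_differentiableAt] with x hx
  rw [jac_add_single hx (hφ.differentiable (by simp) x), det_add_updateRow_zero,
      add_sub_cancel_left]

end Piola

section Rotations

variable {d : ℕ}

/-- The distance, in the entrywise supremum norm, from a matrix to `SO(G)`. -/
noncomputable def rotDist (G : Matrix (Fin d) (Fin d) ℝ) (A : Fin d → Fin d → ℝ) : ℝ :=
  infDist (α := Fin d → Fin d → ℝ) A (SOset d G)

theorem rotDist_nonneg (G : Matrix (Fin d) (Fin d) ℝ) (A : Fin d → Fin d → ℝ) : 0 ≤ rotDist G A :=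
  infDist_nonneg

theorem lipschitzWith_rotDist (G : Matrix (Fin d) (Fin d) ℝ) : LipschitzWith 1 (rotDist G) :=
  lipschitz_infDist_pt _

theorem sum_sq_of_mem_SOset {G R : Matrix (Fin d) (Fin d) ℝ} (hR : R ∈ SOset d G) (j : Fin d) :
    ∑ k, R k j ^ 2 = G j j := by
  rw [← hR.1, mul_apply]
  exact Finset.sum_congr rfl fun k _ => by rw [transpose_apply, sq]

theorem sq_le_of_mem_SOset {G R : Matrix (Fin d) (Fin d) ℝ} (hR : R ∈ SOset d G) (i j : Fin d) :
    R i j ^ 2 ≤ G j j := by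
  rw [← sum_sq_of_mem_SOset hR j]
  exact Finset.single_le_sum (f := fun k => R k j ^ 2) (fun k _ => sq_nonneg _) (Finset.mem_univ i)

theorem abs_le_one_of_mem_SOset {R : Matrix (Fin d) (Fin d) ℝ} (hR : R ∈ SOset d 1) (i j : Fin d) :
    |R i j| ≤ 1 := by
  have := sq_le_of_mem_SOset hR i j
  rw [one_apply_eq] at this
  exact abs_le_one_iff_mul_self_le_one.2 (by rwa [← sq])

theorem det_sq_of_mem_SOset {G R : Matrix (Fin d) (Fin d) ℝ} (hR : R ∈ SOset d G) :
    R.det ^ 2 = G.det := by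
  rw [← hR.1, det_mul, det_transpose, sq]

theorem det_eq_sqrt_of_mem_SOset {G R : Matrix (Fin d) (Fin d) ℝ} (hR : R ∈ SOset d G) :
    R.det = √G.det := by
  rw [← det_sq_of_mem_SOset hR, Real.sqrt_sq hR.2.le]

theorem one_mem_SOset : (1 : Matrix (Fin d) (Fin d) ℝ) ∈ SOset d 1 := by
  simp [SOset]

theorem isCompact_SOset {G : Matrix (Fin d) (Fin d) ℝ} (hG : 0 < G.det) :
    IsCompact (X := Fin d → Fin d → ℝ) (SOset d G) := by
  refine Metric.isCompact_of_isClosed_isBounded (α := Fin d → Fin d → ℝ) ?_ ?_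
  · have h : (SOset d G : Set (Fin d → Fin d → ℝ)) =
        {R : Fin d → Fin d → ℝ | (of R)ᵀ * of R = G} ∩ {R : Fin d → Fin d → ℝ | (of R).det =
            √G.det} := by
      ext R
      constructor
      · exact fun hR => ⟨hR.1, det_eq_sqrt_of_mem_SOset hR⟩
      · rintro ⟨h1, h2⟩
        refine ⟨h1, ?_⟩
        have h3 : (of R).det = √G.det := h2
        exact h3 ▸ Real.sqrt_pos.2 hG
    rw [h]
    have hof : Continuous fun R : Fin d → Fin d → ℝ => (of R : Matrix (Fin d) (Fin d) ℝ) :=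
      continuous_id
    exact (isClosed_eq (hof.matrix_transpose.matrix_mul hof) continuous_const).inter
      (isClosed_eq hof.matrix_det continuous_const)
  · refine (isBounded_closedBall (x := (0 : Fin d → Fin d → ℝ))
      (r := ∑ j, √(G j j))).subset fun R hR => ?_
    rw [mem_closedBall_zero_iff]
    have h0 : 0 ≤ ∑ j, √(G j j) := Finset.sum_nonneg fun j _ => Real.sqrt_nonneg _
    refine (pi_norm_le_iff_of_nonneg h0).2 fun i => (pi_norm_le_iff_of_nonneg h0).2 fun j => ?_
    refine (Real.abs_le_sqrt (sq_le_of_mem_SOset hR i j)).trans ?_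
    exact Finset.single_le_sum (f := fun j => √(G j j)) (fun k _ => Real.sqrt_nonneg _)
      (Finset.mem_univ j)

theorem exists_mem_SOset_norm_sub_eq (A : Fin d → Fin d → ℝ) :
    ∃ R : Fin d → Fin d → ℝ, (of R) ∈ SOset d 1 ∧ rotDist 1 A = ‖A - R‖ := by
  obtain ⟨R, hR, h⟩ := IsCompact.exists_infDist_eq_dist (α := Fin d → Fin d → ℝ)
    (isCompact_SOset (d := d) (G := 1) (by simp)) ⟨_, one_mem_SOset⟩ A
  exact ⟨R, hR, by rw [rotDist, h, dist_eq_norm]⟩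

theorem norm_le_one_of_mem_SOset {R : Fin d → Fin d → ℝ} (hR : of R ∈ SOset d 1) : ‖R‖ ≤ 1 :=
  (pi_norm_le_iff_of_nonneg zero_le_one).2 fun i =>
      (pi_norm_le_iff_of_nonneg zero_le_one).2 fun j =>
    abs_le_one_of_mem_SOset hR i j

theorem norm_le_rotDist_add_one (A : Fin d → Fin d → ℝ) : ‖A‖ ≤ rotDist 1 A + 1 := by
  obtain ⟨R, hR, h⟩ := exists_mem_SOset_norm_sub_eq A
  rw [h]
  linarith [norm_le_one_of_mem_SOset hR, norm_sub_norm_le A R]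

theorem adjugate_of_mem_SOset {R : Matrix (Fin d) (Fin d) ℝ} (hR : R ∈ SOset d 1) :
    R.adjugate = Rᵀ := by
  have hdet : R.det = 1 := by simpa using det_eq_sqrt_of_mem_SOset hR
  have h1 := R.adjugate_mul
  have h2 : R * Rᵀ = 1 := mul_eq_one_comm.1 hR.1
  rw [hdet, one_smul] at h1
  calc R.adjugate = R.adjugate * (R * Rᵀ) := by rw [h2, mul_one]
    _ = Rᵀ := by rw [← Matrix.mul_assoc, h1, one_mul]

theorem contDiff_det_of {E : Type*} [NormedAddCommGroup E] [NormedSpace ℝ E]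
    {A : E → Matrix (Fin d) (Fin d) ℝ} (hA : ∀ i j, ContDiff ℝ 1 fun x => A x i j) :
    ContDiff ℝ 1 fun x => (A x).det := by
  simp only [det_apply]
  exact ContDiff.sum fun σ _ => ContDiff.const_smul _ (contDiff_prod fun i _ => hA _ _)

theorem contDiff_adjugate (i j : Fin d) :
    ContDiff ℝ 1 fun A : Fin d → Fin d → ℝ => (of A).adjugate i j := by
  simp only [adjugate_apply]
  refine contDiff_det_of fun k l => ?_
  by_cases hk : k = j
  · subst hk
    simp only [updateRow_self]
    exact contDiff_const
  · simp only [updateRow_ne hk]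
    exact contDiff_apply_apply ℝ ℝ k l

theorem exists_abs_sub_adjugate_le (d : ℕ) (B : ℝ) :
    ∃ K : ℝ≥0, ∀ A : Fin d → Fin d → ℝ, ‖A‖ ≤ B → ∀ i j,
      |A i j - (of A).adjugate j i| ≤ K * rotDist 1 A := by
  have hsm : ∀ i j, ContDiff ℝ 1 fun A : Fin d → Fin d → ℝ => A i j - (of A).adjugate j i :=
    fun i j => (contDiff_apply_apply ℝ ℝ i j).sub (contDiff_adjugate j i)
  choose K hK using fun i j => (hsm i j).contDiffOn.exists_lipschitzOnWith one_ne_zero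
    (convex_closedBall (0 : Fin d → Fin d → ℝ) (max B 1)) (isCompact_closedBall _ _)
  refine ⟨∑ i, ∑ j, K i j, fun A hA i j => ?_⟩
  obtain ⟨R, hR, h⟩ := exists_mem_SOset_norm_sub_eq A
  have h1 := (hK i j).dist_le_mul A (by simpa using Or.inl hA) R
    (by simpa using Or.inr (norm_le_one_of_mem_SOset hR))
  have h2 : R i j - (of R).adjugate j i = 0 := by
    rw [adjugate_of_mem_SOset hR, transpose_apply, of_apply, sub_self]
  rw [h2, dist_zero_right, Real.norm_eq_abs, dist_eq_norm, ← h] at h1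
  refine h1.trans (mul_le_mul_of_nonneg_right ?_ (rotDist_nonneg 1 A))
  refine NNReal.coe_le_coe.2 ?_
  exact (Finset.single_le_sum (f := fun j => K i j) (fun _ _ => zero_le) (Finset.mem_univ j)).trans
    (Finset.single_le_sum (f := fun i => ∑ j, K i j) (fun _ _ => zero_le) (Finset.mem_univ i))

theorem sum_sum_sq_of_mem_SOset {R : Matrix (Fin d) (Fin d) ℝ} (hR : R ∈ SOset d 1) :
    ∑ i, ∑ j, R i j ^ 2 = d := by
  rw [Finset.sum_comm]
  simp [sum_sq_of_mem_SOset hR]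

theorem abs_sum_sum_sq_sub_le {A : Fin d → Fin d → ℝ} {B : ℝ} (hA : ‖A‖ ≤ B) :
    |∑ i, ∑ j, A i j ^ 2 - d| ≤ d * d * (B + 1) * rotDist 1 A := by
  obtain ⟨R, hR, h⟩ := exists_mem_SOset_norm_sub_eq A
  have hent : ∀ i j, |A i j ^ 2 - (of R) i j ^ 2| ≤ (B + 1) * ‖A - R‖ := fun i j => by
    have h1 : |A i j - R i j| ≤ ‖A - R‖ :=
      (norm_le_pi_norm ((A - R) i) j).trans (norm_le_pi_norm (A - R) i)
    have h2 : |A i j| ≤ B := ((norm_le_pi_norm (A i) j).trans (norm_le_pi_norm A i)).trans hA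
    have h3 : |R i j| ≤ 1 := abs_le_one_of_mem_SOset hR i j
    rw [of_apply, sq_sub_sq, abs_mul]
    exact mul_le_mul ((abs_add_le _ _).trans (add_le_add h2 h3)) h1 (abs_nonneg _)
      (by linarith [(abs_nonneg _).trans h2])
  have hd : ∑ i, ∑ j, A i j ^ 2 - d = ∑ i, ∑ j, (A i j ^ 2 - (of R) i j ^ 2) := by
    simp only [Finset.sum_sub_distrib, sum_sum_sq_of_mem_SOset hR]
  rw [h, hd]
  calc _ ≤ ∑ i, ∑ j, |A i j ^ 2 - (of R) i j ^ 2| :=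
        (Finset.abs_sum_le_sum_abs _ _).trans
          (Finset.sum_le_sum fun i _ => Finset.abs_sum_le_sum_abs _ _)
    _ ≤ ∑ i : Fin d, ∑ j : Fin d, (B + 1) * ‖A - R‖ :=
        Finset.sum_le_sum fun i _ => Finset.sum_le_sum fun j _ => hent i j
    _ = _ := by simp; ring

theorem abs_transpose_mul_le {R A : Fin d → Fin d → ℝ} (hR : of R ∈ SOset d 1) (i j : Fin d) :
    |((of R)ᵀ * of A) i j| ≤ d * ‖A‖ := by
  rw [mul_apply]
  calc |∑ k, (of R)ᵀ i k * of A k j| ≤ ∑ k : Fin d, ‖A‖ :=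
        (Finset.abs_sum_le_sum_abs _ _).trans (Finset.sum_le_sum fun k _ => by
          rw [abs_mul, transpose_apply, of_apply A]
          have h1 := abs_le_one_of_mem_SOset hR k i
          have h2 : |A k j| ≤ ‖A‖ := (norm_le_pi_norm (A k) j).trans (norm_le_pi_norm A k)
          nlinarith [abs_nonneg (A k j), abs_nonneg (of R k i)])
    _ = _ := by simp

theorem abs_symm_transpose_mul_sub_one_le {A R : Fin d → Fin d → ℝ} {B : ℝ} (hB : 0 ≤ B)
    (hA : ‖A‖ ≤ B) (hR : of R ∈ SOset d 1) (i j : Fin d) :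
    |(((of R)ᵀ * of A) i j + ((of R)ᵀ * of A) j i) / 2 - (1 : Matrix (Fin d) (Fin d) ℝ) i j| ≤
      (d + d ^ 3) * (B + 2) * (rotDist 1 A + ‖A - R‖ ^ 2) := by
  obtain ⟨S, hS, h⟩ := exists_mem_SOset_norm_sub_eq A
  set Q : Matrix (Fin d) (Fin d) ℝ := (of R)ᵀ * of S with hQ
  have hRR : of R * (of R)ᵀ = 1 := mul_eq_one_comm.1 hR.1
  have hQQ : Qᵀ * Q = 1 := by
    rw [hQ, transpose_mul, transpose_transpose, Matrix.mul_assoc, ← Matrix.mul_assoc (of R), hRR,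
      Matrix.one_mul, hS.1]
  have hQ1 : Q - 1 = (of R)ᵀ * of (S - R) := by
    have : of (S - R) = of S - of R := rfl
    rw [this, Matrix.mul_sub, hR.1]
  have hAQ : (of R)ᵀ * of A = Q + (of R)ᵀ * of (A - S) := by
    have : of (A - S) = of A - of S := rfl
    rw [this, Matrix.mul_sub]
    abel
  have hsymm : (Q - 1)ᵀ * (Q - 1) = (2 : ℝ) • 1 - Q - Qᵀ := by
    rw [transpose_sub, transpose_one, Matrix.sub_mul, Matrix.mul_sub, hQQ, Matrix.one_mul,
      Matrix.mul_one, two_smul]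
    abel
  have h1 := congrFun (congrFun hsymm i) j
  rw [Matrix.sub_apply, Matrix.sub_apply, Matrix.smul_apply, transpose_apply, smul_eq_mul] at h1
  have h2 : (((of R)ᵀ * of A) i j + ((of R)ᵀ * of A) j i) / 2 - (1 : Matrix (Fin d) (Fin d) ℝ) i j =
      (((of R)ᵀ * of (A - S)) i j + ((of R)ᵀ * of (A - S)) j i) / 2 -
        ((Q - 1)ᵀ * (Q - 1) : Matrix (Fin d) (Fin d) ℝ) i j / 2 := by
    rw [h1, hAQ, Matrix.add_apply, Matrix.add_apply]
    ring
  have h3 : |((Q - 1)ᵀ * (Q - 1) : Matrix (Fin d) (Fin d) ℝ) i j| ≤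
      d * (d * ‖S - R‖ * (d * ‖S - R‖)) := by
    rw [mul_apply]
    calc _ ≤ ∑ k : Fin d, d * ‖S - R‖ * (d * ‖S - R‖) :=
          (Finset.abs_sum_le_sum_abs _ _).trans (Finset.sum_le_sum fun k _ => by
            rw [abs_mul, transpose_apply, hQ1]
            exact mul_le_mul (abs_transpose_mul_le hR k i) (abs_transpose_mul_le hR k j)
              (abs_nonneg _) (by positivity))
      _ = _ := by simp
  have h4 := abs_transpose_mul_le (A := A - S) hR i j
  have h5 := abs_transpose_mul_le (A := A - S) hR j i
  have h6 : ‖S - R‖ ≤ ‖A - S‖ + ‖A - R‖ := by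
    rw [← norm_sub_rev S A]
    exact norm_sub_le_norm_sub_add_norm_sub S A R
  have h7 : ‖A - S‖ ≤ B + 1 := (norm_sub_le _ _).trans (add_le_add hA (norm_le_one_of_mem_SOset hS))
  rw [h2, h]
  have h8 : ‖S - R‖ ^ 2 ≤ 2 * ((B + 2) * (‖A - S‖ + ‖A - R‖ ^ 2)) := by
    nlinarith [norm_nonneg (S - R), norm_nonneg (A - S), norm_nonneg (A - R),
      sq_nonneg (‖A - S‖ - ‖A - R‖), mul_nonneg hB (sq_nonneg ‖A - R‖)]
  calc _ ≤ (|((of R)ᵀ * of (A - S)) i j| + |((of R)ᵀ * of (A - S)) j i|) / 2 +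
        |((Q - 1)ᵀ * (Q - 1) : Matrix (Fin d) (Fin d) ℝ) i j| / 2 := by
        refine (abs_sub _ _).trans ?_
        rw [abs_div, abs_div, abs_two]
        gcongr
        exact abs_add_le _ _
    _ ≤ (d * ‖A - S‖ + d * ‖A - S‖) / 2 + d * (d * ‖S - R‖ * (d * ‖S - R‖)) / 2 := by gcongr
    _ = d * ‖A - S‖ + d ^ 3 * ‖S - R‖ ^ 2 / 2 := by ring
    _ ≤ d * ((B + 2) * (‖A - S‖ + ‖A - R‖ ^ 2)) +
        d ^ 3 * (2 * ((B + 2) * (‖A - S‖ + ‖A - R‖ ^ 2))) / 2 := by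
        gcongr
        nlinarith [norm_nonneg (A - S), mul_nonneg hB (sq_nonneg ‖A - R‖), sq_nonneg ‖A - R‖,
          mul_nonneg hB (norm_nonneg (A - S))]
    _ = _ := by ring

end Rotations

section Korn

variable {d : ℕ}

theorem opNorm_le_of_forall_single {F : Type*} [NormedAddCommGroup F] [NormedSpace ℝ F]
    (L : (Fin d → ℝ) →L[ℝ] F) {η : ℝ} (hη : 0 ≤ η) (h : ∀ k, ‖L (Pi.single k 1)‖ ≤ η) :
    ‖L‖ ≤ d * η := by
  refine ContinuousLinearMap.opNorm_le_bound _ (by positivity) fun w => ?_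
  have hw : w = ∑ k, w k • (Pi.single k 1 : Fin d → ℝ) := by
    rw [← Finset.univ_sum_single w]
    refine Finset.sum_congr rfl fun k _ => ?_
    rw [← Pi.single_smul, smul_eq_mul, mul_one]
    simp
  calc ‖L w‖ = ‖∑ k, w k • L (Pi.single k 1)‖ := by
        conv_lhs => rw [hw, map_sum]
        simp only [map_smul]
    _ ≤ ∑ k : Fin d, η * ‖w‖ := norm_sum_le_of_le _ fun k _ => by
        rw [norm_smul, mul_comm]
        exact mul_le_mul (h k) (norm_le_pi_norm w k) (norm_nonneg _) hη
    _ = _ := by simp; ring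

theorem hasFDerivAt_integral_mul_comp_sub {f φ : (Fin d → ℝ) → ℝ} (hf : LocallyIntegrable f volume)
    (hφ : ContDiff ℝ ((⊤ : ℕ∞) : WithTop ℕ∞) φ) (hφc : HasCompactSupport φ) (x : Fin d → ℝ) :
    ∃ L : (Fin d → ℝ) →L[ℝ] ℝ, HasFDerivAt (fun x => ∫ y, f y * φ (x - y)) L x ∧
      ∀ k, L (Pi.single k 1) = ∫ y, f y * pd k φ (x - y) := by
  have h1 : ContDiff ℝ 1 φ := hφ.of_le (by norm_cast)
  refine ⟨_, hφc.hasFDerivAt_convolution_right (ContinuousLinearMap.mul ℝ ℝ) hf h1 x, fun k => ?_⟩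
  rw [convolution_precompR_apply _ hf (hφc.fderiv ℝ) (h1.continuous_fderiv one_ne_zero)]
  rfl

theorem integral_pd_comp_sub {φ : (Fin d → ℝ) → ℝ} (hφ : ContDiff ℝ ((⊤ : ℕ∞) : WithTop ℕ∞) φ)
    (hφc : HasCompactSupport φ) (x : Fin d → ℝ) (k : Fin d) : ∫ y, pd k φ (x - y) = 0 := by
  rw [integral_sub_left_eq_self (pd k φ) volume x]
  have h := integral_mul_fderiv_eq_neg_fderiv_mul_of_integrable (μ :=
      (volume : Measure (Fin d → ℝ)))
    (f := fun _ => (1 : ℝ)) (g := φ) (v := Pi.single k 1) (by simp)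
    (by
      simp only [one_mul]
      exact (continuous_pd hφ k).integrable_of_hasCompactSupport (hasCompactSupport_pd hφc k))
    (by simpa using hφ.continuous.integrable_of_hasCompactSupport hφc)
    (fun x _ => by fun_prop) (fun x _ => hφ.differentiable (by simp) x)
  simp only [one_mul, fderiv_fun_const, Pi.zero_apply, _root_.zero_apply, zero_mul,
    integral_zero, neg_zero] at h
  exact h

theorem IsCurlFree.integral_mul_pd_comp_sub {h : (Fin d → ℝ) → Fin d → ℝ} (hc : IsCurlFree h)
    {φ : (Fin d → ℝ) → ℝ} (hφ : ContDiff ℝ ((⊤ : ℕ∞) : WithTop ℕ∞) φ) (hφc : HasCompactSupport φ)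
    (x : Fin d → ℝ) (i j : Fin d) :
    ∫ y, h y i * pd j φ (x - y) = ∫ y, h y j * pd i φ (x - y) := by
  have h1 := hc (fun y => φ (x - y)) (hφ.comp (contDiff_const.sub contDiff_id))
    (hφc.comp_homeomorph (Homeomorph.subLeft x)) i j
  simpa only [pd_comp_sub_left hφ, mul_neg, integral_neg, neg_inj] using h1

/-- A linear **Korn inequality** for fields satisfying the mean value formula: an `L¹` bound on the
symmetric part of a curl-free matrix field gives a uniform bound on its oscillation. -/
theorem exists_norm_sub_le_of_symm (d : ℕ) {r t ρ : ℝ} (hr : 0 ≤ r) (ht : 0 < t) (hρ : r + t < ρ) :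
    ∃ M : ℝ, 0 ≤ M ∧ ∀ {w : (Fin d → ℝ) → Fin d → Fin d → ℝ}, LocallyIntegrable w volume →
    (∀ i, IsCurlFree fun x => w x i) → (∀ i, IsDivFreeOn (fun x => w x i) (ball 0 ρ)) →
    ∀ (S : Fin d → Fin d → ℝ) {A : ℝ}, 0 ≤ A → (∀ i j, ∫ x in closedBall 0 (r + t),
      |(w x i j + w x j i) / 2 - S i j| ≤ A) →
    ∃ R : Fin d → Fin d → ℝ, ∀ᵐ x, x ∈ closedBall 0 r → ‖w x - R‖ ≤ M * A := by
  have hφ := contDiff_kernel (d := d) t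
  have hφc := hasCompactSupport_kernel (d := d) ht
  choose B hB using fun k => (hasCompactSupport_pd hφc k).exists_bound_of_continuous
    (continuous_pd hφ k)
  set M₀ : ℝ := ∑ k, |B k| with hM₀
  have hM₀0 : 0 ≤ M₀ := Finset.sum_nonneg fun k _ => abs_nonneg _
  have hBM : ∀ k w, |pd k (kernel t) w| ≤ M₀ := fun k w => (hB k w).trans ((le_abs_self _).trans
    (Finset.single_le_sum (f := fun k => |B k|) (fun _ _ => abs_nonneg _) (Finset.mem_univ k)))
  refine ⟨d * (3 * M₀) * r, by positivity, fun {w} hw hc hd S A hA0 hA => ?_⟩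
  have hwi : ∀ i, LocallyIntegrable (fun x => w x i) volume := fun i x => by
    obtain ⟨s, hs, hi⟩ := hw x
    exact ⟨s, hs, Integrable.eval hi i⟩
  have hwij : ∀ i j, LocallyIntegrable (fun x => w x i j) volume := fun i j x => by
    obtain ⟨s, hs, hi⟩ := hwi i x
    exact ⟨s, hs, Integrable.eval hi j⟩
  set e : Fin d → Fin d → (Fin d → ℝ) → ℝ := fun i j x =>
    (w x i j + w x j i) / 2 - S i j with he
  have hfint : ∀ x i j k, Integrable fun y => w y i j * pd k (kernel t) (x - y) := fun x i j k =>
    integrable_mul_comp_sub (hwij i j) (continuous_pd hφ k) (hasCompactSupport_pd hφc k) x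
  have hpd : ∀ x k, Integrable fun y => pd k (kernel t) (x - y) := fun x k =>
    ((continuous_pd hφ k).integrable_of_hasCompactSupport
      (hasCompactSupport_pd hφc k)).comp_sub_left x
  have hTe : ∀ x i j k, ∫ y, e i j y * pd k (kernel t) (x - y) =
      ((∫ y, w y i j * pd k (kernel t) (x - y)) + ∫ y, w y j i * pd k (kernel t) (x - y)) / 2 := by
    intro x i j k
    have h1 : ∀ y, e i j y * pd k (kernel t) (x - y) =
        (w y i j * pd k (kernel t) (x - y) + w y j i * pd k (kernel t) (x - y)) / 2 -
          S i j * pd k (kernel t) (x - y) := fun y => by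
      rw [he]; ring
    simp only [h1]
    have h2 : Integrable fun y => (w y i j * pd k (kernel t) (x - y) +
        w y j i * pd k (kernel t) (x - y)) / 2 := ((hfint x i j k).add (hfint x j i k)).div_const 2
    rw [integral_sub h2 ((hpd x k).const_mul _), integral_div, integral_add (hfint x i j k)
        (hfint x j i k), integral_const_mul,
      integral_pd_comp_sub hφ hφc, mul_zero, sub_zero]
  have hcurl := fun x i j k => (hc i).integral_mul_pd_comp_sub hφ hφc x j k
  have hid : ∀ x i j k, ∫ y, w y i j * pd k (kernel t) (x - y) =
      (∫ y, e i j y * pd k (kernel t) (x - y)) + (∫ y, e i k y * pd j (kernel t) (x - y)) -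
        ∫ y, e j k y * pd i (kernel t) (x - y) := fun x i j k => by
    rw [hTe, hTe, hTe, hcurl x i k j, hcurl x j k i, hcurl x k j i]
    ring
  have hbound : ∀ x ∈ closedBall (0 : Fin d → ℝ) r, ∀ i j k,
      |∫ y, e i j y * pd k (kernel t) (x - y)| ≤ M₀ * A := by
    intro x hx i j k
    have hon : IntegrableOn (fun y => |e i j y|) (closedBall 0 (r + t)) := by
      have h1 : IntegrableOn (fun y => (w y i j + w y j i) / 2) (closedBall 0 (r + t)) :=
        ((((hwij i j).integrableOn_isCompact (isCompact_closedBall 0 (r + t))).add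
          ((hwij j i).integrableOn_isCompact (isCompact_closedBall 0 (r + t)))).div_const 2)
      have h2 : IntegrableOn (fun _ : Fin d → ℝ => S i j)
        (closedBall 0 (r + t)) := integrableOn_const measure_closedBall_lt_top.ne
      exact (h1.sub h2).abs
    refine le_trans ?_ (mul_le_mul_of_nonneg_left (hA i j) hM₀0)
    rw [← integral_const_mul, ← integral_indicator measurableSet_closedBall]
    refine norm_integral_le_of_norm_le (f := fun y => e i j y * pd k (kernel t) (x - y))
      (IntegrableOn.integrable_indicator (hon.const_mul M₀) measurableSet_closedBall)
      (Eventually.of_forall fun y => ?_)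
    by_cases hy : y ∈ closedBall (0 : Fin d → ℝ) (r + t)
    · rw [indicator_of_mem hy, norm_mul, mul_comm]
      exact mul_le_mul_of_nonneg_right (hBM _ _) (abs_nonneg _)
    · rw [indicator_of_notMem hy, pd_eq_zero_of_notMem, mul_zero, norm_zero]
      intro hmem
      have h1 := tsupport_subset_closedBall (x := (0 : Fin d → ℝ)) (r := 3 / 4 * t)
        (φ := kernel t) (fun z hz => kernel_of_le_norm ht (by simpa using hz)) hmem
      rw [mem_closedBall_zero_iff] at h1 hx
      refine hy (mem_closedBall_zero_iff.2 ?_)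
      have h2 := norm_sub_le x (x - y)
      rw [sub_sub_cancel] at h2
      linarith
  refine ⟨fun i j => ∫ y, w y i j * kernel t (0 - y), ?_⟩
  filter_upwards [ae_all_iff.2 fun i => ae_eq_integral_mul_kernel (hwi i) (hc i) (hd i) ht hρ]
    with x hx hxr
  refine (pi_norm_le_iff_of_nonneg (by positivity)).2 fun i =>
    (pi_norm_le_iff_of_nonneg (by positivity)).2 fun j => ?_
  rw [Pi.sub_apply, Pi.sub_apply, hx i hxr j]
  choose L hL hL' using fun x => hasFDerivAt_integral_mul_comp_sub (hwij i j) hφ hφc x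
  have hLn : ∀ z ∈ closedBall (0 : Fin d → ℝ) r, ‖L z‖ ≤ d * (3 * (M₀ * A)) := fun z hz => by
    refine opNorm_le_of_forall_single _ (by positivity) fun k => ?_
    rw [hL', hid, Real.norm_eq_abs]
    refine (abs_sub _ _).trans ?_
    linarith [abs_add_le (∫ y, e i j y * pd k (kernel t) (z - y))
      (∫ y, e i k y * pd j (kernel t) (z - y)), hbound z hz i j k, hbound z hz i k j,
      hbound z hz j k i]
  have h1 := (convex_closedBall (0 : Fin d → ℝ) r).norm_image_sub_le_of_norm_hasFDerivWithin_le
    (fun z _ => (hL z).hasFDerivWithinAt) hLn (mem_closedBall_self hr) hxr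
  refine h1.trans ?_
  have h2 : ‖x - 0‖ ≤ r := by simpa using hxr
  calc _ ≤ d * (3 * (M₀ * A)) * r := by gcongr
    _ = _ := by ring

end Korn

section Linearization

variable {d : ℕ}

theorem rotDist_le_norm_add_one (A : Fin d → Fin d → ℝ) : rotDist 1 A ≤ ‖A‖ + 1 := by
  have h := infDist_le_dist_of_mem (α := Fin d → Fin d → ℝ) (x := A) (one_mem_SOset (d := d))
  refine h.trans ((dist_eq_norm (E := Fin d → Fin d → ℝ) _ _).trans_le ?_)
  exact (norm_sub_le (E := Fin d → Fin d → ℝ) _ _).trans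
    (add_le_add le_rfl (norm_le_one_of_mem_SOset (d := d) (one_mem_SOset (d := d))))

theorem integrableOn_rotDist {h : (Fin d → ℝ) → Fin d → Fin d → ℝ} {S : Set (Fin d → ℝ)}
    (hS : volume S ≠ ∞) (hh : IntegrableOn h S) : IntegrableOn (fun x => rotDist 1 (h x)) S := by
  have h1 : IntegrableOn (fun _ : Fin d → ℝ => (1 : ℝ)) S := integrableOn_const hS
  refine (hh.norm.add h1).mono'
    ((lipschitzWith_rotDist 1).continuous.comp_aestronglyMeasurable hh.aestronglyMeasurable)
    (Eventually.of_forall fun x => ?_)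
  rw [Real.norm_of_nonneg (rotDist_nonneg _ _)]
  exact rotDist_le_norm_add_one _

theorem volume_real_closedBall_le_one {r : ℝ} (hr : 0 ≤ r) (hr' : r ≤ 1 / 2) (c : Fin d → ℝ) :
    volume.real (closedBall c r) ≤ 1 := by
  rw [volume_real_closedBall c hr]
  exact pow_le_one₀ (by linarith) (by linarith)

theorem integral_sub_sq_mul {f k : (Fin d → ℝ) → ℝ} (hk : Integrable k) (hk1 : ∫ y, k y = 1)
    (hf : Integrable fun y => f y * k y) (hf2 : Integrable fun y => f y ^ 2 * k y) :
    ∫ y, (f y - ∫ z, f z * k z) ^ 2 * k y = (∫ y, f y ^ 2 * k y) - (∫ z, f z * k z) ^ 2 := by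
  set a := ∫ z, f z * k z with ha
  have h1 : ∀ y, (f y - a) ^ 2 * k y = (f y ^ 2 * k y - 2 * a * (f y * k y)) + a ^ 2 * k y :=
    fun y => by ring
  simp only [h1]
  have h2 : Integrable fun y => f y ^ 2 * k y - 2 * a * (f y * k y) := hf2.sub (hf.const_mul _)
  rw [integral_add h2 (hk.const_mul _), integral_sub hf2 (hf.const_mul _), integral_const_mul,
    integral_const_mul, hk1, ← ha]
  ring

theorem exists_bound_kernel {t : ℝ} (ht : 0 < t) : ∃ M : ℝ, 0 ≤ M ∧ ∀ w : Fin d → ℝ,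
    kernel t w ≤ M := by
  obtain ⟨M, hM⟩ := (hasCompactSupport_kernel (d := d) ht).exists_bound_of_continuous
    (contDiff_kernel t).continuous
  exact ⟨M, (norm_nonneg _).trans (hM 0), fun w => (le_abs_self _).trans (hM w)⟩

theorem kernel_sub_eq_zero {t : ℝ} (ht : 0 < t) {r ρ : ℝ} (hρ : r + 3 / 4 * t ≤ ρ) {x y : Fin d → ℝ}
    (hx : x ∈ closedBall (0 : Fin d → ℝ) r) (hy : y ∉ closedBall (0 : Fin d → ℝ) ρ) :
    kernel t (x - y) = 0 := by
  refine kernel_of_le_norm ht ?_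
  rw [mem_closedBall_zero_iff] at hx hy
  have h2 := norm_sub_le x (x - y)
  rw [sub_sub_cancel] at h2
  linarith

theorem integral_mul_kernel_le {t : ℝ} (ht : 0 < t) {r ρ : ℝ} (hρ : r + 3 / 4 * t ≤ ρ)
    {x : Fin d → ℝ} (hx : x ∈ closedBall (0 : Fin d → ℝ) r) {M : ℝ}
    (hM : ∀ w : Fin d → ℝ, kernel t w ≤ M) {f g : (Fin d → ℝ) → ℝ}
    (hg : IntegrableOn g (closedBall 0 ρ))
    (hfg : ∀ᵐ y, y ∈ closedBall (0 : Fin d → ℝ) ρ → |f y| ≤ g y) :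
    |∫ y, f y * kernel t (x - y)| ≤ M * ∫ y in closedBall 0 ρ, g y := by
  rw [← integral_const_mul, ← integral_indicator measurableSet_closedBall]
  refine norm_integral_le_of_norm_le (f := fun y => f y * kernel t (x - y))
    (IntegrableOn.integrable_indicator (hg.const_mul M) measurableSet_closedBall) ?_
  filter_upwards [hfg] with y hy
  by_cases hyρ : y ∈ closedBall (0 : Fin d → ℝ) ρ
  · rw [indicator_of_mem hyρ, norm_mul, Real.norm_of_nonneg (kernel_nonneg ht _), mul_comm]
    exact mul_le_mul (hM _) (hy hyρ) (abs_nonneg _) ((kernel_nonneg ht 0).trans (hM 0))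
  · rw [indicator_of_notMem hyρ, kernel_sub_eq_zero ht hρ hx hyρ, mul_zero, norm_zero]

theorem exists_ae_norm_le_of_rotDist (d : ℕ) : ∃ B : ℝ, 0 ≤ B ∧
    ∀ {h : (Fin d → ℝ) → Fin d → Fin d → ℝ}, LocallyIntegrable h volume →
    (∀ i, IsCurlFree fun x => h x i) → (∀ i, IsDivFreeOn (fun x => h x i) (ball 0 (1 / 4))) →
    ∫ x in closedBall 0 (1 / 4), rotDist 1 (h x) ≤ 1 →
    ∀ᵐ x, x ∈ closedBall (0 : Fin d → ℝ) (3 / 16) → ‖h x‖ ≤ B := by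
  obtain ⟨M, hM0, hM⟩ := exists_bound_kernel (d := d) (t := 1 / 32) (by norm_num)
  refine ⟨M * 2, by positivity, fun {h} hh hc hd hδ => ?_⟩
  have hhi : ∀ i, LocallyIntegrable (fun x => h x i) volume := fun i x => by
    obtain ⟨s, hs, hi⟩ := hh x
    exact ⟨s, hs, Integrable.eval hi i⟩
  have hon := hh.integrableOn_isCompact (isCompact_closedBall 0 (1 / 4))
  have hone : IntegrableOn (fun _ : Fin d → ℝ => (1 : ℝ)) (closedBall 0 (1 / 4)) :=
    integrableOn_const measure_closedBall_lt_top.ne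
  have hnorm : ∫ x in closedBall 0 (1 / 4), ‖h x‖ ≤ 2 := by
    calc ∫ x in closedBall 0 (1 / 4), ‖h x‖
        ≤ ∫ x in closedBall 0 (1 / 4), (rotDist 1 (h x) + 1) :=
          integral_mono hon.norm
            ((integrableOn_rotDist measure_closedBall_lt_top.ne hon).add hone)
            fun x => norm_le_rotDist_add_one _
      _ = (∫ x in closedBall 0 (1 / 4), rotDist 1 (h x)) +
          volume.real (closedBall (0 : Fin d → ℝ) (1 / 4)) := by
          rw [integral_add (integrableOn_rotDist measure_closedBall_lt_top.ne hon) hone]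
          simp
      _ ≤ 1 + 1 := add_le_add hδ (volume_real_closedBall_le_one (by norm_num) (by norm_num) _)
      _ = 2 := by norm_num
  filter_upwards [ae_all_iff.2 fun i => ae_eq_integral_mul_kernel (hhi i) (hc i) (hd i)
    (t := 1 / 32) (r := 3 / 16) (by norm_num) (by norm_num)] with x hx hxr
  refine (pi_norm_le_iff_of_nonneg (by positivity)).2 fun i =>
    (pi_norm_le_iff_of_nonneg (by positivity)).2 fun j => ?_
  rw [hx i hxr j]
  refine (integral_mul_kernel_le (by norm_num) (ρ := 1 / 4) (by norm_num) hxr hM hon.norm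
    (Eventually.of_forall fun y _ =>
      (norm_le_pi_norm (h y i) j).trans (norm_le_pi_norm (h y) i))).trans ?_
  gcongr

theorem exists_rotation_integral_sq_le (d : ℕ) : ∃ C s B : ℝ, 0 ≤ C ∧ 0 < s ∧ s ≤ 1 / 16 ∧ 0 ≤ B ∧
    ∀ {h : (Fin d → ℝ) → Fin d → Fin d → ℝ}, LocallyIntegrable h volume →
    (∀ i, IsCurlFree fun x => h x i) → (∀ i, IsDivFreeOn (fun x => h x i) (ball 0 (1 / 4))) →
    ∫ x in closedBall 0 (1 / 4), rotDist 1 (h x) ≤ 1 →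
    (∀ᵐ x, x ∈ closedBall (0 : Fin d → ℝ) s → ‖h x‖ ≤ B) ∧
    ∃ R : Fin d → Fin d → ℝ, of R ∈ SOset d 1 ∧
      ∫ x in closedBall 0 s, ‖h x - R‖ ^ 2 ≤ C * ∫ x in closedBall 0 (1 / 4), rotDist 1 (h x) := by
  obtain ⟨B, hB0, hB⟩ := exists_ae_norm_le_of_rotDist d
  obtain ⟨M, hM0, hM⟩ := exists_bound_kernel (d := d) (t := 1 / 16) (by norm_num)
  set s : ℝ := 1 / (64 * (d + 1)) with hs
  have hs0 : 0 < s := by positivity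
  have hs16 : s ≤ 1 / 16 := by
    rw [hs]; gcongr; linarith [(Nat.cast_nonneg d : (0 : ℝ) ≤ d)]
  set c : ℝ := (bumpMass d)⁻¹ * ((1 / 16) ^ d)⁻¹ with hc_def
  have hc0 : 0 < c := mul_pos (inv_pos.2 (bumpMass_pos d)) (by positivity)
  have hker : ∀ x ∈ closedBall (0 : Fin d → ℝ) s, ∀ y ∈ closedBall (0 : Fin d → ℝ) s,
      c ≤ kernel (1 / 16) (x - y) := by
    intro x hx y hy
    rw [mem_closedBall_zero_iff] at hx hy
    have h1 : ‖x - y‖ ≤ 2 * s := (norm_sub_le _ _).trans (by linarith)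
    have h2 : nsq (x - y) ≤ d * (2 * s) ^ 2 := (nsq_le_mul_norm_sq _).trans (by gcongr)
    have h3 : (d : ℝ) * (2 * s) ^ 2 ≤ (1 / 16) ^ 2 / 4 := by
      have h4 : s * (64 * (d + 1)) = 1 := by rw [hs]; field_simp
      have hd0 : (0 : ℝ) ≤ d := Nat.cast_nonneg d
      have h5 : (64 * s) * d ≤ 1 := by nlinarith
      have h6 : 64 * s ≤ 1 := by nlinarith [mul_nonneg hs0.le hd0]
      nlinarith
    rw [kernel, bump, cutoff_of_le, hc_def]
    · simp
    · rw [div_le_iff₀ (by norm_num)]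
      linarith
  set V := volume.real (closedBall (0 : Fin d → ℝ) s) with hV
  have hV0 : 0 < V := by rw [hV, volume_real_closedBall _ hs0.le]; positivity
  set K : ℝ := d * d * (B + 1) with hK
  have hK0 : 0 ≤ K := by positivity
  refine ⟨2 * (c⁻¹ * (M * K + K / V)) + 2 * (B + 1), s, B, by positivity, hs0, hs16, hB0,
    fun {h} hh hc hd hδ => ?_⟩
  have hbd := hB hh hc hd hδ
  set δ := ∫ x in closedBall 0 (1 / 4), rotDist 1 (h x) with hδ_def
  have hhi : ∀ i, LocallyIntegrable (fun x => h x i) volume := fun i x => by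
    obtain ⟨s, hs, hi⟩ := hh x
    exact ⟨s, hs, Integrable.eval hi i⟩
  have hhij : ∀ i j, LocallyIntegrable (fun x => h x i j) volume := fun i j x => by
    obtain ⟨s, hs, hi⟩ := hhi i x
    exact ⟨s, hs, Integrable.eval hi j⟩
  have hon := hh.integrableOn_isCompact (isCompact_closedBall 0 (1 / 4))
  have hrot := integrableOn_rotDist measure_closedBall_lt_top.ne hon
  have hδ0 : 0 ≤ δ := integral_nonneg fun _ => rotDist_nonneg _ _
  have hsub : closedBall (0 : Fin d → ℝ) s ⊆ closedBall 0 (1 / 4) :=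
    closedBall_subset_closedBall (by linarith)
  have hsub' : closedBall (0 : Fin d → ℝ) s ⊆ closedBall 0 (3 / 16) :=
    closedBall_subset_closedBall (by linarith)
  refine ⟨hbd.mono fun x hx hxs => hx (hsub' hxs), ?_⟩
  have hcont : Continuous (kernel (1 / 16) : (Fin d → ℝ) → ℝ) := (contDiff_kernel _).continuous
  -- bound of the quadratic oscillation around a generic point
  have hvar : ∀ᵐ x, x ∈ closedBall (0 : Fin d → ℝ) s → (∀ i, ∀ j, h x i j =
      ∫ y, h y i j * kernel (1 / 16) (x - y)) → ‖h x‖ ≤ B →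
      ∫ y in closedBall 0 s, ‖h y - h x‖ ^ 2 ≤ c⁻¹ * (M * K * δ + K * rotDist 1 (h x)) := by
    refine Eventually.of_forall fun x hx hmean hxB => ?_
    have hk := integrable_kernel_sub (d := d) (t := 1 / 16) (by norm_num) x
    have hi1 : ∀ i j, Integrable fun y => h y i j * kernel (1 / 16) (x - y) := fun i j =>
      integrable_mul_comp_sub (hhij i j) hcont (hasCompactSupport_kernel (by norm_num)) x
    have hi2 : ∀ i j, Integrable fun y => h y i j ^ 2 * kernel (1 / 16) (x - y) := fun i j => by
      refine ((hi1 i j).norm.const_mul B).mono' (((hhij i j).aestronglyMeasurable.pow 2).mul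
        (hcont.comp (continuous_const.sub continuous_id)).aestronglyMeasurable) ?_
      filter_upwards [hbd] with y hy
      by_cases hyρ : y ∈ closedBall (0 : Fin d → ℝ) (3 / 16)
      · rw [sq, mul_assoc, norm_mul]
        exact mul_le_mul_of_nonneg_right
          (((norm_le_pi_norm (h y i) j).trans (norm_le_pi_norm (h y) i)).trans (hy hyρ))
          (norm_nonneg _)
      · rw [kernel_sub_eq_zero (by norm_num) (by linarith) hx hyρ]
        simp
    have hi3 : ∀ i j, Integrable fun y => (h y i j - h x i j) ^ 2 * kernel (1 / 16) (x - y) :=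
      fun i j => by
      have h1 : ∀ y, (h y i j - h x i j) ^ 2 * kernel (1 / 16) (x - y) =
          (h y i j ^ 2 * kernel (1 / 16) (x - y) - 2 * h x i j * (h y i j * kernel (1 / 16)
              (x - y)))
            + h x i j ^ 2 * kernel (1 / 16) (x - y) := fun y => by ring
      simp only [h1]
      exact ((hi2 i j).sub ((hi1 i j).const_mul _)).add (hk.const_mul _)
    have hi4 : Integrable fun y => (∑ i, ∑ j, (h y i j - h x i j) ^ 2) * kernel (1 / 16)
        (x - y) := by
      simp only [Finset.sum_mul]
      exact integrable_finsetSum _ fun i _ => integrable_finsetSum _ fun j _ => hi3 i j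
    have hi5 : Integrable fun y => (∑ i, ∑ j, h y i j ^ 2) * kernel (1 / 16) (x - y) := by
      simp only [Finset.sum_mul]
      exact integrable_finsetSum _ fun i _ => integrable_finsetSum _ fun j _ => hi2 i j
    have hident : ∫ y, (∑ i, ∑ j, (h y i j - h x i j) ^ 2) * kernel (1 / 16) (x - y) =
        (∫ y, (∑ i, ∑ j, h y i j ^ 2 - d) * kernel (1 / 16) (x - y)) -
          (∑ i, ∑ j, h x i j ^ 2 - d) := by
      have h1 : ∫ y, (∑ i, ∑ j, h y i j ^ 2 - d) * kernel (1 / 16) (x - y) =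
          (∑ i, ∑ j, ∫ y, h y i j ^ 2 * kernel (1 / 16) (x - y)) - d := by
        simp only [sub_mul]
        rw [integral_sub hi5 (hk.const_mul _), integral_const_mul,
            integral_kernel_sub (by norm_num),
          mul_one]
        simp only [Finset.sum_mul]
        rw [integral_finsetSum _ fun i _ => integrable_finsetSum _ fun j _ => hi2 i j]
        simp only [integral_finsetSum _ fun j _ => hi2 _ j]
      rw [h1]
      simp only [Finset.sum_mul]
      rw [integral_finsetSum _ fun i _ => integrable_finsetSum _ fun j _ => hi3 i j]
      simp only [integral_finsetSum _ fun j _ => hi3 _ j]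
      have h2 : ∀ i j, ∫ y, (h y i j - h x i j) ^ 2 * kernel (1 / 16) (x - y) =
          (∫ y, h y i j ^ 2 * kernel (1 / 16) (x - y)) - h x i j ^ 2 := fun i j => by
        rw [hmean i j]
        exact integral_sub_sq_mul hk (integral_kernel_sub (by norm_num) x) (hi1 i j) (hi2 i j)
      simp only [h2, Finset.sum_sub_distrib]
      ring
    have hm1 : |∫ y, (∑ i, ∑ j, h y i j ^ 2 - d) * kernel (1 / 16) (x - y)| ≤ M * (K * δ) := by
      refine (integral_mul_kernel_le (by norm_num) (ρ := 3 / 16) (by linarith) hx hM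
        (g := fun y => K * rotDist 1 (h y)) ((hrot.mono_set
          (closedBall_subset_closedBall (by norm_num))).const_mul _)
        (hbd.mono fun y hy hyρ => abs_sum_sum_sq_sub_le (hy hyρ))).trans ?_
      rw [integral_const_mul]
      gcongr
      exact setIntegral_mono_set hrot (Eventually.of_forall fun _ => rotDist_nonneg _ _)
        (closedBall_subset_closedBall (by norm_num)).eventuallyLE
    have hm2 : |∑ i, ∑ j, h x i j ^ 2 - (d : ℝ)| ≤ K * rotDist 1 (h x) := abs_sum_sum_sq_sub_le hxB
    have hpt : ∀ y ∈ closedBall (0 : Fin d → ℝ) s, ‖h y - h x‖ ^ 2 ≤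
        c⁻¹ * ((∑ i, ∑ j, (h y i j - h x i j) ^ 2) * kernel (1 / 16) (x - y)) := fun y hy => by
      have h0 : 0 ≤ ∑ i, ∑ j, (h y i j - h x i j) ^ 2 :=
        Finset.sum_nonneg fun i _ => Finset.sum_nonneg fun j _ => sq_nonneg _
      have h1 : ‖h y - h x‖ ≤ √(∑ i, ∑ j, (h y i j - h x i j) ^ 2) :=
        (pi_norm_le_iff_of_nonneg (Real.sqrt_nonneg _)).2 fun i =>
          (pi_norm_le_iff_of_nonneg (Real.sqrt_nonneg _)).2 fun j => Real.abs_le_sqrt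
            ((Finset.single_le_sum (f := fun j => (h y i j - h x i j) ^ 2) (fun _ _ => sq_nonneg _)
              (Finset.mem_univ j)).trans
            (Finset.single_le_sum (f := fun i => ∑ j, (h y i j - h x i j) ^ 2)
              (fun _ _ => Finset.sum_nonneg fun _ _ => sq_nonneg _) (Finset.mem_univ i)))
      have h2 := pow_le_pow_left₀ (norm_nonneg _) h1 2
      rw [Real.sq_sqrt h0] at h2
      refine h2.trans ?_
      rw [le_inv_mul_iff₀ hc0, mul_comm]
      exact mul_le_mul_of_nonneg_left (hker x hx y hy) h0
    calc ∫ y in closedBall 0 s, ‖h y - h x‖ ^ 2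
        ≤ ∫ y in closedBall 0 s,
          c⁻¹ * ((∑ i, ∑ j, (h y i j - h x i j) ^ 2) * kernel (1 / 16) (x - y)) :=
          integral_mono_of_nonneg (Eventually.of_forall fun _ => sq_nonneg _)
            (hi4.const_mul _).integrableOn
            ((ae_restrict_iff' measurableSet_closedBall).2 (Eventually.of_forall hpt))
      _ ≤ ∫ y, c⁻¹ * ((∑ i, ∑ j, (h y i j - h x i j) ^ 2) * kernel (1 / 16) (x - y)) :=
          setIntegral_le_integral (hi4.const_mul _) (Eventually.of_forall fun y =>
            mul_nonneg (inv_nonneg.2 hc0.le) (mul_nonneg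
              (Finset.sum_nonneg fun i _ => Finset.sum_nonneg fun j _ => sq_nonneg _)
              (kernel_nonneg (by norm_num) _)))
      _ ≤ _ := by
          rw [integral_const_mul, hident]
          gcongr
          linarith [le_abs_self (∫ y, (∑ i, ∑ j, h y i j ^ 2 - d) * kernel (1 / 16) (x - y)),
            neg_abs_le (∑ i, ∑ j, h x i j ^ 2 - (d : ℝ))]
  have hmean := ae_all_iff.2 fun i => ae_eq_integral_mul_kernel (hhi i) (hc i) (hd i)
    (t := 1 / 16) (r := s) (by norm_num) (by linarith)
  have hgood : ∀ᵐ x ∂volume.restrict (closedBall (0 : Fin d → ℝ) s),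
      ‖h x‖ ≤ B ∧ ∫ y in closedBall 0 s, ‖h y - h x‖ ^ 2 ≤
        c⁻¹ * (M * K * δ + K * rotDist 1 (h x)) := by
    rw [ae_restrict_iff' measurableSet_closedBall]
    filter_upwards [hvar, hmean, hbd] with x h1 h2 h3 hx
    exact ⟨h3 (hsub' hx), h1 hx (fun i j => h2 i hx j) (h3 (hsub' hx))⟩
  have hne : volume.restrict (closedBall (0 : Fin d → ℝ) s) ≠ 0 := by
    rw [Ne, Measure.restrict_eq_zero]
    exact volume_closedBall_pos 0 hs0
  have : IsFiniteMeasure (volume.restrict (closedBall (0 : Fin d → ℝ) s)) :=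
    ⟨by rw [Measure.restrict_apply_univ]; exact measure_closedBall_lt_top⟩
  obtain ⟨x, hx, hxavg⟩ := exists_notMem_null_le_average hne (hrot.mono_set hsub) hgood
  obtain ⟨hxB, hxvar⟩ : ‖h x‖ ≤ B ∧ ∫ y in closedBall 0 s, ‖h y - h x‖ ^ 2 ≤
        c⁻¹ * (M * K * δ + K * rotDist 1 (h x)) := by
    by_contra hcon
    exact hx hcon
  have hxδ : rotDist 1 (h x) ≤ δ / V := by
    refine hxavg.trans ?_
    rw [setAverage_eq, smul_eq_mul, ← hV, div_eq_inv_mul]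
    gcongr
    exact setIntegral_mono_set hrot (Eventually.of_forall fun _ => rotDist_nonneg _ _)
        hsub.eventuallyLE
  obtain ⟨R, hR, hxR⟩ := exists_mem_SOset_norm_sub_eq (h x)
  refine ⟨R, hR, ?_⟩
  have hR2 : ‖h x - R‖ ^ 2 ≤ (B + 1) * (δ / V) := by
    rw [sq]
    refine mul_le_mul ((norm_sub_le _ _).trans (add_le_add hxB (norm_le_one_of_mem_SOset hR)))
      (hxR ▸ hxδ) (norm_nonneg _) (by positivity)
  have hsq : IntegrableOn (fun y => ‖h y - h x‖ ^ 2) (closedBall 0 s) := by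
    refine Measure.integrableOn_of_bounded (M := (2 * B) ^ 2) measure_closedBall_lt_top.ne
      ((hh.aestronglyMeasurable.sub aestronglyMeasurable_const).norm.pow 2) ?_
    rw [ae_restrict_iff' measurableSet_closedBall]
    filter_upwards [hbd] with y hy hys
    rw [norm_pow, norm_norm]
    have := hy (hsub' hys)
    gcongr
    exact (norm_sub_le _ _).trans (by linarith)
  have hcst : IntegrableOn (fun _ : Fin d → ℝ => 2 * ‖h x - R‖ ^ 2) (closedBall 0 s) :=
    integrableOn_const measure_closedBall_lt_top.ne
  calc ∫ y in closedBall 0 s, ‖h y - R‖ ^ 2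
      ≤ ∫ y in closedBall 0 s, (2 * ‖h y - h x‖ ^ 2 + 2 * ‖h x - R‖ ^ 2) := by
        refine integral_mono_of_nonneg (Eventually.of_forall fun _ => sq_nonneg _)
          ((hsq.const_mul 2).add hcst) (Eventually.of_forall fun y => ?_)
        have h1 := norm_sub_le_norm_sub_add_norm_sub (h y) (h x) R
        have h2 := pow_le_pow_left₀ (norm_nonneg _) h1 2
        simp only
        nlinarith [sq_nonneg (‖h y - h x‖ - ‖h x - R‖)]
    _ = 2 * (∫ y in closedBall 0 s, ‖h y - h x‖ ^ 2) + V * (2 * ‖h x - R‖ ^ 2) := by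
        rw [integral_add (hsq.const_mul 2) hcst, integral_const_mul, setIntegral_const, smul_eq_mul]
    _ ≤ 2 * (c⁻¹ * (M * K * δ + K * (δ / V))) + V * (2 * ((B + 1) * (δ / V))) := by
        gcongr
        exact hxvar.trans (by gcongr)
    _ = _ := by
        field_simp

end Linearization

section RotationEstimate

variable {d : ℕ}

theorem locallyIntegrable_eval_eval {h : (Fin d → ℝ) → Fin d → Fin d → ℝ}
    (hh : LocallyIntegrable h volume) (i j : Fin d) :
    LocallyIntegrable (fun x => h x i j) volume := fun x => by
  obtain ⟨s, hs, hs'⟩ := hh x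
  exact ⟨s, hs, (Integrable.eval hs' i).eval j⟩

theorem integral_sum_mul_mul_pd {h : (Fin d → ℝ) → Fin d → Fin d → ℝ}
    (hh : LocallyIntegrable h volume) (a : Fin d → ℝ) {φ : (Fin d → ℝ) → ℝ}
    (hφ : ContDiff ℝ ((⊤ : ℕ∞) : WithTop ℕ∞) φ) (hφc : HasCompactSupport φ) (i j : Fin d) :
    ∫ y, (∑ k, a k * h y k i) * pd j φ y = ∑ k, a k * ∫ y, h y k i * pd j φ y := by
  have hfint : ∀ k, Integrable fun y => h y k i * pd j φ y := fun k =>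
    (locallyIntegrable_eval_eval hh k i).integrable_smul_right_of_hasCompactSupport
      (g := pd j φ) (continuous_pd hφ j) (hasCompactSupport_pd hφc j)
  simp only [Finset.sum_mul, mul_assoc]
  rw [integral_finsetSum _ fun k _ => (hfint k).const_mul (a k)]
  simp only [integral_const_mul]

theorem isCurlFree_sum_mul {h : (Fin d → ℝ) → Fin d → Fin d → ℝ}
    (hh : LocallyIntegrable h volume) (hc : ∀ k, IsCurlFree fun x => h x k) (a : Fin d → ℝ) :
    IsCurlFree fun x j => ∑ k, a k * h x k j := fun φ hφ hφc i j => by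
  rw [integral_sum_mul_mul_pd hh a hφ hφc, integral_sum_mul_mul_pd hh a hφ hφc]
  exact Finset.sum_congr rfl fun k _ => by rw [hc k φ hφ hφc i j]

theorem isDivFreeOn_sum_mul {h : (Fin d → ℝ) → Fin d → Fin d → ℝ} {U : Set (Fin d → ℝ)}
    (hh : LocallyIntegrable h volume) (hc : ∀ k, IsDivFreeOn (fun x => h x k) U) (a : Fin d → ℝ) :
    IsDivFreeOn (fun x j => ∑ k, a k * h x k j) U := fun φ hφ hφc hφU => by
  simp only [integral_sum_mul_mul_pd hh a hφ hφc]
  rw [Finset.sum_comm]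
  simp only [← Finset.mul_sum]
  exact Finset.sum_eq_zero fun k _ => by rw [hc k φ hφ hφc hφU, mul_zero]

theorem norm_transpose_mul_le {R A : Fin d → Fin d → ℝ} (hR : of R ∈ SOset d 1) :
    ‖fun i j => ∑ k, R k i * A k j‖ ≤ d * ‖A‖ := by
  refine (pi_norm_le_iff_of_nonneg (by positivity)).2 fun i =>
    (pi_norm_le_iff_of_nonneg (by positivity)).2 fun j => ?_
  simpa [Matrix.mul_apply] using abs_transpose_mul_le (A := A) hR i j

theorem exists_integral_norm_sub_le_rotDist (d : ℕ) : ∃ C s : ℝ, 0 ≤ C ∧ 0 < s ∧ s ≤ 1 / 4 ∧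
    ∀ {h : (Fin d → ℝ) → Fin d → Fin d → ℝ}, LocallyIntegrable h volume →
    (∀ i, IsCurlFree fun x => h x i) → (∀ i, IsDivFreeOn (fun x => h x i) (ball 0 (1 / 4))) →
    ∃ R : Fin d → Fin d → ℝ,
      ∫ x in closedBall 0 s, ‖h x - R‖ ≤ C * ∫ x in closedBall 0 (1 / 4), rotDist 1 (h x) := by
  obtain ⟨C₀, s₀, B, hC₀, hs₀, hs₀', hB, H⟩ := exists_rotation_integral_sq_le d
  obtain ⟨M, hM, HM⟩ := exists_norm_sub_le_of_symm d (r := s₀ / 2) (t := s₀ / 2) (ρ := 1 / 4)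
    (by linarith) (by linarith) (by linarith)
  set K : ℝ := (d + d ^ 3) * (B + 2) with hK
  have hK0 : 0 ≤ K := by positivity
  refine ⟨d * (M * (K * (1 + C₀))) + 3, s₀ / 2, by positivity, by linarith, by linarith, ?_⟩
  intro h hh hc hdv
  have hfint : ∀ r : ℝ, IntegrableOn h (closedBall 0 r) := fun r =>
    hh.integrableOn_isCompact (isCompact_closedBall _ _)
  have hrot : ∀ r : ℝ, IntegrableOn (fun x => rotDist 1 (h x)) (closedBall 0 r) := fun r =>
    integrableOn_rotDist measure_closedBall_lt_top.ne (hfint r)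
  set δ := ∫ x in closedBall 0 (1 / 4), rotDist 1 (h x) with hδ
  have hδ0 : 0 ≤ δ := integral_nonneg fun x => rotDist_nonneg _ _
  have hmono : ∀ r ≤ (1 / 4 : ℝ), ∫ x in closedBall 0 r, rotDist 1 (h x) ≤ δ := fun r hr =>
    setIntegral_mono_set (hrot _) (Eventually.of_forall fun _ => rotDist_nonneg _ _)
      (closedBall_subset_closedBall hr).eventuallyLE
  rcases lt_or_ge 1 δ with h1 | h1
  · refine ⟨0, ?_⟩
    have hcst : IntegrableOn (fun _ : Fin d → ℝ => (1 : ℝ)) (closedBall 0 (s₀ / 2)) :=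
      integrableOn_const measure_closedBall_lt_top.ne
    calc ∫ x in closedBall 0 (s₀ / 2), ‖h x - 0‖
        ≤ ∫ x in closedBall 0 (s₀ / 2), (rotDist 1 (h x) + 1) := by
          refine setIntegral_mono (by simpa [IntegrableOn] using (hfint _).norm)
              ((hrot _).add hcst) fun x => ?_
          simpa using norm_le_rotDist_add_one (h x)
      _ = (∫ x in closedBall 0 (s₀ / 2), rotDist 1 (h x)) +
            volume.real (closedBall (0 : Fin d → ℝ) (s₀ / 2)) := by
          rw [integral_add (hrot _) hcst]; simp
      _ ≤ δ + 1 := add_le_add (hmono _ (by linarith))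
          (volume_real_closedBall_le_one (by linarith) (by linarith) _)
      _ ≤ _ := by
          have : 0 ≤ d * (M * (K * (1 + C₀))) * δ := by positivity
          nlinarith
  · obtain ⟨hbd, R, hR, hRint⟩ := H hh hc hdv h1
    set w : (Fin d → ℝ) → Fin d → Fin d → ℝ := fun x i j => ∑ k, R k i * h x k j with hw
    have hwc : Continuous fun (A : Fin d → Fin d → ℝ) (i j : Fin d) => ∑ k, R k i * A k j := by
      fun_prop
    have hwloc : LocallyIntegrable w volume := fun x => by
      obtain ⟨s, hs, hs'⟩ := hh x
      exact ⟨s, hs, (hs'.norm.const_mul (d : ℝ)).mono'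
        (hwc.comp_aestronglyMeasurable hs'.aestronglyMeasurable)
        (Eventually.of_forall fun x => norm_transpose_mul_le hR)⟩
    have hsq : IntegrableOn (fun x => ‖h x - R‖ ^ 2) (closedBall 0 s₀) := by
      refine Measure.integrableOn_of_bounded (M := (B + 1) ^ 2) measure_closedBall_lt_top.ne
        ((hh.aestronglyMeasurable.sub aestronglyMeasurable_const).norm.pow 2) ?_
      filter_upwards [(ae_restrict_iff' measurableSet_closedBall).2 hbd] with x hx
      rw [Real.norm_of_nonneg (by positivity)]
      gcongr
      exact (norm_sub_le _ _).trans (add_le_add hx (norm_le_one_of_mem_SOset hR))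
    obtain ⟨R', hR'⟩ := HM (w := w) hwloc (fun i => isCurlFree_sum_mul hh hc fun k => R k i)
      (fun i => isDivFreeOn_sum_mul hh hdv fun k => R k i)
      (fun i j => (1 : Matrix (Fin d) (Fin d) ℝ) i j) (A := K * (1 + C₀) * δ) (by positivity) <| by
        intro i j
        rw [add_halves]
        calc _ ≤ ∫ x in closedBall 0 s₀, K * (rotDist 1 (h x) + ‖h x - R‖ ^ 2) := by
              refine integral_mono_of_nonneg (Eventually.of_forall fun x => abs_nonneg _)
                (((hrot _).add hsq).const_mul _) ?_
              filter_upwards [(ae_restrict_iff' measurableSet_closedBall).2 hbd] with x hx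
              simpa [hw, Matrix.mul_apply, hK] using abs_symm_transpose_mul_sub_one_le hB hx hR i j
          _ ≤ K * (δ + C₀ * δ) := by
              rw [integral_const_mul, integral_add (hrot _) hsq]
              gcongr
              exact hmono _ (by linarith)
          _ = _ := by ring
    refine ⟨fun i j => ∑ k, R i k * R' k j, ?_⟩
    have hRT : of (fun i j => R j i) ∈ SOset d 1 := by
      have h1 : of (fun i j => R j i) = (of R)ᵀ := rfl
      rw [h1]
      refine ⟨?_, by rw [det_transpose]; exact hR.2⟩
      rw [transpose_transpose]
      exact mul_eq_one_comm.1 hR.1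
    have hpt : ∀ x, ‖h x - fun i j => ∑ k, R i k * R' k j‖ ≤ d * ‖w x - R'‖ := fun x => by
      have h2 := norm_transpose_mul_le (A := w x - R') hRT
      convert h2 using 2
      have hRR : of R * (of R)ᵀ = 1 := mul_eq_one_comm.1 hR.1
      have h3 : of (h x) - of R * of R' = of R * ((of R)ᵀ * of (h x) - of R') := by
        rw [Matrix.mul_sub, ← Matrix.mul_assoc, hRR, Matrix.one_mul]
      ext i j
      have h4 := congrFun (congrFun h3 i) j
      simpa [Matrix.mul_apply, hw] using h4
    calc _ ≤ ∫ x in closedBall (0 : Fin d → ℝ) (s₀ / 2), d * (M * (K * (1 + C₀) * δ)) := by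
          refine integral_mono_of_nonneg (Eventually.of_forall fun x => norm_nonneg _)
            (integrableOn_const measure_closedBall_lt_top.ne) ?_
          filter_upwards [(ae_restrict_iff' measurableSet_closedBall).2 hR'] with x hx
          exact (hpt x).trans (by gcongr)
      _ = volume.real (closedBall (0 : Fin d → ℝ) (s₀ / 2)) * (d * (M * (K * (1 + C₀) * δ))) := by
          simp
      _ ≤ 1 * (d * (M * (K * (1 + C₀) * δ))) := by
          gcongr
          exact volume_real_closedBall_le_one (by linarith) (by linarith) _
      _ ≤ _ := by nlinarith

end RotationEstimate

section HelmholtzSplitting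

variable {d : ℕ}

/-- The Jacobian matrix as an element of the normed space `Fin d → Fin d → ℝ`. -/
noncomputable def grad (u : (Fin d → ℝ) → Fin d → ℝ) (x : Fin d → ℝ) : Fin d → Fin d → ℝ :=
  fun i j => jac u x i j

theorem measurable_grad (u : (Fin d → ℝ) → Fin d → ℝ) : Measurable (grad u) :=
  measurable_pi_iff.2 fun i => measurable_pi_iff.2 fun j => measurable_jac u i j

theorem norm_grad_le (u : (Fin d → ℝ) → Fin d → ℝ) (x : Fin d → ℝ) :
    ‖grad u x‖ ≤ ‖fderiv ℝ u x‖ :=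
  (pi_norm_le_iff_of_nonneg (norm_nonneg _)).2 fun i =>
    (pi_norm_le_iff_of_nonneg (norm_nonneg _)).2 fun j => abs_jac_le u x i j

theorem norm_fderiv_le_grad (u : (Fin d → ℝ) → Fin d → ℝ) (x : Fin d → ℝ) :
    ‖fderiv ℝ u x‖ ≤ d * ‖grad u x‖ :=
  opNorm_le_of_forall_single _ (norm_nonneg _) fun k =>
    (pi_norm_le_iff_of_nonneg (norm_nonneg _)).2 fun i =>
      (norm_le_pi_norm (grad u x i) k).trans (norm_le_pi_norm (grad u x) i)

theorem grad_eq_of_fderiv_eq {u v : (Fin d → ℝ) → Fin d → ℝ} {x : Fin d → ℝ}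
    (h : fderiv ℝ u x = fderiv ℝ v x) : grad u x = grad v x := by
  unfold grad jac
  rw [h]

theorem norm_grad_le_of_lipschitz {v : (Fin d → ℝ) → Fin d → ℝ} {L : ℝ≥0} (hv : LipschitzWith L v)
    (x : Fin d → ℝ) : ‖grad v x‖ ≤ L :=
  (norm_grad_le v x).trans (norm_fderiv_le_of_lipschitz ℝ hv)

theorem isCurlFree_grad {v : (Fin d → ℝ) → Fin d → ℝ} {L : ℝ≥0} (hv : LipschitzWith L v)
    (i : Fin d) : IsCurlFree fun x => grad v x i := by
  have hvi : LipschitzWith L fun x => v x i := fun x y =>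
    (edist_le_pi_edist (v x) (v y) i).trans (hv x y)
  have hae : ∀ᵐ x, ∀ j, grad v x i j = pd j (fun x => v x i) x := by
    filter_upwards [hv.ae_differentiableAt] with x hx j
    have h := (hasFDerivAt_pi'.1 hx.hasFDerivAt i).fderiv
    rw [pd, h]
    rfl
  intro φ hφ hφc j k
  have h := isCurlFree_gradient hvi φ hφ hφc j k
  calc _ = ∫ y, pd j (fun x => v x i) y * pd k φ y :=
        integral_congr_ae (hae.mono fun x hx => by simp only [hx])
    _ = ∫ y, pd k (fun x => v x i) y * pd j φ y := h
    _ = _ := integral_congr_ae (hae.mono fun x hx => by simp only [hx])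

theorem locallyIntegrable_of_norm_le {E : Type*} [NormedAddCommGroup E]
    {f : (Fin d → ℝ) → E} (hf : AEStronglyMeasurable f volume) {M : ℝ} (hM : ∀ x, ‖f x‖ ≤ M) :
    LocallyIntegrable f volume := fun x =>
  ⟨closedBall x 1, closedBall_mem_nhds x one_pos,
    Measure.integrableOn_of_bounded (M := M) measure_closedBall_lt_top.ne hf
      (Eventually.of_forall hM)⟩

theorem exists_curlFree_divFree_approx (d : ℕ) {q : ℝ} (hq : 1 < q) (L : ℝ≥0) : ∃ C : ℝ≥0,
    ∀ {v : (Fin d → ℝ) → Fin d → ℝ}, LipschitzWith L v →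
    ∃ h : (Fin d → ℝ) → Fin d → Fin d → ℝ, LocallyIntegrable h volume ∧
      (∀ i, IsCurlFree fun x => h x i) ∧ (∀ i, IsDivFreeOn (fun x => h x i) (ball 0 (1 / 4))) ∧
      ∫⁻ x in closedBall 0 (1 / 4), ‖h x - grad v x‖ₑ ≤
        C * (∫⁻ x in closedBall 0 (1 / 4),
            ENNReal.ofReal (rotDist 1 (grad v x)) ^ q) ^ (1 / q) := by
  obtain ⟨C, hC⟩ := exists_lintegral_gradProj_le d hq
  obtain ⟨K, hK⟩ := exists_abs_sub_adjugate_le d L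
  refine ⟨d * (C * K), fun {v} hv => ?_⟩
  set Q : Set (Fin d → ℝ) := closedBall 0 (1 / 4) with hQ
  have hvol : volume Q ≤ 1 := by
    rw [hQ, volume_closedBall _ (by norm_num)]
    exact ENNReal.ofReal_le_one.2 (pow_le_one₀ (by norm_num) (by norm_num))
  set F : Fin d → (Fin d → ℝ) → Fin d → ℝ := fun i =>
    Q.indicator fun x j => grad v x i j - (jac v x).adjugate j i with hF
  have hFm : ∀ i, Measurable (F i) := fun i => by
    refine Measurable.indicator (measurable_pi_iff.2 fun j => ?_) measurableSet_closedBall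
    exact (measurable_jac v i j).sub (measurable_adjugate (measurable_jac v) j i)
  have hFle : ∀ i x, ‖F i x‖ ≤ K * rotDist 1 (grad v x) := fun i x => by
    have h0 : 0 ≤ K * rotDist 1 (grad v x) := mul_nonneg K.2 (rotDist_nonneg _ _)
    by_cases hx : x ∈ Q
    · rw [hF]
      simp only [indicator_of_mem hx]
      exact (pi_norm_le_iff_of_nonneg h0).2 fun j => hK _ (norm_grad_le_of_lipschitz hv x) i j
    · rw [hF]
      simp only [indicator_of_notMem hx, norm_zero]
      exact h0
  have hF2 : ∀ i, MemLp (F i) 2 volume := fun i => by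
    have hind : Q.indicator (F i) = F i := by
      rw [hF]; simp only [indicator_indicator, inter_self]
    rw [← hind, memLp_indicator_iff_restrict measurableSet_closedBall]
    have : IsFiniteMeasure (volume.restrict Q) := ⟨by simpa using measure_closedBall_lt_top⟩
    refine MemLp.of_bound (hFm i).aestronglyMeasurable (K * (L + 1))
        (Eventually.of_forall fun x => ?_)
    refine (hFle i x).trans ?_
    gcongr
    exact (rotDist_le_norm_add_one _).trans (by gcongr; exact norm_grad_le_of_lipschitz hv x)
  have hgl : ∀ i, LocallyIntegrable (fun x => grad v x i) volume := fun i =>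
    locallyIntegrable_of_norm_le
      ((measurable_pi_apply i).comp (measurable_grad v)).aestronglyMeasurable
      fun x => (norm_le_pi_norm _ i).trans (norm_grad_le_of_lipschitz hv x)
  have hpl : ∀ i, LocallyIntegrable (gradProj (F i)) volume := fun i =>
    locallyIntegrable_gradProj (hF2 i)
  refine ⟨fun x i => grad v x i - gradProj (F i) x, ?_, fun i => ?_, fun i => ?_, ?_⟩
  · intro x
    choose s hs hs' using fun i => ((hgl i).sub (hpl i)) x
    exact ⟨⋂ i, s i, iInter_mem.2 hs, Integrable.of_eval fun i =>
      (hs' i).mono_set (iInter_subset _ i)⟩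
  · exact (isCurlFree_grad hv i).sub (hgl i) (hpl i) (isCurlFree_gradProj (hF2 i))
  · intro φ hφ hφc hφQ
    have hfint : ∀ {h : (Fin d → ℝ) → Fin d → ℝ}, LocallyIntegrable h volume → ∀ j,
        Integrable fun y => h y j * pd j φ y := fun {h} hh j => by
      have hj : LocallyIntegrable (fun y => h y j) volume := fun x => by
        obtain ⟨s, hs, hs'⟩ := hh x
        exact ⟨s, hs, Integrable.eval hs' j⟩
      exact hj.integrable_smul_right_of_hasCompactSupport (g := pd j φ) (continuous_pd hφ j)
        (hasCompactSupport_pd hφc j)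
    have h1 : ∀ j, ∫ y, (grad v y i - gradProj (F i) y) j * pd j φ y =
        (∫ y, grad v y i j * pd j φ y) - ∫ y, gradProj (F i) y j * pd j φ y := fun j => by
      rw [← integral_sub (hfint (hgl i) j) (hfint (hpl i) j)]
      simp only [Pi.sub_apply, sub_mul]
    have h2 : ∀ j, ∫ y, (jac v y).adjugate j i * pd j φ y =
        (∫ y, grad v y i j * pd j φ y) - ∫ y, F i y j * pd j φ y := fun j => by
      rw [← integral_sub (hfint (hgl i) j)
        (hfint ((hF2 i).locallyIntegrable (by norm_num)) j)]
      refine integral_congr_ae (Eventually.of_forall fun y => ?_)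
      by_cases hy : y ∈ Q
      · simp only [hF, indicator_of_mem hy]
        ring
      · have : pd j φ y = 0 := pd_eq_zero_of_notMem (fun h =>
          hy (ball_subset_closedBall (hφQ h))) j
        simp [this]
    have h3 := isDivFreeOn_adjugate_jac hv i (ball 0 (1 / 4)) φ hφ hφc hφQ
    simp only [h2] at h3
    simp only [h1]
    rw [Finset.sum_sub_distrib, sum_integral_gradProj_mul_pd (hF2 i) hφ hφc,
      ← Finset.sum_sub_distrib]
    exact h3
  · set I := (∫⁻ x in Q, ENNReal.ofReal (rotDist 1 (grad v x)) ^ q) ^ (1 / q) with hI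
    have h1 : ∀ i, ∫⁻ x in Q, ‖gradProj (F i) x‖ₑ ≤ C * K * I := fun i => by
      refine (hC 0 (1 / 4) (by norm_num) (hF2 i) fun x hx => indicator_of_notMem hx _).trans ?_
      rw [mul_assoc]
      refine mul_le_mul_right ?_ _
      have h2 : (∫⁻ x in Q, ‖F i x‖ₑ ^ q) ^ (1 / q) ≤ K * I := by
        calc (∫⁻ x in Q, ‖F i x‖ₑ ^ q) ^ (1 / q)
            ≤ (∫⁻ x in Q,
                (K : ℝ≥0∞) ^ q * ENNReal.ofReal (rotDist 1 (grad v x)) ^ q) ^ (1 / q) := by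
              refine ENNReal.rpow_le_rpow (lintegral_mono fun x => ?_) (by positivity)
              rw [← ENNReal.mul_rpow_of_nonneg _ _ (by linarith)]
              refine ENNReal.rpow_le_rpow ?_ (by linarith)
              rw [← ofReal_norm, ← ENNReal.ofReal_coe_nnreal, ← ENNReal.ofReal_mul K.coe_nonneg]
              exact ENNReal.ofReal_le_ofReal (hFle i x)
          _ = K * I := by
              rw [lintegral_const_mul' _ _ (ENNReal.rpow_ne_top_of_nonneg (by linarith)
                ENNReal.coe_ne_top), ENNReal.mul_rpow_of_nonneg _ _ (by positivity),
                ← ENNReal.rpow_mul, mul_one_div_cancel (by linarith), ENNReal.rpow_one]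
      calc _ ≤ 1 * (K * I) := mul_le_mul'
            (ENNReal.rpow_le_one hvol (one_sub_one_div_nonneg hq)) h2
        _ = _ := one_mul _
    calc ∫⁻ x in Q, ‖(fun i => grad v x i - gradProj (F i) x) - grad v x‖ₑ
        ≤ ∫⁻ x in Q, ∑ i, ‖gradProj (F i) x‖ₑ := by
          refine lintegral_mono fun x => ?_
          have h2 : (fun i => grad v x i - gradProj (F i) x) - grad v x =
              -∑ i, Pi.single i (gradProj (F i) x) := by
            rw [Finset.univ_sum_single]
            ext i j
            simp
          rw [h2, enorm_neg]
          refine (enorm_sum_le _ _).trans (Finset.sum_le_sum fun i _ => ?_)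
          rw [enorm_le_iff_norm_le, Pi.norm_single]
      _ = ∑ i, ∫⁻ x in Q, ‖gradProj (F i) x‖ₑ :=
          lintegral_finsetSum' _ fun i _ => (hpl i).aestronglyMeasurable.enorm.restrict
      _ ≤ ∑ _i : Fin d, C * K * I := Finset.sum_le_sum fun i _ => h1 i
      _ = _ := by simp [mul_assoc]

end HelmholtzSplitting

section LocalRigidity

variable {d : ℕ}

theorem enorm_le_ofReal_rotDist_add_one (A : Fin d → Fin d → ℝ) :
    ‖A‖ₑ ≤ ENNReal.ofReal (rotDist 1 A) + 1 := by
  rw [← ofReal_norm, ← ENNReal.ofReal_one, ← ENNReal.ofReal_add (rotDist_nonneg _ _) zero_le_one]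
  exact ENNReal.ofReal_le_ofReal (norm_le_rotDist_add_one A)

theorem ofReal_rotDist_le_add (G : Matrix (Fin d) (Fin d) ℝ) (A B : Fin d → Fin d → ℝ) :
    ENNReal.ofReal (rotDist G A) ≤ ENNReal.ofReal (rotDist G B) + ‖A - B‖ₑ := by
  rw [← ofReal_norm, ← ENNReal.ofReal_add (rotDist_nonneg _ _) (norm_nonneg _)]
  refine ENNReal.ofReal_le_ofReal ?_
  have h := (lipschitzWith_rotDist G).dist_le_mul A B
  rw [NNReal.coe_one, one_mul, Real.dist_eq, dist_eq_norm] at h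
  linarith [le_abs_self (rotDist G A - rotDist G B)]

theorem volume_closedBall_le_one {r : ℝ} (hr : 0 ≤ r) (hr' : r ≤ 1 / 2) (c : Fin d → ℝ) :
    volume (closedBall c r) ≤ 1 := by
  rw [volume_closedBall _ hr]
  exact ENNReal.ofReal_le_one.2 (pow_le_one₀ (by linarith) (by linarith))

theorem exists_lintegral_grad_sub_le (d : ℕ) {q : ℝ} (hq : 1 < q) : ∃ (C : ℝ≥0) (s : ℝ),
    0 < s ∧ s ≤ 1 / 4 ∧ ∀ {u : (Fin d → ℝ) → Fin d → ℝ} {U : Set (Fin d → ℝ)}, IsOpen U →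
    closedBall 0 1 ⊆ U → ContDiffOn ℝ 1 u U → ∃ R : Fin d → Fin d → ℝ,
      ∫⁻ x in closedBall 0 s, ‖grad u x - R‖ₑ ≤
        C * (∫⁻ x in closedBall 0 1, ENNReal.ofReal (rotDist 1 (grad u x)) ^ q) ^ (1 / q) := by
  set L : ℝ≥0 := 2 ^ d * 2 * (d * 2) with hL
  obtain ⟨C₁, s, hC₁, hs, hs', H₁⟩ := exists_integral_norm_sub_le_rotDist d
  obtain ⟨C₂, H₂⟩ := exists_curlFree_divFree_approx d hq L
  have hq0 : 0 < q := by linarith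
  set M : ℝ≥0 := (1 + (L + 1) ^ q * 4 ^ d) ^ (1 / q) with hM
  set C₃ : ℝ≥0 := C₂ * M + ((L + 1) * 4 ^ d + 1) with hC₃
  refine ⟨C₁.toNNReal * (1 + C₃) + C₃ + 2, s, hs, hs', fun {u U} hU hsub hu => ?_⟩
  set g : (Fin d → ℝ) → ℝ≥0 := fun x => (rotDist 1 (grad u x)).toNNReal with hg
  have hgm : Measurable g :=
    ((lipschitzWith_rotDist 1).continuous.measurable.comp (measurable_grad u)).real_toNNReal
  change ∃ R : Fin d → Fin d → ℝ, ∫⁻ x in closedBall 0 s, ‖grad u x - R‖ₑ ≤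
    _ * (∫⁻ x in closedBall 0 1, (g x : ℝ≥0∞) ^ q) ^ (1 / q)
  set J := ∫⁻ x in closedBall 0 1, (g x : ℝ≥0∞) ^ q with hJ
  have hgle : ∀ r ≤ (1 / 4 : ℝ), 0 ≤ r → ∫⁻ x in closedBall 0 r, (g x : ℝ≥0∞) ≤ J ^ (1 / q) :=
    fun r hr hr0 => by
      refine (lintegral_le_holderBound hgm hq _).trans ?_
      calc _ ≤ 1 * J ^ (1 / q) := mul_le_mul' (ENNReal.rpow_le_one
              (volume_closedBall_le_one hr0 (by linarith) _) (one_sub_one_div_nonneg hq))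
            (ENNReal.rpow_le_rpow (lintegral_mono_set
              (closedBall_subset_closedBall (by linarith))) (by positivity))
        _ = _ := one_mul _
  have hgrad : ∀ x, ‖grad u x‖ₑ ≤ g x + 1 := fun x => enorm_le_ofReal_rotDist_add_one _
  rcases lt_or_ge 1 (J ^ (1 / q)) with h1 | h1
  · refine ⟨0, ?_⟩
    calc ∫⁻ x in closedBall 0 s, ‖grad u x - 0‖ₑ
        ≤ ∫⁻ x in closedBall 0 s, ((g x : ℝ≥0∞) + 1) :=
          lintegral_mono fun x => by rw [sub_zero]; exact hgrad x
      _ = (∫⁻ x in closedBall 0 s, (g x : ℝ≥0∞)) + volume (closedBall (0 : Fin d → ℝ) s) := by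
          rw [lintegral_add_left hgm.coe_nnreal_ennreal]; simp
      _ ≤ J ^ (1 / q) + J ^ (1 / q) := add_le_add (hgle s hs' hs.le)
          ((volume_closedBall_le_one hs.le (by linarith) _).trans h1.le)
      _ = 2 * J ^ (1 / q) := (two_mul _).symm
      _ ≤ _ := mul_le_mul_left (by push_cast; exact le_add_self) _
  · have hJ1 : J ≤ 1 := by
      have := ENNReal.rpow_le_one h1 hq0.le
      rwa [← ENNReal.rpow_mul, one_div_mul_cancel hq0.ne', ENNReal.rpow_one] at this
    have hJle : J ≤ J ^ (1 / q) := by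
      conv_lhs => rw [← ENNReal.rpow_one J]
      exact ENNReal.rpow_le_rpow_of_exponent_ge hJ1 ((div_le_one hq0).2 hq.le)
    obtain ⟨v, hv, N, hN, hNvol, hvu⟩ := exists_lipschitz_truncation hq hU hsub hu hgm fun x _ =>
      (norm_fderiv_le_grad u x).trans (by
        gcongr
        rw [hg, Real.coe_toNNReal _ (rotDist_nonneg _ _)]
        exact norm_le_rotDist_add_one _)
    obtain ⟨h, hh, hhc, hhd, hhv⟩ := H₂ hv
    set Q : Set (Fin d → ℝ) := closedBall 0 (1 / 4) with hQ
    have hgv : ∫⁻ x in Q, ENNReal.ofReal (rotDist 1 (grad v x)) ^ q ≤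
        (1 + (L + 1) ^ q * 4 ^ d) * J := by
      calc _ ≤ ∫⁻ x in Q, ((g x : ℝ≥0∞) ^ q + N.indicator (fun _ => ((L : ℝ≥0∞) + 1) ^ q) x) := by
            refine lintegral_mono_ae ?_
            filter_upwards [(ae_restrict_iff' measurableSet_closedBall).2 hvu] with x hx
            by_cases hxN : x ∈ N
            · rw [indicator_of_mem hxN]
              refine le_add_left (ENNReal.rpow_le_rpow ?_ hq0.le)
              rw [← ENNReal.ofReal_coe_nnreal, ← ENNReal.ofReal_one,
                ← ENNReal.ofReal_add L.coe_nonneg zero_le_one]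
              refine ENNReal.ofReal_le_ofReal ((rotDist_le_norm_add_one _).trans ?_)
              gcongr
              exact norm_grad_le_of_lipschitz hv x
            · rw [grad_eq_of_fderiv_eq (hx hxN)]
              exact le_self_add
        _ ≤ J + ((L : ℝ≥0∞) + 1) ^ q * (4 ^ d * J) := by
            rw [lintegral_add_left (hgm.coe_nnreal_ennreal.pow_const q)]
            refine add_le_add (lintegral_mono_set (closedBall_subset_closedBall (by norm_num))) ?_
            rw [lintegral_indicator_const hN]
            exact mul_le_mul_right ((Measure.restrict_apply_le _ _).trans hNvol) _
        _ = _ := by ring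
    have hhv' : ∫⁻ x in Q, ‖h x - grad v x‖ₑ ≤ C₂ * M * J ^ (1 / q) := by
      refine hhv.trans ?_
      rw [mul_assoc]
      refine mul_le_mul_right ((ENNReal.rpow_le_rpow hgv (by positivity)).trans_eq ?_) _
      rw [ENNReal.mul_rpow_of_nonneg _ _ (by positivity), hM,
        ENNReal.coe_rpow_of_nonneg _ (by positivity)]
      push_cast
      rw [ENNReal.coe_rpow_of_nonneg _ hq0.le]
      push_cast
      rfl
    have hvu' : ∫⁻ x in Q, ‖grad v x - grad u x‖ₑ ≤ ((L + 1) * 4 ^ d + 1) * J ^ (1 / q) := by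
      calc _ ≤ ∫⁻ x in Q, (N.indicator (fun _ => (L : ℝ≥0∞) + 1) x + (g x : ℝ≥0∞)) := by
            refine lintegral_mono_ae ?_
            filter_upwards [(ae_restrict_iff' measurableSet_closedBall).2 hvu] with x hx
            by_cases hxN : x ∈ N
            · rw [indicator_of_mem hxN, add_assoc, add_comm 1]
              refine (enorm_sub_le).trans (add_le_add ?_ (hgrad x))
              rw [← ofReal_norm, ← ENNReal.ofReal_coe_nnreal]
              exact ENNReal.ofReal_le_ofReal (norm_grad_le_of_lipschitz hv x)
            · rw [grad_eq_of_fderiv_eq (hx hxN), sub_self, enorm_zero]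
              exact zero_le
        _ ≤ (L + 1) * (4 ^ d * J ^ (1 / q)) + J ^ (1 / q) := by
            rw [lintegral_add_right _ hgm.coe_nnreal_ennreal]
            refine add_le_add ?_ (hgle _ le_rfl (by norm_num))
            rw [lintegral_indicator_const hN]
            exact mul_le_mul_right ((Measure.restrict_apply_le _ _).trans
              (hNvol.trans (mul_le_mul_right hJle _))) _
        _ = _ := by ring
    have hhu : ∫⁻ x in Q, ‖h x - grad u x‖ₑ ≤ C₃ * J ^ (1 / q) := by
      calc _ ≤ ∫⁻ x in Q, (‖h x - grad v x‖ₑ + ‖grad v x - grad u x‖ₑ) :=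
            lintegral_mono fun x => by
              rw [← sub_add_sub_cancel (h x) (grad v x) (grad u x)]
              exact enorm_add_le _ _
        _ ≤ C₂ * M * J ^ (1 / q) + ((L + 1) * 4 ^ d + 1) * J ^ (1 / q) := by
            have hm : Measurable fun x => ‖grad v x - grad u x‖ₑ :=
              ((measurable_grad v).sub (measurable_grad u)).enorm
            rw [lintegral_add_right _ hm]
            exact add_le_add hhv' hvu'
        _ = _ := by rw [hC₃]; push_cast; ring
    have hrot : ∫⁻ x in Q, ENNReal.ofReal (rotDist 1 (h x)) ≤ (1 + C₃) * J ^ (1 / q) := by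
      calc _ ≤ ∫⁻ x in Q, ((g x : ℝ≥0∞) + ‖h x - grad u x‖ₑ) :=
            lintegral_mono fun x => ofReal_rotDist_le_add 1 _ _
        _ ≤ J ^ (1 / q) + C₃ * J ^ (1 / q) := by
            rw [lintegral_add_left hgm.coe_nnreal_ennreal]
            exact add_le_add (hgle _ le_rfl (by norm_num)) hhu
        _ = _ := by ring
    obtain ⟨R, hR⟩ := H₁ hh hhc hhd
    refine ⟨R, ?_⟩
    have hfint : ∀ r : ℝ, IntegrableOn h (closedBall 0 r) := fun r =>
      hh.integrableOn_isCompact (isCompact_closedBall _ _)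
    have hhR : ∫⁻ x in closedBall 0 s, ‖h x - R‖ₑ ≤ C₁.toNNReal * ((1 + C₃) * J ^ (1 / q)) := by
      have hc : IntegrableOn (fun _ : Fin d → ℝ => R) (closedBall 0 s) :=
        integrableOn_const measure_closedBall_lt_top.ne
      refine (ofReal_integral_norm_eq_lintegral_enorm ((hfint s).sub hc)).symm.trans_le ?_
      refine (ENNReal.ofReal_le_ofReal hR).trans ?_
      rw [ENNReal.ofReal_mul hC₁, ofReal_integral_eq_lintegral_ofReal
        (integrableOn_rotDist measure_closedBall_lt_top.ne (hfint _))
        (Eventually.of_forall fun x => rotDist_nonneg _ _)]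
      exact mul_le_mul_right hrot _
    calc _ ≤ ∫⁻ x in closedBall 0 s, (‖h x - R‖ₑ + ‖h x - grad u x‖ₑ) :=
          lintegral_mono fun x => by
            rw [← sub_sub_sub_cancel_left R (grad u x) (h x)]
            exact enorm_sub_le
      _ ≤ C₁.toNNReal * ((1 + C₃) * J ^ (1 / q)) + C₃ * J ^ (1 / q) := by
          have hm : AEMeasurable (fun x => ‖h x - R‖ₑ) (volume.restrict (closedBall 0 s)) :=
            (hh.aestronglyMeasurable.sub aestronglyMeasurable_const).enorm.restrict
          rw [lintegral_add_left' hm]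
          exact add_le_add hhR ((lintegral_mono_set (closedBall_subset_closedBall hs')).trans hhu)
      _ = ((C₁.toNNReal * (1 + C₃) + C₃ : ℝ≥0) : ℝ≥0∞) * J ^ (1 / q) := by push_cast; ring
      _ ≤ _ := mul_le_mul_left (by exact_mod_cast le_self_add) _

end LocalRigidity

section AffineChange

variable {d : ℕ}

theorem norm_mulVec_le {A : Matrix (Fin d) (Fin d) ℝ} {B : ℝ} (hB : 0 ≤ B) (hA : ∀ i j, |A i j| ≤ B)
    (y : Fin d → ℝ) : ‖A *ᵥ y‖ ≤ d * B * ‖y‖ := by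
  refine (pi_norm_le_iff_of_nonneg (by positivity)).2 fun i => ?_
  rw [mulVec, dotProduct]
  refine (norm_sum_le _ _).trans ((Finset.sum_le_sum fun k _ => ?_).trans_eq
    (b := ∑ _k : Fin d, B * ‖y‖) (by simp [mul_assoc]))
  rw [norm_mul]
  exact mul_le_mul (hA i k) (norm_le_pi_norm y k) (norm_nonneg _) hB

theorem norm_mul_le_of_abs_le {A : Matrix (Fin d) (Fin d) ℝ} {B : ℝ} (hB : 0 ≤ B)
    (hA : ∀ i j, |A i j| ≤ B) (M : Fin d → Fin d → ℝ) :
    ‖fun i j => (of M * A) i j‖ ≤ d * B * ‖M‖ := by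
  refine (pi_norm_le_iff_of_nonneg (by positivity)).2 fun i =>
    (pi_norm_le_iff_of_nonneg (by positivity)).2 fun j => ?_
  rw [mul_apply]
  refine (norm_sum_le _ _).trans ((Finset.sum_le_sum fun k _ => ?_).trans_eq
    (b := ∑ _k : Fin d, ‖M‖ * B) (by simp; ring))
  rw [norm_mul]
  exact mul_le_mul ((norm_le_pi_norm (M i) k).trans (norm_le_pi_norm M i)) (hA k j)
    (norm_nonneg _) (norm_nonneg _)

theorem exists_mem_SOset_rotDist_eq {G : Matrix (Fin d) (Fin d) ℝ} (hG : 0 < G.det)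
    (hne : (SOset d G).Nonempty) (M : Fin d → Fin d → ℝ) :
    ∃ R : Fin d → Fin d → ℝ, of R ∈ SOset d G ∧ rotDist G M = ‖M - R‖ := by
  obtain ⟨R, hR, h⟩ := (isCompact_SOset hG).exists_infDist_eq_dist (α := Fin d → Fin d → ℝ) hne M
  exact ⟨R, hR, h.trans (dist_eq_norm (E := Fin d → Fin d → ℝ) _ _)⟩

theorem det_pos_of_mem_SOset {G A : Matrix (Fin d) (Fin d) ℝ} (hA : A ∈ SOset d G) :
    0 < G.det := by
  rw [← det_sq_of_mem_SOset hA]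
  exact pow_pos hA.2 2

theorem mul_inv_mem_SOset_one {G A R : Matrix (Fin d) (Fin d) ℝ} (hA : A ∈ SOset d G)
    (hR : R ∈ SOset d G) : R * A⁻¹ ∈ SOset d 1 := by
  have hu : IsUnit A.det := hA.2.ne'.isUnit
  refine ⟨?_, ?_⟩
  · rw [transpose_mul, Matrix.mul_assoc, ← Matrix.mul_assoc Rᵀ, hR.1, ← hA.1, Matrix.mul_assoc,
      mul_nonsing_inv _ hu, Matrix.mul_one, ← transpose_mul, mul_nonsing_inv _ hu, transpose_one]
  · rw [det_mul, det_nonsing_inv, Ring.inverse_eq_inv']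
    exact mul_pos hR.2 (inv_pos.2 hA.2)

theorem rotDist_one_mul_inv_le {G A : Matrix (Fin d) (Fin d) ℝ} (hA : A ∈ SOset d G) {B : ℝ}
    (hB : 0 ≤ B) (hA' : ∀ i j, |A⁻¹ i j| ≤ B) (M : Fin d → Fin d → ℝ) :
    rotDist 1 (fun i j => (of M * A⁻¹) i j) ≤ d * B * rotDist G M := by
  obtain ⟨R, hR, h⟩ := exists_mem_SOset_rotDist_eq (det_pos_of_mem_SOset hA) ⟨A, hA⟩ M
  rw [h]
  refine (infDist_le_dist_of_mem (α := Fin d → Fin d → ℝ) (mul_inv_mem_SOset_one hA hR)).trans ?_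
  refine le_trans (le_of_eq ?_) (norm_mul_le_of_abs_le hB hA' (M - R))
  refine (dist_eq_norm (E := Fin d → Fin d → ℝ) _ _).trans (congrArg _ ?_)
  ext i j
  change (of M * A⁻¹) i j - (of R * A⁻¹) i j = (of (M - R) * A⁻¹) i j
  simp [mul_apply, sub_mul]

theorem lintegral_image_add_mulVec {A : Matrix (Fin d) (Fin d) ℝ} (hA : A.det ≠ 0)
    (c : Fin d → ℝ) {S : Set (Fin d → ℝ)} (hS : MeasurableSet S) (f : (Fin d → ℝ) → ℝ≥0∞) :
    ∫⁻ x in (fun y => c + A *ᵥ y) '' S, f x =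
      ENNReal.ofReal |A.det| * ∫⁻ y in S, f (c + A *ᵥ y) := by
  have hder : ∀ y ∈ S, HasFDerivWithinAt (fun y => c + A *ᵥ y)
      (LinearMap.toContinuousLinearMap (toLin' A)) S y := fun y _ =>
    ((LinearMap.toContinuousLinearMap (toLin' A)).hasFDerivAt.const_add c).hasFDerivWithinAt
  have hinj : InjOn (fun y => c + A *ᵥ y) S := fun y _ z _ h =>
    mulVec_injective_of_isUnit ((isUnit_iff_isUnit_det A).2 hA.isUnit) (add_left_cancel h)
  rw [lintegral_image_eq_lintegral_abs_det_fderiv_mul volume hS hder hinj,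
    ← lintegral_const_mul' _ _ ENNReal.ofReal_ne_top]
  have hdet : (LinearMap.toContinuousLinearMap (toLin' A)).det = A.det := by
    rw [ContinuousLinearMap.det, LinearMap.coe_toContinuousLinearMap, LinearMap.det_toLin']
  rw [hdet]

theorem jac_comp_add_mulVec {u : (Fin d → ℝ) → Fin d → ℝ} {A : Matrix (Fin d) (Fin d) ℝ}
    {ρ : ℝ} (hρ : ρ ≠ 0) {c y : Fin d → ℝ}
    (hu : DifferentiableAt ℝ u (c + (ρ • A) *ᵥ y)) :
    jac (fun y => ρ⁻¹ • u (c + (ρ • A) *ᵥ y)) y = jac u (c + (ρ • A) *ᵥ y) * A := by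
  have h1 : HasFDerivAt (fun y => c + (ρ • A) *ᵥ y)
      (LinearMap.toContinuousLinearMap (toLin' (ρ • A))) y :=
    (LinearMap.toContinuousLinearMap (toLin' (ρ • A))).hasFDerivAt.const_add c
  have h2 := (hu.hasFDerivAt.comp y h1).const_smul ρ⁻¹
  ext i j
  have h3 : fderiv ℝ (fun y => ρ⁻¹ • u (c + (ρ • A) *ᵥ y)) y = _ := h2.fderiv
  have h4 : (toLin' (ρ • A)) (Pi.single j 1) = ρ • ∑ k, A k j • (Pi.single k 1 : Fin d → ℝ) := by
    ext k
    simp [toLin'_apply, Finset.sum_apply, Pi.single_apply]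
  rw [jac, of_apply, h3, mul_apply]
  change ρ⁻¹ * fderiv ℝ u (c + (ρ • A) *ᵥ y) ((toLin' (ρ • A)) (Pi.single j 1)) i = _
  rw [h4, map_smul, map_sum, Pi.smul_apply, Finset.sum_apply, smul_eq_mul, inv_mul_cancel_left₀ hρ]
  refine Finset.sum_congr rfl fun k _ => ?_
  rw [map_smul, Pi.smul_apply, smul_eq_mul, mul_comm]
  rfl

theorem exists_lintegral_grad_sub_le_holderBound (d : ℕ) {q : ℝ} (hq : 1 < q) {B : ℝ} (hB : 0 ≤ B) :
    ∃ (κ : ℕ) (K : ℝ≥0), 1 ≤ κ ∧ ∀ {G A : Matrix (Fin d) (Fin d) ℝ}, A ∈ SOset d G →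
    (∀ i j, |A i j| ≤ B) → (∀ i j, |A⁻¹ i j| ≤ B) →
    ∀ {u : (Fin d → ℝ) → Fin d → ℝ} {U : Set (Fin d → ℝ)}, IsOpen U → ContDiffOn ℝ 1 u U →
    ∀ c r, 0 < r → closedBall c (κ * r) ⊆ U → ∃ R : Fin d → Fin d → ℝ,
      ∫⁻ x in closedBall c r, ‖grad u x - R‖ₑ ≤
        K * holderBound (fun x => (rotDist G (grad u x)).toNNReal) q (closedBall c (κ * r)) := by
  obtain ⟨C, s, hs, hs', H⟩ := exists_lintegral_grad_sub_le d hq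
  have hq0 : 0 < q := by linarith
  set m : ℝ := d * B + 1 with hm
  have hm1 : 1 ≤ m := by rw [hm]; linarith [show 0 ≤ d * B by positivity]
  have hκ : m * (m / s) ≤ ⌈m * (m / s)⌉₊ := Nat.le_ceil _
  refine ⟨⌈m * (m / s)⌉₊, m.toNNReal * (C * m.toNNReal), Nat.one_le_ceil_iff.2 (by positivity), ?_⟩
  intro G A hA hAB hAB' u U hU hu c r hr hrU
  set κ : ℝ := ((⌈m * (m / s)⌉₊ : ℕ) : ℝ) with hκdef
  set ρ : ℝ := m / s * r with hρdef
  have hρ : 0 < ρ := by positivity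
  have hAu : IsUnit A.det := hA.2.ne'.isUnit
  set T : (Fin d → ℝ) → Fin d → ℝ := fun y => c + (ρ • A⁻¹) *ᵥ y with hT
  have hdet : (ρ • A⁻¹).det ≠ 0 := by
    rw [det_smul, det_nonsing_inv, Ring.inverse_eq_inv']
    exact mul_ne_zero (pow_ne_zero _ hρ.ne') (inv_ne_zero hA.2.ne')
  have hTball : T '' closedBall 0 1 ⊆ closedBall c (κ * r) := by
    rintro _ ⟨y, hy, rfl⟩
    rw [hT, mem_closedBall, dist_self_add_left, smul_mulVec, norm_smul, Real.norm_of_nonneg hρ.le]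
    have h1 : ‖A⁻¹ *ᵥ y‖ ≤ m := by
      have h2 := norm_mulVec_le hB hAB' y
      have h3 : ‖y‖ ≤ 1 := by simpa using hy
      have h4 : d * B * ‖y‖ ≤ d * B * 1 := by gcongr
      linarith
    calc ρ * ‖A⁻¹ *ᵥ y‖ ≤ ρ * m := by gcongr
      _ = m * (m / s) * r := by rw [hρdef]; ring
      _ ≤ κ * r := by gcongr
  have hballT : closedBall c r ⊆ T '' closedBall 0 s := by
    intro x hx
    refine ⟨ρ⁻¹ • A *ᵥ (x - c), ?_, ?_⟩
    · rw [mem_closedBall, dist_zero_right, norm_smul, norm_inv, Real.norm_of_nonneg hρ.le,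
        inv_mul_le_iff₀ hρ]
      have h2 := norm_mulVec_le hB hAB (x - c)
      rw [mem_closedBall, dist_eq_norm] at hx
      calc _ ≤ d * B * ‖x - c‖ := h2
        _ ≤ m * r := by gcongr; rw [hm]; linarith
        _ = ρ * s := by rw [hρdef]; field_simp
    · rw [hT]
      simp only
      rw [smul_mulVec, mulVec_smul, smul_smul, mul_inv_cancel₀ hρ.ne', one_smul, mulVec_mulVec,
        nonsing_inv_mul _ hAu, one_mulVec, add_sub_cancel]
  set w : (Fin d → ℝ) → Fin d → ℝ := fun y => ρ⁻¹ • u (T y) with hw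
  have hTc : ContDiff ℝ 1 T :=
    contDiff_const.add (LinearMap.toContinuousLinearMap (toLin' (ρ • A⁻¹))).contDiff
  have hwU : ContDiffOn ℝ 1 w (T ⁻¹' U) :=
    (hu.comp hTc.contDiffOn Subset.rfl).const_smul ρ⁻¹
  have hTU : closedBall 0 1 ⊆ T ⁻¹' U := image_subset_iff.1 (hTball.trans hrU)
  have hgrad : ∀ y ∈ closedBall (0 : Fin d → ℝ) 1,
      grad w y = fun i j => (of (grad u (T y)) * A⁻¹) i j := fun y hy => by
    have h1 := (hu.differentiableOn one_ne_zero).differentiableAt (hU.mem_nhds (hTU hy))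
    have h2 := jac_comp_add_mulVec (u := u) hρ.ne' h1
    exact congrArg (fun M : Matrix (Fin d) (Fin d) ℝ => fun i j => M i j) h2
  obtain ⟨R, hR⟩ := H (hU.preimage hTc.continuous) hTU hwU
  refine ⟨fun i j => (of R * A) i j, ?_⟩
  set g : (Fin d → ℝ) → ℝ≥0 := fun x => (rotDist G (grad u x)).toNNReal with hg
  set δ : ℝ≥0∞ := ENNReal.ofReal |(ρ • A⁻¹).det| with hδ
  set Y : ℝ≥0∞ := ∫⁻ x in closedBall c (κ * r), (g x : ℝ≥0∞) ^ q with hY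
  set J : ℝ≥0∞ := ∫⁻ y in closedBall 0 1, ENNReal.ofReal (rotDist 1 (grad w y)) ^ q with hJ
  have hJY : δ * J ≤ (m.toNNReal : ℝ≥0∞) ^ q * Y := by
    calc δ * J ≤ δ * ∫⁻ y in closedBall 0 1, (m.toNNReal : ℝ≥0∞) ^ q * (g (T y) : ℝ≥0∞) ^ q := by
          refine mul_le_mul_right (setLIntegral_mono' measurableSet_closedBall fun y hy => ?_) _
          rw [← ENNReal.mul_rpow_of_nonneg _ _ hq0.le, hgrad y hy]
          refine ENNReal.rpow_le_rpow ?_ hq0.le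
          change _ ≤ ENNReal.ofReal m * ENNReal.ofReal (rotDist G (grad u (T y)))
          rw [← ENNReal.ofReal_mul (by linarith)]
          refine ENNReal.ofReal_le_ofReal ((rotDist_one_mul_inv_le hA hB hAB' _).trans ?_)
          exact mul_le_mul_of_nonneg_right (by linarith) (rotDist_nonneg _ _)
      _ = (m.toNNReal : ℝ≥0∞) ^ q * ∫⁻ x in T '' closedBall 0 1, (g x : ℝ≥0∞) ^ q := by
          rw [hT, lintegral_image_add_mulVec hdet c measurableSet_closedBall,
            lintegral_const_mul' _ _ (ENNReal.rpow_ne_top_of_nonneg hq0.le ENNReal.coe_ne_top),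
            mul_left_comm]
      _ ≤ _ := mul_le_mul_right (lintegral_mono_set hTball) _
  have hδvol : δ ≤ volume (closedBall c (κ * r)) := by
    have h1 := lintegral_image_add_mulVec hdet c
      (measurableSet_closedBall (x := (0 : Fin d → ℝ)) (ε := 1 / 2)) fun _ => 1
    rw [setLIntegral_one, setLIntegral_one, volume_closedBall _ (by norm_num),
      mul_one_div_cancel two_ne_zero, one_pow, ENNReal.ofReal_one, mul_one] at h1
    rw [hδ, ← h1]
    exact measure_mono ((image_mono (closedBall_subset_closedBall (by norm_num))).trans hTball)
  have hδJ : δ * J ^ (1 / q) ≤ m.toNNReal * holderBound g q (closedBall c (κ * r)) := by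
    calc δ * J ^ (1 / q) = δ ^ (1 - 1 / q) * (δ * J) ^ (1 / q) := by
          rw [ENNReal.mul_rpow_of_nonneg _ _ (by positivity), ← mul_assoc,
            ← ENNReal.rpow_add_of_nonneg _ _ (one_sub_one_div_nonneg hq) (by positivity),
            sub_add_cancel, ENNReal.rpow_one]
      _ ≤ volume (closedBall c (κ * r)) ^ (1 - 1 / q) *
          ((m.toNNReal : ℝ≥0∞) ^ q * Y) ^ (1 / q) :=
          mul_le_mul' (ENNReal.rpow_le_rpow hδvol (one_sub_one_div_nonneg hq))
            (ENNReal.rpow_le_rpow hJY (by positivity))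
      _ = _ := by
          rw [ENNReal.mul_rpow_of_nonneg _ _ (by positivity), ← ENNReal.rpow_mul,
            mul_one_div_cancel hq0.ne', ENNReal.rpow_one, holderBound, mul_left_comm]
  have hpt : ∀ y ∈ closedBall (0 : Fin d → ℝ) s,
      ‖grad u (T y) - fun i j => (of R * A) i j‖ₑ ≤ m.toNNReal * ‖grad w y - R‖ₑ := fun y hy => by
    rw [← ofReal_norm, ← ofReal_norm]
    change _ ≤ ENNReal.ofReal m * _
    rw [← ENNReal.ofReal_mul (by linarith)]
    refine ENNReal.ofReal_le_ofReal ?_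
    have h1 := norm_mul_le_of_abs_le hB hAB (grad w y - R)
    have h2 : (fun i j => (of (grad w y - R) * A) i j) =
        grad u (T y) - fun i j => (of R * A) i j := by
      have h3 : of (grad w y - R) * A = of (grad u (T y)) - of R * A := by
        have h4 : of (grad w y - R) = of (grad u (T y)) * A⁻¹ - of R := by
          rw [hgrad y (closedBall_subset_closedBall (by linarith) hy)]
          rfl
        rw [h4, Matrix.sub_mul, Matrix.mul_assoc, nonsing_inv_mul _ hAu, Matrix.mul_one]
      exact congrArg (fun M : Matrix (Fin d) (Fin d) ℝ => fun i j => M i j) h3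
    rw [← h2]
    exact h1.trans (mul_le_mul_of_nonneg_right (by linarith) (norm_nonneg _))
  calc _ ≤ ∫⁻ x in T '' closedBall 0 s, ‖grad u x - fun i j => (of R * A) i j‖ₑ :=
        lintegral_mono_set hballT
    _ = δ * ∫⁻ y in closedBall 0 s, ‖grad u (T y) - fun i j => (of R * A) i j‖ₑ :=
        lintegral_image_add_mulVec hdet c measurableSet_closedBall _
    _ ≤ δ * ∫⁻ y in closedBall 0 s, m.toNNReal * ‖grad w y - R‖ₑ :=
        mul_le_mul_right (setLIntegral_mono' measurableSet_closedBall hpt) _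
    _ ≤ δ * (m.toNNReal * (C * J ^ (1 / q))) := by
        rw [lintegral_const_mul' _ _ ENNReal.coe_ne_top]
        exact mul_le_mul_right (mul_le_mul_right hR _) _
    _ = m.toNNReal * (C * (δ * J ^ (1 / q))) := by ring
    _ ≤ m.toNNReal * (C * (m.toNNReal * holderBound g q (closedBall c (κ * r)))) :=
        mul_le_mul_right (mul_le_mul_right hδJ _) _
    _ = _ := by push_cast; ring

end AffineChange

section MetricChange

variable {d : ℕ}

open scoped MatrixOrder Matrix.Norms.L2Operator in
theorem exists_posSemidef_mul_self_eq {M : Matrix (Fin d) (Fin d) ℝ} (hM : M.PosSemidef) :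
    ∃ S : Matrix (Fin d) (Fin d) ℝ, S.PosSemidef ∧ S * S = M :=
  ⟨CFC.sqrt M, (CFC.sqrt_nonneg M).posSemidef, CFC.sqrt_mul_sqrt_self M hM.nonneg⟩

theorem exists_posSemidef_mul_self_eq_det_pos {M : Matrix (Fin d) (Fin d) ℝ} (hM : M.PosDef) :
    ∃ S : Matrix (Fin d) (Fin d) ℝ, S.PosSemidef ∧ S * S = M ∧ 0 < S.det := by
  obtain ⟨S, hS, hSM⟩ := exists_posSemidef_mul_self_eq hM.posSemidef
  refine ⟨S, hS, hSM, hS.det_nonneg.lt_of_ne fun h => ?_⟩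
  have h1 := hM.det_pos
  rw [← hSM, det_mul, ← h, mul_zero] at h1
  exact h1.false

theorem posSemidef_transpose_eq {S : Matrix (Fin d) (Fin d) ℝ} (hS : S.PosSemidef) : Sᵀ = S := by
  have h := hS.isHermitian.eq
  rwa [conjTranspose_eq_transpose_of_trivial] at h

theorem nonempty_SOset {G : Matrix (Fin d) (Fin d) ℝ} (hG : G.PosDef) : (SOset d G).Nonempty := by
  obtain ⟨S, hS, hSM, hdet⟩ := exists_posSemidef_mul_self_eq_det_pos hG
  exact ⟨S, by rw [posSemidef_transpose_eq hS, hSM], hdet⟩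

theorem trace_transpose_mul_self_eq_sum (X : Matrix (Fin d) (Fin d) ℝ) :
    (Xᵀ * X).trace = ∑ i, ∑ j, X i j ^ 2 := by
  simp only [trace, diag, mul_apply, transpose_apply, ← pow_two]
  exact Finset.sum_comm

theorem sum_sq_sub_one_le {S M : Matrix (Fin d) (Fin d) ℝ} (hS : S.PosSemidef) (hSM : S * S = M) :
    ∑ i, ∑ j, (S - 1) i j ^ 2 ≤ ∑ i, ∑ j, (M - 1) i j ^ 2 := by
  have hSt := posSemidef_transpose_eq hS
  have hE : (S - 1)ᵀ = S - 1 := by rw [transpose_sub, hSt, transpose_one]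
  rw [← trace_transpose_mul_self_eq_sum, ← trace_transpose_mul_self_eq_sum]
  have h1 : (M - 1)ᵀ * (M - 1) = (S * (S - 1))ᵀ * (S * (S - 1)) +
      (2 : ℝ) • ((S - 1)ᵀ * S * (S - 1)) + (S - 1)ᵀ * (S - 1) := by
    rw [← hSM, transpose_mul, hE, transpose_sub, transpose_mul, hSt, transpose_one, two_smul]
    noncomm_ring
  have h2 : 0 ≤ ((S - 1)ᵀ * S * (S - 1)).trace := by
    have := (hS.conjTranspose_mul_mul_same (S - 1)).trace_nonneg
    rwa [conjTranspose_eq_transpose_of_trivial] at this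
  have h3 : 0 ≤ ((S * (S - 1))ᵀ * (S * (S - 1))).trace := by
    rw [trace_transpose_mul_self_eq_sum]
    positivity
  rw [h1, trace_add, trace_add, trace_smul, smul_eq_mul]
  linarith

theorem abs_apply_le_frob (X : Matrix (Fin d) (Fin d) ℝ) (i j : Fin d) : |X i j| ≤ frob X := by
  rw [← Real.sqrt_sq_eq_abs, frob]
  refine Real.sqrt_le_sqrt ?_
  calc X i j ^ 2 ≤ ∑ j, X i j ^ 2 :=
        Finset.single_le_sum (fun _ _ => sq_nonneg _) (Finset.mem_univ j)
    _ ≤ _ := Finset.single_le_sum (f := fun i => ∑ j, X i j ^ 2)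
        (fun _ _ => Finset.sum_nonneg fun _ _ => sq_nonneg _) (Finset.mem_univ i)

theorem frob_nonneg (X : Matrix (Fin d) (Fin d) ℝ) : 0 ≤ frob X := Real.sqrt_nonneg _

theorem norm_le_frob (X : Fin d → Fin d → ℝ) : ‖X‖ ≤ frob (of X) :=
  (pi_norm_le_iff_of_nonneg (frob_nonneg _)).2 fun i =>
    (pi_norm_le_iff_of_nonneg (frob_nonneg _)).2 fun j => abs_apply_le_frob (of X) i j

theorem frob_le_of_abs_le {X : Matrix (Fin d) (Fin d) ℝ} {b : ℝ} (hb : 0 ≤ b)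
    (h : ∀ i j, |X i j| ≤ b) : frob X ≤ d * b := by
  rw [frob, Real.sqrt_le_left (by positivity)]
  calc ∑ i, ∑ j, X i j ^ 2 ≤ ∑ _i : Fin d, ∑ _j : Fin d, b ^ 2 :=
        Finset.sum_le_sum fun i _ => Finset.sum_le_sum fun j _ => by
          rw [← sq_abs]
          exact pow_le_pow_left₀ (abs_nonneg _) (h i j) 2
    _ = _ := by simp; ring

theorem frob_le_mul_norm (X : Fin d → Fin d → ℝ) : frob (of X) ≤ d * ‖X‖ :=
  frob_le_of_abs_le (norm_nonneg _) fun i j =>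
    (norm_le_pi_norm (X i) j).trans (norm_le_pi_norm X i)

theorem frob_mul_le {A X : Matrix (Fin d) (Fin d) ℝ} {B : ℝ} (hB : 0 ≤ B)
    (hA : ∀ i j, |A i j| ≤ B) : frob (X * A) ≤ d ^ 2 * B * frob X := by
  have h : ∀ i j, |(X * A) i j| ≤ d * B * frob X := fun i j => by
    rw [mul_apply]
    calc |∑ k, X i k * A k j| ≤ ∑ k, |X i k * A k j| := Finset.abs_sum_le_sum_abs _ _
      _ ≤ ∑ _k : Fin d, frob X * B := Finset.sum_le_sum fun k _ => by
          rw [abs_mul]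
          exact mul_le_mul (abs_apply_le_frob _ _ _) (hA _ _) (abs_nonneg _) (frob_nonneg _)
      _ = _ := by simp; ring
  exact (frob_le_of_abs_le (by have := frob_nonneg X; positivity) h).trans_eq (by ring)

theorem frob_transpose (X : Matrix (Fin d) (Fin d) ℝ) : frob Xᵀ = frob X :=
  congrArg Real.sqrt Finset.sum_comm

theorem frob_mul_le' {A X : Matrix (Fin d) (Fin d) ℝ} {B : ℝ} (hB : 0 ≤ B)
    (hA : ∀ i j, |A i j| ≤ B) : frob (A * X) ≤ d ^ 2 * B * frob X := by
  rw [← frob_transpose (A * X), transpose_mul, ← frob_transpose X]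
  exact frob_mul_le hB fun i j => hA j i

theorem frobG_eq_frob {G R : Matrix (Fin d) (Fin d) ℝ} (hR : R ∈ SOset d G)
    (X : Matrix (Fin d) (Fin d) ℝ) : frobG G X = frob (X * R⁻¹) := by
  have h : X * G⁻¹ * Xᵀ = (X * R⁻¹)ᵀᵀ * (X * R⁻¹)ᵀ := by
    rw [← hR.1, Matrix.mul_inv_rev, transpose_transpose, transpose_mul, transpose_nonsing_inv]
    simp only [Matrix.mul_assoc]
  rw [frobG, ← frob_transpose, frob, h, trace_transpose_mul_self_eq_sum]

theorem frobG_nonneg (G X : Matrix (Fin d) (Fin d) ℝ) : 0 ≤ frobG G X := Real.sqrt_nonneg _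

theorem isUnit_det_of_mem_SOset {G R : Matrix (Fin d) (Fin d) ℝ} (hR : R ∈ SOset d G) :
    IsUnit R.det := hR.2.ne'.isUnit

theorem frob_le_frobG {G R : Matrix (Fin d) (Fin d) ℝ} (hR : R ∈ SOset d G) {B : ℝ} (hB : 0 ≤ B)
    (hRB : ∀ i j, |R i j| ≤ B) (X : Matrix (Fin d) (Fin d) ℝ) :
    frob X ≤ d ^ 2 * B * frobG G X := by
  have h := frob_mul_le (X := X * R⁻¹) hB hRB
  rwa [Matrix.mul_assoc, nonsing_inv_mul _ (isUnit_det_of_mem_SOset hR), Matrix.mul_one,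
    ← frobG_eq_frob hR] at h

theorem exists_mem_SOset_frob_sub_le {G H R : Matrix (Fin d) (Fin d) ℝ} (hR : R ∈ SOset d G)
    (hH : H.PosDef) {B : ℝ} (hB : 0 ≤ B) (hRB : ∀ i j, |R i j| ≤ B)
    (hRB' : ∀ i j, |R⁻¹ i j| ≤ B) :
    ∃ S ∈ SOset d H, frob (S - R) ≤ (d ^ 2 * B) ^ 3 * frob (H - G) := by
  have hu := isUnit_det_of_mem_SOset hR
  have hM : ((R⁻¹)ᵀ * H * R⁻¹).PosDef := by
    have h := (IsUnit.posDef_star_left_conjugate_iff (U := R⁻¹) (x := H)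
      ((isUnit_nonsing_inv_iff).2 ((isUnit_iff_isUnit_det _).2 hu))).2 hH
    rwa [star_eq_conjTranspose, conjTranspose_eq_transpose_of_trivial] at h
  obtain ⟨S, hS, hSM, hSdet⟩ := exists_posSemidef_mul_self_eq_det_pos hM
  have hM1 : (R⁻¹)ᵀ * H * R⁻¹ - 1 = (R⁻¹)ᵀ * (H - G) * R⁻¹ := by
    have h : (R⁻¹)ᵀ * G * R⁻¹ = 1 := by
      rw [← hR.1, ← Matrix.mul_assoc, ← transpose_mul, mul_nonsing_inv _ hu, transpose_one,
        Matrix.one_mul, mul_nonsing_inv _ hu]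
    rw [Matrix.mul_sub, Matrix.sub_mul, h]
  refine ⟨S * R, ⟨?_, by rw [det_mul]; exact mul_pos hSdet hR.2⟩, ?_⟩
  · calc (S * R)ᵀ * (S * R) = Rᵀ * (S * S) * R := by
          rw [transpose_mul, posSemidef_transpose_eq hS]
          simp only [Matrix.mul_assoc]
      _ = (R⁻¹ * R)ᵀ * H * (R⁻¹ * R) := by
          rw [hSM, transpose_mul]
          simp only [Matrix.mul_assoc]
      _ = H := by
          rw [nonsing_inv_mul _ hu, transpose_one, Matrix.one_mul, Matrix.mul_one]
  · have hK : (0 : ℝ) ≤ d ^ 2 * B := by positivity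
    calc frob (S * R - R) = frob ((S - 1) * R) := by rw [Matrix.sub_mul, Matrix.one_mul]
      _ ≤ d ^ 2 * B * frob (S - 1) := frob_mul_le hB hRB
      _ ≤ d ^ 2 * B * frob ((R⁻¹)ᵀ * (H - G) * R⁻¹) := by
          refine mul_le_mul_of_nonneg_left ?_ hK
          rw [← hM1]
          exact Real.sqrt_le_sqrt (sum_sq_sub_one_le hS hSM)
      _ ≤ d ^ 2 * B * (d ^ 2 * B * (d ^ 2 * B * frob (H - G))) := by
          refine mul_le_mul_of_nonneg_left ((frob_mul_le hB hRB').trans ?_) hK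
          exact mul_le_mul_of_nonneg_left (frob_mul_le' hB fun i j => hRB' j i) hK
      _ = _ := by ring

theorem rotDist_le_distG_add {G H : Matrix (Fin d) (Fin d) ℝ} (hG : G.PosDef) (hH : H.PosDef)
    {B : ℝ} (hB : 0 ≤ B) (hRB : ∀ R ∈ SOset d G, ∀ i j, |R i j| ≤ B)
    (hRB' : ∀ R ∈ SOset d G, ∀ i j, |R⁻¹ i j| ≤ B) (A : Fin d → Fin d → ℝ) :
    rotDist H A ≤ d ^ 2 * B * distG G (of A) (SOset d G) + (d ^ 2 * B) ^ 3 * frob (H - G) := by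
  have hK : (0 : ℝ) ≤ d ^ 2 * B := by positivity
  have key : ∀ R : Fin d → Fin d → ℝ, of R ∈ SOset d G →
      rotDist H A ≤ d ^ 2 * B * frobG G (of A - of R) + (d ^ 2 * B) ^ 3 * frob (H - G) := by
    intro R hR
    have hS' : ∃ S : Fin d → Fin d → ℝ, of S ∈ SOset d H ∧
        frob (of S - of R) ≤ (d ^ 2 * B) ^ 3 * frob (H - G) :=
      exists_mem_SOset_frob_sub_le hR hH hB (hRB _ hR) (hRB' _ hR)
    obtain ⟨S, hS, hSR⟩ := hS'
    have h1 : rotDist H A ≤ ‖A - S‖ :=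
      (infDist_le_dist_of_mem (α := Fin d → Fin d → ℝ) hS).trans_eq (dist_eq_norm _ _)
    have h2 : ‖A - S‖ ≤ ‖A - R‖ + ‖S - R‖ := by
      rw [norm_sub_rev S]
      exact norm_sub_le_norm_sub_add_norm_sub _ _ _
    have h3 : ‖A - R‖ ≤ frob (of A - of R) := norm_le_frob _
    have h4 : ‖S - R‖ ≤ frob (of S - of R) := norm_le_frob _
    have h5 := frob_le_frobG hR hB (hRB _ hR) (of A - of R)
    linarith
  obtain ⟨R₀, hR₀⟩ := nonempty_SOset hG
  rcases hK.eq_or_lt with h0 | hpos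
  · have := key R₀ hR₀
    rw [← h0] at this ⊢
    simpa using this
  · have : (rotDist H A - (d ^ 2 * B) ^ 3 * frob (H - G)) / (d ^ 2 * B) ≤
        distG G (of A) (SOset d G) := by
      refine le_csInf ⟨_, R₀, hR₀, rfl⟩ ?_
      rintro _ ⟨R, hR, rfl⟩
      rw [div_le_iff₀ hpos]
      have : rotDist H A ≤ d ^ 2 * B * frobG G (of A - R) + _ := key R hR
      linarith
    rw [div_le_iff₀ hpos] at this
    linarith

theorem abs_le_of_mem_SOset_of_le {G R : Matrix (Fin d) (Fin d) ℝ} (hR : R ∈ SOset d G) {m : ℝ}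
    (hG : ∀ v : Fin d → ℝ, v ⬝ᵥ G *ᵥ v ≤ m * ∑ i, v i ^ 2) (i j : Fin d) :
    |R i j| ≤ Real.sqrt m := by
  refine Real.abs_le_sqrt ((sq_le_of_mem_SOset hR i j).trans ?_)
  have h := hG (Pi.single j 1)
  simpa [Pi.single_apply, ite_pow] using h

theorem abs_inv_le_of_mem_SOset_of_le {G R : Matrix (Fin d) (Fin d) ℝ} (hR : R ∈ SOset d G) {m : ℝ}
    (hm : 0 < m) (hG : ∀ v : Fin d → ℝ, m⁻¹ * ∑ i, v i ^ 2 ≤ v ⬝ᵥ G *ᵥ v) (i j : Fin d) :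
    |R⁻¹ i j| ≤ Real.sqrt m := by
  refine Real.abs_le_sqrt ?_
  have h := hG (R⁻¹ *ᵥ Pi.single j 1)
  have h1 : (R⁻¹ *ᵥ Pi.single j 1) ⬝ᵥ G *ᵥ (R⁻¹ *ᵥ Pi.single j (1 : ℝ)) = 1 := by
    rw [← hR.1, ← mulVec_mulVec, dotProduct_mulVec, vecMul_transpose, mulVec_mulVec,
      mul_nonsing_inv _ (isUnit_det_of_mem_SOset hR), one_mulVec]
    simp
  rw [h1, inv_mul_le_iff₀ hm, mul_one] at h
  refine le_trans ?_ h
  have h2 : R⁻¹ i j ^ 2 = (R⁻¹ *ᵥ Pi.single j 1) i ^ 2 := by simp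
  rw [h2]
  exact Finset.single_le_sum (f := fun i => (R⁻¹ *ᵥ Pi.single j 1) i ^ 2)
    (fun _ _ => sq_nonneg _) (Finset.mem_univ i)

end MetricChange

section CubeRigidity

variable {d : ℕ}

theorem continuousOn_grad {u : (Fin d → ℝ) → Fin d → ℝ} {U : Set (Fin d → ℝ)} (hU : IsOpen U)
    (hu : ContDiffOn ℝ 1 u U) : ContinuousOn (grad u) U := by
  refine continuousOn_pi.2 fun i => continuousOn_pi.2 fun j => ?_
  exact (continuous_apply i).comp_continuousOn
    ((hu.continuousOn_fderiv_of_isOpen hU le_rfl).clm_apply continuousOn_const)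

theorem exists_lintegral_grad_sub_rpow_le_closedBall (d : ℕ) {p : ℝ} (hp : 1 < p) {B : ℝ}
    (hB : 0 ≤ B) : ∃ C : ℝ≥0, ∀ {H A : Matrix (Fin d) (Fin d) ℝ}, A ∈ SOset d H →
      (∀ i j, |A i j| ≤ B) → (∀ i j, |A⁻¹ i j| ≤ B) →
      ∀ {u : (Fin d → ℝ) → Fin d → ℝ} {U : Set (Fin d → ℝ)}, IsOpen U → ContDiffOn ℝ 1 u U →
      ∀ (c : Fin d → ℝ) (r : ℝ), 0 < r → closedBall c r ⊆ U →
      ∃ R : Fin d → Fin d → ℝ, of R ∈ SOset d H ∧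
        ∫⁻ x in closedBall c r, ‖grad u x - R‖ₑ ^ p ≤
          C * ∫⁻ x in closedBall c r, ENNReal.ofReal (rotDist H (grad u x)) ^ p := by
  have hq : 1 < (1 + p) / 2 := by linarith
  have hqp : (1 + p) / 2 < p := by linarith
  have hp0 : 0 < p := by linarith
  obtain ⟨κ, K, hκ, hlocal⟩ := exists_lintegral_grad_sub_le_holderBound d hq hB
  obtain ⟨C₁, hC₁⟩ := exists_oscillation_le_of_dilated d hq hκ K
  obtain ⟨C₂, hC₂⟩ := exists_lintegral_enorm_sub_cubeAvg_le d hq hqp C₁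
  refine ⟨(2 : ℝ≥0) ^ (p - 1) * (2 ^ p * C₂ + 1), ?_⟩
  intro H A hA hAB hAB' u U hU hu c r hr hcr
  have hdet : 0 < H.det := det_pos_of_mem_SOset hA
  have hg : Measurable fun x => (rotDist H (grad u x)).toNNReal :=
    ((lipschitzWith_rotDist H).continuous.measurable.comp (measurable_grad u)).real_toNNReal
  have hfint : IntegrableOn (grad u) (closedBall c r) :=
    ((continuousOn_grad hU hu).mono hcr).integrableOn_compact (isCompact_closedBall c r)
  obtain ⟨L, hL⟩ := (IsCompact.isBounded (α := Fin d → Fin d → ℝ)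
    (isCompact_SOset hdet)).exists_norm_le
  have hbound : ∀ x ∈ closedBall c r,
      ‖grad u x‖ ≤ ((rotDist H (grad u x)).toNNReal : ℝ) + (L.toNNReal : ℝ≥0) := fun x _ => by
    obtain ⟨S, hS, hSx⟩ := exists_mem_SOset_rotDist_eq hdet ⟨A, hA⟩ (grad u x)
    rw [Real.coe_toNNReal _ (rotDist_nonneg _ _), hSx]
    have h1 : ‖S‖ ≤ L.toNNReal := (hL S hS).trans (Real.le_coe_toNNReal L)
    have h2 := norm_sub_norm_le (grad u x) S
    linarith
  have hosc := hC₁ (grad u) _ hg (closedBall c r) hfint L.toNNReal hbound fun c' r' hr' hc' =>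
    hlocal hA hAB hAB' hU hu c' r' hr' (hc'.trans hcr)
  have hFS := hC₂ (grad u) _ hg c r hr hfint fun c' r' hr' hc' =>
    (hosc c' r' hr' hc').trans_eq (mul_assoc _ _ _).symm
  obtain ⟨R, hR, hRm⟩ := exists_mem_SOset_rotDist_eq hdet ⟨A, hA⟩ (cubeAvg (grad u) c r)
  refine ⟨R, hR, ?_⟩
  set m := cubeAvg (grad u) c r with hm
  have hpt : ∀ x, ‖grad u x - R‖ₑ ^ p ≤ (2 : ℝ≥0∞) ^ (p - 1) * (2 ^ p * ‖grad u x - m‖ₑ ^ p +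
      ((rotDist H (grad u x)).toNNReal : ℝ≥0∞) ^ p) := fun x => by
    have h1 : ‖grad u x - R‖ₑ ≤ 2 * ‖grad u x - m‖ₑ + (rotDist H (grad u x)).toNNReal := by
      have h2 : ‖m - R‖ₑ ≤ ENNReal.ofReal (rotDist H (grad u x)) + ‖grad u x - m‖ₑ := by
        rw [← ofReal_norm (m - R), ← hRm, ← enorm_neg (grad u x - m), neg_sub]
        exact ofReal_rotDist_le_add H m (grad u x)
      calc ‖grad u x - R‖ₑ = ‖(grad u x - m) + (m - R)‖ₑ := by rw [sub_add_sub_cancel]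
        _ ≤ ‖grad u x - m‖ₑ + ‖m - R‖ₑ := enorm_add_le _ _
        _ ≤ ‖grad u x - m‖ₑ + (ENNReal.ofReal (rotDist H (grad u x)) + ‖grad u x - m‖ₑ) := by
            gcongr
        _ = _ := by
            rw [two_mul, add_left_comm, add_comm]
            rfl
    refine (ENNReal.rpow_le_rpow h1 hp0.le).trans
      ((ENNReal.rpow_add_le_mul_rpow_add_rpow _ _ hp.le).trans_eq ?_)
    rw [ENNReal.mul_rpow_of_nonneg _ _ hp0.le]
  have h2 : (2 : ℝ≥0∞) ^ (p - 1) ≠ ∞ := ENNReal.rpow_ne_top_of_nonneg (by linarith) (by simp)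
  have h2' : (2 : ℝ≥0∞) ^ p ≠ ∞ := ENNReal.rpow_ne_top_of_nonneg hp0.le (by simp)
  have hgm : Measurable fun x => ((rotDist H (grad u x)).toNNReal : ℝ≥0∞) ^ p :=
    hg.coe_nnreal_ennreal.pow_const p
  have hc : (((2 : ℝ≥0) ^ (p - 1) * (2 ^ p * C₂ + 1) : ℝ≥0) : ℝ≥0∞) =
      (2 : ℝ≥0∞) ^ (p - 1) * (2 ^ p * C₂ + 1) := by
    push_cast [ENNReal.coe_rpow_of_nonneg _ hp0.le,
      ENNReal.coe_rpow_of_nonneg (2 : ℝ≥0) (show 0 ≤ p - 1 by linarith)]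
    rfl
  calc _ ≤ ∫⁻ x in closedBall c r, (2 : ℝ≥0∞) ^ (p - 1) * (2 ^ p * ‖grad u x - m‖ₑ ^ p +
      ((rotDist H (grad u x)).toNNReal : ℝ≥0∞) ^ p) := lintegral_mono hpt
    _ = (2 : ℝ≥0∞) ^ (p - 1) * (2 ^ p * (∫⁻ x in closedBall c r, ‖grad u x - m‖ₑ ^ p) +
        ∫⁻ x in closedBall c r, ((rotDist H (grad u x)).toNNReal : ℝ≥0∞) ^ p) := by
        rw [lintegral_const_mul' _ _ h2, lintegral_add_right _ hgm, lintegral_const_mul' _ _ h2']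
    _ ≤ (2 : ℝ≥0∞) ^ (p - 1) * (2 ^ p * (C₂ *
          ∫⁻ x in closedBall c r, ((rotDist H (grad u x)).toNNReal : ℝ≥0∞) ^ p) +
        ∫⁻ x in closedBall c r, ((rotDist H (grad u x)).toNNReal : ℝ≥0∞) ^ p) := by
        gcongr
    _ = _ := by
        rw [hc]
        change _ = _ * ∫⁻ x in closedBall c r, ((rotDist H (grad u x)).toNNReal : ℝ≥0∞) ^ p
        ring

theorem exists_lintegral_grad_sub_rpow_le_ball (d : ℕ) {p : ℝ} (hp : 1 < p) {B : ℝ}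
    (hB : 0 ≤ B) : ∃ C : ℝ≥0, ∀ {H A : Matrix (Fin d) (Fin d) ℝ}, A ∈ SOset d H →
      (∀ i j, |A i j| ≤ B) → (∀ i j, |A⁻¹ i j| ≤ B) →
      ∀ {u : (Fin d → ℝ) → Fin d → ℝ} (c : Fin d → ℝ) (r : ℝ), 0 < r →
      ContDiffOn ℝ 1 u (ball c r) →
      ∃ R : Fin d → Fin d → ℝ, of R ∈ SOset d H ∧
        ∫⁻ x in ball c r, ‖grad u x - R‖ₑ ^ p ≤
          C * ∫⁻ x in ball c r, ENNReal.ofReal (rotDist H (grad u x)) ^ p := by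
  obtain ⟨C, hC⟩ := exists_lintegral_grad_sub_rpow_le_closedBall d hp hB
  refine ⟨C, fun {H A} hA hAB hAB' {u} c r hr hu => ?_⟩
  set ρ : ℕ → ℝ := fun n => r * (1 - 1 / ((n : ℝ) + 2)) with hρ
  have hfrac : ∀ n : ℕ, 0 < 1 / ((n : ℝ) + 2) ∧ 1 / ((n : ℝ) + 2) < 1 := fun n =>
    ⟨by positivity, by rw [div_lt_one (by positivity)]; linarith [n.cast_nonneg (α := ℝ)]⟩
  have hρ0 : ∀ n, 0 < ρ n := fun n => mul_pos hr (by linarith [(hfrac n).2])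
  have hρr : ∀ n, ρ n < r := fun n => by
    have := mul_lt_mul_of_pos_left (show 1 - 1 / ((n : ℝ) + 2) < 1 by linarith [(hfrac n).1]) hr
    rwa [mul_one] at this
  have hρlim : Tendsto ρ atTop (𝓝 r) := by
    have h1 : Tendsto (fun n : ℕ => 1 / ((n : ℝ) + 2)) atTop (𝓝 0) := by
      have := (tendsto_const_nhds (x := (1 : ℝ))).div_atTop
        (tendsto_atTop_add_const_right atTop (2 : ℝ) tendsto_natCast_atTop_atTop)
      exact this
    have h2 := (h1.const_sub 1).const_mul r
    simpa [hρ] using h2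
  choose R hR hRint using fun n => hC hA hAB hAB' isOpen_ball hu c (ρ n) (hρ0 n)
    (closedBall_subset_ball (hρr n))
  obtain ⟨R₀, hR₀, φ, hφ, hlim⟩ := IsCompact.tendsto_subseq (X := Fin d → Fin d → ℝ)
    (isCompact_SOset (det_pos_of_mem_SOset hA)) hR
  refine ⟨R₀, hR₀, ?_⟩
  set F : ℕ → (Fin d → ℝ) → ℝ≥0∞ := fun n =>
    (closedBall c (ρ (φ n))).indicator fun x => ‖grad u x - R (φ n)‖ₑ ^ p with hF
  have hFm : ∀ n, Measurable (F n) := fun n =>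
    (((measurable_grad u).sub_const _).enorm.pow_const p).indicator measurableSet_closedBall
  have hFlim : ∀ x ∈ ball c r, ‖grad u x - R₀‖ₑ ^ p = liminf (fun n => F n x) atTop := by
    intro x hx
    refine (Tendsto.liminf_eq ?_).symm
    have h1 : Tendsto (fun n => ‖grad u x - R (φ n)‖ₑ ^ p) atTop (𝓝 (‖grad u x - R₀‖ₑ ^ p)) :=
      (ENNReal.continuous_rpow_const.tendsto _).comp
        ((continuous_enorm.tendsto _).comp (hlim.const_sub (grad u x)))
    refine h1.congr' ?_
    filter_upwards [(hρlim.comp hφ.tendsto_atTop).eventually (lt_mem_nhds (mem_ball.1 hx))]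
      with n hn
    have hx' : x ∈ closedBall c (ρ (φ n)) := mem_closedBall.2 hn.le
    exact (indicator_of_mem hx' fun x => ‖grad u x - R (φ n)‖ₑ ^ p).symm
  calc ∫⁻ x in ball c r, ‖grad u x - R₀‖ₑ ^ p
      = ∫⁻ x in ball c r, liminf (fun n => F n x) atTop :=
        setLIntegral_congr_fun measurableSet_ball hFlim
    _ ≤ liminf (fun n => ∫⁻ x in ball c r, F n x) atTop := lintegral_liminf_le hFm
    _ ≤ liminf (fun _ : ℕ =>
          C * ∫⁻ x in ball c r, ENNReal.ofReal (rotDist H (grad u x)) ^ p) atTop := by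
        refine liminf_le_liminf (Eventually.of_forall fun n => ?_)
        calc ∫⁻ x in ball c r, F n x ≤ ∫⁻ x, F n x := setLIntegral_le_lintegral _ _
          _ = ∫⁻ x in closedBall c (ρ (φ n)), ‖grad u x - R (φ n)‖ₑ ^ p :=
              lintegral_indicator measurableSet_closedBall _
          _ ≤ _ := (hRint (φ n)).trans (mul_le_mul_right (lintegral_mono_set
              (closedBall_subset_ball (hρr (φ n)))) _)
    _ = _ := liminf_const _

end CubeRigidity

section MetricField

variable {d : ℕ}

theorem distG_nonneg (G A : Matrix (Fin d) (Fin d) ℝ) (S : Set (Matrix (Fin d) (Fin d) ℝ)) :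
    0 ≤ distG G A S := by
  refine Real.sInf_nonneg ?_
  rintro _ ⟨R, -, rfl⟩
  exact frobG_nonneg _ _

theorem ball_eq_pi_Ioo (a : Fin d → ℝ) {l : ℝ} (hl : 0 < l) :
    Set.pi univ (fun i => Ioo (a i) (a i + l)) = ball (fun i => a i + l / 2) (l / 2) := by
  rw [ball_pi _ (by positivity)]
  refine congrArg _ (funext fun i => ?_)
  rw [Real.ball_eq_Ioo]
  congr 1 <;> ring

theorem abs_apply_le_of_mem_SOset {G R : Matrix (Fin d) (Fin d) ℝ} (hR : R ∈ SOset d G) {B : ℝ}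
    (hB : 0 ≤ B) (hRB : ∀ i j, |R i j| ≤ B) (i j : Fin d) : |G i j| ≤ d ^ 2 * B * (d * B) := by
  refine (abs_apply_le_frob G i j).trans ?_
  rw [← hR.1]
  refine (frob_mul_le hB hRB).trans (mul_le_mul_of_nonneg_left ?_ (by positivity))
  exact frob_le_of_abs_le hB fun i j => hRB j i

theorem frob_sub_le_oscG {G : (Fin d → ℝ) → Matrix (Fin d) (Fin d) ℝ} {Q : Set (Fin d → ℝ)} {b : ℝ}
    (hb : 0 ≤ b) (hG : ∀ x ∈ Q, ∀ i j, |G x i j| ≤ b) {x y : Fin d → ℝ} (hx : x ∈ Q) (hy : y ∈ Q) :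
    frob (G x - G y) ≤ oscG G Q := by
  refine le_csSup ⟨d * (b + b), ?_⟩ ⟨x, hx, y, hy, rfl⟩
  rintro _ ⟨x, hx, y, hy, rfl⟩
  exact frob_le_of_abs_le (by positivity) fun i j =>
    (abs_sub _ _).trans (add_le_add (hG x hx i j) (hG y hy i j))

theorem ofReal_add_rpow_le {p : ℝ} (hp : 1 ≤ p) {k m s t : ℝ} (hk : 0 ≤ k) (hm : 0 ≤ m) (hs : 0 ≤ s)
    (ht : 0 ≤ t) : ENNReal.ofReal (k * s + m * t) ^ p ≤
      2 ^ (p - 1) * (ENNReal.ofReal k ^ p + ENNReal.ofReal m ^ p) *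
        (ENNReal.ofReal (t ^ p) + ENNReal.ofReal (s ^ p)) := by
  have hp0 : 0 ≤ p := by linarith
  rw [ENNReal.ofReal_add (by positivity) (by positivity), ENNReal.ofReal_mul hk,
    ENNReal.ofReal_mul hm, ← ENNReal.ofReal_rpow_of_nonneg hs hp0,
    ← ENNReal.ofReal_rpow_of_nonneg ht hp0, mul_assoc]
  refine (ENNReal.rpow_add_le_mul_rpow_add_rpow _ _ hp).trans (mul_le_mul_right ?_ _)
  rw [ENNReal.mul_rpow_of_nonneg _ _ hp0, ENNReal.mul_rpow_of_nonneg _ _ hp0, add_mul]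
  gcongr
  · exact le_add_self
  · exact le_self_add

end MetricField

end Rigidity

open Rigidity Metric Set ENNReal in
theorem stmt_12 (d : ℕ) (hd : 1 ≤ d) (p : ℝ) (hp : 1 < p)
    (lam : ℝ) (hlam : 0 < lam) :
    ∃ C : ℝ, 0 < C ∧
      ∀ (a : Fin d → ℝ) (l : ℝ), 0 < l →
      ∀ Q : Set (Fin d → ℝ), Q = Set.pi Set.univ (fun i => Set.Ioo (a i) (a i + l)) →
      ∀ G : (Fin d → ℝ) → Matrix (Fin d) (Fin d) ℝ,
        (∀ i j, Measurable fun x => G x i j) →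
        (∀ x ∈ Q, (G x).IsSymm) → (∀ x ∈ Q, (G x).PosDef) →
        (∀ x ∈ Q, ∀ v : Fin d → ℝ,
          lam⁻¹ * (∑ i, (v i) ^ 2) ≤ v ⬝ᵥ (G x).mulVec v ∧
          v ⬝ᵥ (G x).mulVec v ≤ lam * (∑ i, (v i) ^ 2)) →
      ∀ u : (Fin d → ℝ) → (Fin d → ℝ), ContDiffOn ℝ 1 u Q →
      ∀ x₀ ∈ Q,
        ∃ R : Matrix (Fin d) (Fin d) ℝ, Rᵀ * R = G x₀ ∧ 0 < R.det ∧
          (∫⁻ x in Q, ENNReal.ofReal (frobG (G x) (jac u x - R) ^ p)) ≤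
            ENNReal.ofReal C *
              (volume Q * ENNReal.ofReal (oscG G Q ^ p) +
                ∫⁻ x in Q, ENNReal.ofReal (distG (G x) (jac u x) (SOset d (G x)) ^ p)) := by
  have hp0 : 0 < p := by linarith
  set B := Real.sqrt lam with hBdef
  have hB : 0 ≤ B := Real.sqrt_nonneg _
  set k : ℝ := d ^ 2 * B with hk
  have hk0 : 0 ≤ k := by positivity
  obtain ⟨C, hC⟩ := exists_lintegral_grad_sub_rpow_le_ball d hp hB
  set N : ENNReal := ENNReal.ofReal (k * d) ^ p *
    (C * (2 ^ (p - 1) * (ENNReal.ofReal k ^ p + ENNReal.ofReal (k ^ 3) ^ p))) with hN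
  have hpow : ∀ t : ℝ, ENNReal.ofReal t ^ p ≠ ∞ := fun t =>
    rpow_ne_top_of_nonneg hp0.le ofReal_ne_top
  have hM : (2 : ENNReal) ^ (p - 1) * (ENNReal.ofReal k ^ p + ENNReal.ofReal (k ^ 3) ^ p) ≠ ∞ :=
    mul_ne_top (rpow_ne_top_of_nonneg (by linarith) ofNat_ne_top) (add_ne_top.2 ⟨hpow _, hpow _⟩)
  have hNtop : N ≠ ∞ := mul_ne_top (hpow _) (mul_ne_top coe_ne_top hM)
  refine ⟨N.toReal + 1, by positivity, ?_⟩
  intro a l hl Q hQ G _ _ hGpos hGb u hu x₀ hx₀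
  rw [ball_eq_pi_Ioo a hl] at hQ
  have hQm : MeasurableSet Q := hQ ▸ measurableSet_ball
  have hSO : ∀ x ∈ Q, ∀ R ∈ SOset d (G x), ∀ i j, |R i j| ≤ B := fun x hx R hR =>
    abs_le_of_mem_SOset_of_le hR fun v => (hGb x hx v).2
  have hSO' : ∀ x ∈ Q, ∀ R ∈ SOset d (G x), ∀ i j, |R⁻¹ i j| ≤ B := fun x hx R hR =>
    abs_inv_le_of_mem_SOset_of_le hR hlam fun v => (hGb x hx v).1
  have hosc : ∀ x ∈ Q, frob (G x₀ - G x) ≤ oscG G Q := fun x hx =>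
    frob_sub_le_oscG (b := d ^ 2 * B * (d * B)) (by positivity) (fun y hy i j => by
      obtain ⟨R, hR⟩ := nonempty_SOset (hGpos y hy)
      exact abs_apply_le_of_mem_SOset hR hB (hSO y hy R hR) i j) hx₀ hx
  have hosc0 : 0 ≤ oscG G Q := (frob_nonneg _).trans (hosc x₀ hx₀)
  obtain ⟨A, hA⟩ := nonempty_SOset (hGpos x₀ hx₀)
  obtain ⟨R, hR, hRint⟩ := hC hA (hSO x₀ hx₀ A hA) (hSO' x₀ hx₀ A hA) _ (l / 2) (by positivity)
    (hQ ▸ hu)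
  rw [← hQ] at hRint
  refine ⟨of R, hR.1, hR.2, ?_⟩
  have hleft : ∀ x ∈ Q, ENNReal.ofReal (frobG (G x) (jac u x - of R) ^ p) ≤
      ENNReal.ofReal (k * d) ^ p * ‖grad u x - R‖ₑ ^ p := fun x hx => by
    obtain ⟨S, hS⟩ := nonempty_SOset (hGpos x hx)
    rw [← ofReal_rpow_of_nonneg (frobG_nonneg _ _) hp0.le, ← mul_rpow_of_nonneg _ _ hp0.le,
      ← ofReal_norm, ← ofReal_mul (by positivity)]
    refine rpow_le_rpow (ofReal_le_ofReal ?_) hp0.le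
    rw [frobG_eq_frob hS, mul_assoc]
    exact (frob_mul_le hB (hSO' x hx S hS)).trans
      (mul_le_mul_of_nonneg_left (frob_le_mul_norm (grad u x - R)) hk0)
  have hright : ∀ x ∈ Q, ENNReal.ofReal (rotDist (G x₀) (grad u x)) ^ p ≤
      2 ^ (p - 1) * (ENNReal.ofReal k ^ p + ENNReal.ofReal (k ^ 3) ^ p) *
        (ENNReal.ofReal (oscG G Q ^ p) +
          ENNReal.ofReal (distG (G x) (jac u x) (SOset d (G x)) ^ p)) := fun x hx => by
    refine le_trans (rpow_le_rpow (ofReal_le_ofReal ?_) hp0.le)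
      (ofReal_add_rpow_le hp.le hk0 (by positivity) (distG_nonneg _ _ _) hosc0)
    exact (rotDist_le_distG_add (hGpos x hx) (hGpos x₀ hx₀) hB (hSO x hx) (hSO' x hx) _).trans
      (add_le_add_right (mul_le_mul_of_nonneg_left (hosc x hx) (by positivity)) _)
  calc ∫⁻ x in Q, ENNReal.ofReal (frobG (G x) (jac u x - of R) ^ p)
      ≤ ∫⁻ x in Q, ENNReal.ofReal (k * d) ^ p * ‖grad u x - R‖ₑ ^ p :=
        setLIntegral_mono' hQm hleft
    _ ≤ ENNReal.ofReal (k * d) ^ p * (C *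
          ∫⁻ x in Q, ENNReal.ofReal (rotDist (G x₀) (grad u x)) ^ p) := by
        rw [lintegral_const_mul' _ _ (hpow _)]
        exact mul_le_mul_right hRint _
    _ ≤ ENNReal.ofReal (k * d) ^ p * (C *
          (2 ^ (p - 1) * (ENNReal.ofReal k ^ p + ENNReal.ofReal (k ^ 3) ^ p) *
            (volume Q * ENNReal.ofReal (oscG G Q ^ p) +
              ∫⁻ x in Q, ENNReal.ofReal (distG (G x) (jac u x) (SOset d (G x)) ^ p)))) := by
        refine mul_le_mul_right (mul_le_mul_right ((setLIntegral_mono' hQm hright).trans_eq ?_) _) _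
        rw [lintegral_const_mul' _ _ hM, lintegral_add_left measurable_const, setLIntegral_const,
          mul_comm (volume Q)]
    _ = N * (volume Q * ENNReal.ofReal (oscG G Q ^ p) +
          ∫⁻ x in Q, ENNReal.ofReal (distG (G x) (jac u x) (SOset d (G x)) ^ p)) := by
        rw [hN]
        ring
    _ ≤ _ := by
        refine mul_le_mul_left ?_ _
        calc N = ENNReal.ofReal N.toReal := (ofReal_toReal hNtop).symm
          _ ≤ _ := ofReal_le_ofReal (by linarith)
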